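/- The simply graded Poincaré series of the mixed trace algebra of two generic 4×4 matrices satisfies P(T_{4,2}; t) = (1 − t + t³ + t⁵ − t⁷ + t⁸) / ((1−t)⁵(1−t²)⁴(1−t³)⁵(1−t⁴)³). -/

import Mathlib

open MvPolynomial Matrix

noncomputable section

/-- Index type for the entries of a pair of generic `n × n` matrices:
`Sum.inl (i,j)` indexes the `(i,j)` entry of `x`, `Sum.inr (i,j)` that of `y`. -/
abbrev MatVar (n : ℕ) := (Fin n × Fin n) ⊕ (Fin n × Fin n)

/-- The substitution sending the variables to the entries of the pair `(A, B)`. -/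
def pairSub {K : Type*} [CommSemiring K] {n : ℕ} (A B : Matrix (Fin n) (Fin n) K) :
    MatVar n → K
  | Sum.inl ij => A ij.1 ij.2
  | Sum.inr ij => B ij.1 ij.2

/-- A polynomial function on pairs of `n × n` matrices is `GLₙ`-invariant (for the action
by simultaneous conjugation). -/
def IsMatInvariant {K : Type*} [Field K] {n : ℕ} (f : MvPolynomial (MatVar n) K) : Prop :=
  ∀ (a : GL (Fin n) K) (A B : Matrix (Fin n) (Fin n) K),
    MvPolynomial.eval
        (pairSub ((a : Matrix (Fin n) (Fin n) K) * A * ((a⁻¹ : GL (Fin n) K) : Matrix (Fin n) (Fin n) K))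
          ((a : Matrix (Fin n) (Fin n) K) * B * ((a⁻¹ : GL (Fin n) K) : Matrix (Fin n) (Fin n) K))) f =
      MvPolynomial.eval (pairSub A B) f


/-- A polynomial map `M_n² → M_n`, given by a matrix of polynomials in the entries of the
pair `(x, y)`, is `GLₙ`-equivariant. -/
def IsMatEquivariant {K : Type*} [Field K] {n : ℕ}
    (M : Matrix (Fin n) (Fin n) (MvPolynomial (MatVar n) K)) : Prop :=
  ∀ (a : GL (Fin n) K) (A B : Matrix (Fin n) (Fin n) K),
    M.map (MvPolynomial.eval
        (pairSub ((a : Matrix (Fin n) (Fin n) K) * A * ((a⁻¹ : GL (Fin n) K) : Matrix (Fin n) (Fin n) K))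
          ((a : Matrix (Fin n) (Fin n) K) * B * ((a⁻¹ : GL (Fin n) K) : Matrix (Fin n) (Fin n) K)))) =
      (a : Matrix (Fin n) (Fin n) K) * M.map (MvPolynomial.eval (pairSub A B)) *
        ((a⁻¹ : GL (Fin n) K) : Matrix (Fin n) (Fin n) K)


/-- The homogeneous component of total degree `k` of the mixed trace algebra `T_{n,2}`. -/
def mixedComponent1 (K : Type*) [Field K] (n k : ℕ) :
    Set (Matrix (Fin n) (Fin n) (MvPolynomial (MatVar n) K)) :=
  {M | IsMatEquivariant M ∧ ∀ i j, (M i j).IsHomogeneous k}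

/-- `dim_K (T_{n,2})_k`. -/
def mixedDim1 (K : Type*) [Field K] (n k : ℕ) : ℕ :=
  Set.finrank K (mixedComponent1 K n k)

/-- The simply graded Poincaré series `P(T_{n,2}; t)`. -/
def mixedPS1 (K : Type*) [Field K] (n : ℕ) : PowerSeries ℚ :=
  PowerSeries.mk fun k => (mixedDim1 K n k : ℚ)

/-- The power series variable `t`. -/
def pu : PowerSeries ℚ := PowerSeries.X

set_option linter.unusedSectionVars false
set_option linter.unusedSimpArgs false


section Fischer
variable {V : Type*} [Fintype V] [DecidableEq V] {K : Type*} [Field K]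

def fWt (a : V →₀ ℕ) : ℕ := ∏ v, (a v).factorial

/-- Fischer pairing -/
def fB (p q : MvPolynomial V K) : K := ∑ a ∈ p.support, (fWt a : K) * coeff a p * coeff a q

lemma fB_eq_sum (p q : MvPolynomial V K) (s : Finset (V →₀ ℕ)) (h : p.support ⊆ s) :
    fB p q = ∑ a ∈ s, (fWt a : K) * coeff a p * coeff a q := by
  unfold fB
  apply Finset.sum_subset h
  intro a _ ha
  rw [notMem_support_iff.mp ha]; simp

lemma fB_add_left (p p' q : MvPolynomial V K) : fB (p + p') q = fB p q + fB p' q := by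
  rw [fB_eq_sum (p + p') q (p.support ∪ p'.support) support_add,
    fB_eq_sum p q (p.support ∪ p'.support) Finset.subset_union_left,
    fB_eq_sum p' q (p.support ∪ p'.support) Finset.subset_union_right, ← Finset.sum_add_distrib]
  apply Finset.sum_congr rfl
  intro a _
  rw [coeff_add]; ring

lemma fB_add_right (p q q' : MvPolynomial V K) : fB p (q + q') = fB p q + fB p q' := by
  unfold fB
  rw [← Finset.sum_add_distrib]
  apply Finset.sum_congr rfl
  intro a _
  rw [coeff_add]; ring

lemma fB_smul_right (c : K) (p q : MvPolynomial V K) : fB p (c • q) = c * fB p q := by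
  unfold fB
  rw [Finset.mul_sum]
  apply Finset.sum_congr rfl
  intro a _
  rw [coeff_smul, smul_eq_mul]; ring

lemma fB_smul_left (c : K) (p q : MvPolynomial V K) : fB (c • p) q = c * fB p q := by
  rw [fB_eq_sum (c • p) q p.support support_smul]
  unfold fB
  rw [Finset.mul_sum]
  apply Finset.sum_congr rfl
  intro a _
  rw [coeff_smul, smul_eq_mul]; ring

lemma fB_monomial (a : V →₀ ℕ) (c : K) (q : MvPolynomial V K) :
    fB (monomial a c) q = (fWt a : K) * c * coeff a q := by
  rw [fB_eq_sum _ q {a} support_monomial_subset]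
  simp

/-- linear in the second argument -/
def fBr (p : MvPolynomial V K) : MvPolynomial V K →ₗ[K] K where
  toFun := fB p
  map_add' := fB_add_right p
  map_smul' c q := by simp [fB_smul_right]

def fBl (q : MvPolynomial V K) : MvPolynomial V K →ₗ[K] K where
  toFun p := fB p q
  map_add' p p' := fB_add_left p p' q
  map_smul' c p := by simp [fB_smul_left]

lemma fB_pderiv (u : V) (p q : MvPolynomial V K) : fB (pderiv u p) q = fB p (q * X u) := by
  have : (fBl q).comp (pderiv u).toLinearMap = fBl (q * X u) := by
    ext a
    simp only [LinearMap.comp_apply]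
    change fB (pderiv u (monomial a 1)) q = fB (monomial a 1) (q * X u)
    rw [pderiv_monomial, fB_monomial, fB_monomial, coeff_mul_X']
    by_cases h : u ∈ a.support
    · have hu : a u ≠ 0 := by simpa using h
      rw [if_pos h]
      have : fWt a = fWt (a - Finsupp.single u 1) * a u := by
        unfold fWt
        rw [← Finset.mul_prod_erase _ _ (Finset.mem_univ u), ← Finset.mul_prod_erase (a := u) _ _ (Finset.mem_univ u)]
        have h1 : ∏ x ∈ Finset.univ.erase u, ((a - Finsupp.single u 1 : V →₀ ℕ) x).factorial = ∏ x ∈ Finset.univ.erase u, (a x).factorial := by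
          apply Finset.prod_congr rfl
          intro x hx
          have : x ≠ u := Finset.ne_of_mem_erase hx
          simp [Finsupp.single_apply, this.symm]
        rw [h1]
        obtain ⟨k, hk⟩ := Nat.exists_eq_succ_of_ne_zero hu
        simp [hk, Nat.factorial_succ]; ring
      rw [this]; push_cast; ring
    · have hu : a u = 0 := by simpa using h
      rw [if_neg h, hu]; simp
  exact LinearMap.congr_fun this p

/-- linear substitution -/
def lsub {R : Type*} [CommRing R] (G : Matrix V V R) : MvPolynomial V R →ₐ[R] MvPolynomial V R :=
  aeval fun v => ∑ u, C (G v u) * X u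

lemma lsub_X {R : Type*} [CommRing R] (G : Matrix V V R) (v : V) : lsub G (X v) = ∑ u, C (G v u) * X u := by
  simp [lsub]

lemma pderiv_lsub (G : Matrix V V K) (u : V) (p : MvPolynomial V K) :
    pderiv u (lsub G p) = ∑ v, C (G v u) * lsub G (pderiv v p) := by
  induction p using MvPolynomial.induction_on with
  | C a => simp [lsub]
  | add p q hp hq => simp only [map_add, hp, hq, mul_add, Finset.sum_add_distrib]
  | mul_X p w hp =>
    have h1 : pderiv u (lsub G (X w)) = C (G w u) := by
      rw [lsub_X, map_sum, Finset.sum_eq_single u]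
      · simp
      · intro b _ hb; simp [pderiv_X, hb.symm, Pi.single_apply]
      · simp
    have h2 : ∀ v, C (G v u) * lsub G (pderiv v (p * X w)) =
        lsub G (X w) * (C (G v u) * lsub G (pderiv v p)) + (if v = w then lsub G p * C (G w u) else 0) := by
      intro v
      rw [Derivation.leibniz, smul_eq_mul, smul_eq_mul, pderiv_X, map_add, map_mul, map_mul]
      by_cases hv : v = w
      · subst hv; rw [if_pos rfl, Pi.single_eq_same, map_one]; ring
      · rw [if_neg hv, Pi.single_eq_of_ne (Ne.symm hv), map_zero]; ring
    rw [Finset.sum_congr rfl (fun v _ => h2 v), Finset.sum_add_distrib, ← Finset.mul_sum, ← hp,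
      Finset.sum_ite_eq' Finset.univ w, if_pos (Finset.mem_univ w), map_mul, Derivation.leibniz, h1,
      smul_eq_mul, smul_eq_mul]
    ring

lemma fB_C (p : MvPolynomial V K) (a : K) : fB p (C a) = a * coeff 0 p := by
  classical
  rw [fB_eq_sum p _ (insert 0 p.support) (Finset.subset_insert _ _), Finset.sum_eq_single 0]
  · simp [fWt]; ring
  · intro b _ hb
    rw [coeff_C, if_neg hb.symm]; simp
  · simp

lemma coeff_zero_lsub (G : Matrix V V K) (p : MvPolynomial V K) : coeff 0 (lsub G p) = coeff 0 p := by
  have : (constantCoeff.comp (lsub G : MvPolynomial V K →+* MvPolynomial V K)) = (constantCoeff : MvPolynomial V K →+* K) := by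
    ext i <;> simp [lsub]
  exact RingHom.congr_fun this p

lemma fB_lsub (G : Matrix V V K) (p q : MvPolynomial V K) : fB (lsub G p) q = fB p (lsub Gᵀ q) := by
  induction q using MvPolynomial.induction_on generalizing p with
  | C a => rw [show lsub Gᵀ (C a) = C a by simp [lsub], fB_C, fB_C, coeff_zero_lsub]
  | add q q' h h' => rw [map_add, fB_add_right, fB_add_right, h, h']
  | mul_X q u h =>
    rw [← fB_pderiv, pderiv_lsub, map_mul, lsub_X, Finset.mul_sum]
    change fBl q _ = fBr p _
    rw [map_sum, map_sum]
    apply Finset.sum_congr rfl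
    intro v _
    rw [← smul_eq_C_mul, map_smul, Matrix.transpose_apply, ← smul_eq_C_mul, mul_smul_comm, map_smul]
    congr 1
    change fB _ _ = fB _ _
    rw [h, fB_pderiv]

end Fischer

lemma fB_self_rat {V : Type*} [Fintype V] (p : MvPolynomial V ℚ) (hp : p ≠ 0) : fB p p ≠ 0 := by
  apply ne_of_gt
  unfold fB
  apply Finset.sum_pos
  · intro a ha
    have h1 : coeff a p ≠ 0 := mem_support_iff.mp ha
    have h2 : 0 < fWt a := Finset.prod_pos fun v _ => Nat.factorial_pos _
    have : (0:ℚ) < fWt a := by exact_mod_cast h2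
    have h3 : 0 < coeff a p * coeff a p := mul_self_pos.mpr h1
    rw [mul_assoc]; positivity
  · rwa [Finset.nonempty_iff_ne_empty, Ne, support_eq_empty]

lemma fB_map {V : Type*} [Fintype V] [DecidableEq V] {K : Type*} [Field K] [CharZero K] (p q : MvPolynomial V ℚ) :
    fB (map (algebraMap ℚ K) p) (map (algebraMap ℚ K) q) = algebraMap ℚ K (fB p q) := by
  rw [fB_eq_sum _ _ p.support (support_map_subset _ _)]
  unfold fB
  rw [map_sum]
  simp only [coeff_map, map_mul, map_natCast]

section Lam
variable {n : ℕ} {K : Type*} [Field K] [CharZero K]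

/-- determinant of the generic matrix -/
def gdet (n : ℕ) (K : Type*) [CommRing K] : MvPolynomial (Fin n × Fin n) K := (mvPolynomialX (Fin n) (Fin n) K).det

lemma gdet_map {R S : Type*} [CommRing R] [CommRing S] (f : R →+* S) : map f (gdet n R) = gdet n S := by
  unfold gdet
  rw [RingHom.map_det]; congr 1
  ext i j; simp [mvPolynomialX]

lemma fB_gdet (M : ℕ) : fB (gdet n K ^ M) (gdet n K ^ M) ≠ 0 := by
  rw [← gdet_map (algebraMap ℚ K), ← map_pow, fB_map, Ne, map_eq_zero]
  exact fB_self_rat _ (pow_ne_zero _ (det_mvPolynomialX_ne_zero _ _))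

/-- the evaluation of a polynomial at a matrix -/
def evm {R : Type*} [CommRing R] (g : Matrix (Fin n) (Fin n) R) : MvPolynomial (Fin n × Fin n) R →+* R :=
  eval fun v => g v.1 v.2

/-- left multiplication matrix -/
def lmul {R : Type*} [CommRing R] (g : Matrix (Fin n) (Fin n) R) : Matrix (Fin n × Fin n) (Fin n × Fin n) R :=
  fun v u => g v.1 u.1 * if v.2 = u.2 then 1 else 0

lemma lmul_transpose (g : Matrix (Fin n) (Fin n) K) : (lmul g)ᵀ = lmul gᵀ := by
  ext v u; simp [lmul, eq_comm]

lemma evm_lsub {R : Type*} [CommRing R] (g x : Matrix (Fin n) (Fin n) R) (p : MvPolynomial (Fin n × Fin n) R) :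
    evm x (lsub (lmul g) p) = evm (g * x) p := by
  have : (evm x).comp (lsub (lmul g) : MvPolynomial (Fin n × Fin n) R →+* MvPolynomial (Fin n × Fin n) R) = evm (g * x) := by
    ext i
    · simp [evm, lsub]
    · simp only [RingHom.comp_apply, RingHom.coe_coe, lsub_X, lmul, evm]
      simp [Matrix.mul_apply, Fintype.sum_prod_type, ite_mul]
  exact RingHom.congr_fun this p

lemma evm_gdet {R : Type*} [CommRing R] (x : Matrix (Fin n) (Fin n) R) : evm x (gdet n R) = x.det := by
  unfold gdet evm
  rw [RingHom.map_det]; congr 1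
  ext i j; simp [mvPolynomialX]

lemma evm_ext {p q : MvPolynomial (Fin n × Fin n) K} (h : ∀ x, evm x p = evm x q) : p = q := by
  apply MvPolynomial.funext
  intro x
  exact h (fun i j => x (i, j))

/-- polynomials are determined on invertible matrices -/
lemma evm_ext' {p q : MvPolynomial (Fin n × Fin n) K} (h : ∀ x : Matrix (Fin n) (Fin n) K, x.det ≠ 0 → evm x p = evm x q) : p = q := by
  have h0 : gdet n K ≠ 0 := det_mvPolynomialX_ne_zero _ _
  apply mul_left_cancel₀ h0
  apply evm_ext
  intro x
  rw [map_mul, map_mul, evm_gdet]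
  by_cases hx : x.det = 0
  · simp [hx]
  · rw [h x hx]

/-- The functional -/
def Lam (n : ℕ) (K : Type*) [Field K] (M : ℕ) : MvPolynomial (Fin n × Fin n) K →ₗ[K] K :=
  (fB (gdet n K ^ M) (gdet n K ^ M))⁻¹ • fBr (gdet n K ^ M)

lemma Lam_gdet (M : ℕ) : Lam n K M (gdet n K ^ M) = 1 := by
  change (fB (gdet n K ^ M) (gdet n K ^ M))⁻¹ * fB (gdet n K ^ M) (gdet n K ^ M) = 1
  exact inv_mul_cancel₀ (fB_gdet M)

lemma lsub_gdet (g : Matrix (Fin n) (Fin n) K) : lsub (lmul g) (gdet n K) = C g.det * gdet n K := by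
  apply evm_ext
  intro x
  rw [evm_lsub, evm_gdet, map_mul, evm_gdet, Matrix.det_mul]
  simp [evm]

lemma Lam_lsub (M : ℕ) (g : Matrix (Fin n) (Fin n) K) (f : MvPolynomial (Fin n × Fin n) K) :
    Lam n K M (lsub (lmul g) f) = g.det ^ M * Lam n K M f := by
  change (fB (gdet n K ^ M) (gdet n K ^ M))⁻¹ * fB (gdet n K ^ M) _ = _ * ((fB (gdet n K ^ M) (gdet n K ^ M))⁻¹ * fB (gdet n K ^ M) _)
  have : lsub (lmul g) f = lsub (lmul gᵀ)ᵀ f := by rw [lmul_transpose, transpose_transpose]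
  rw [this, ← fB_lsub, map_pow, lsub_gdet, Matrix.det_transpose, mul_pow, ← map_pow, ← smul_eq_C_mul, fB_smul_left]
  ring

variable {ι : Type*} [Fintype ι] [DecidableEq ι]

/-- polynomial representation of the matrix monoid -/
structure PRep (D : Matrix ι ι (MvPolynomial (Fin n × Fin n) K)) : Prop where
  one : D.map (evm 1) = 1
  mul : ∀ g h, D.map (evm (g * h)) = D.map (evm g) * D.map (evm h)

def semi (D : Matrix ι ι (MvPolynomial (Fin n × Fin n) K)) (M : ℕ) : Submodule K (ι → K) where
  carrier := {v | ∀ g : Matrix (Fin n) (Fin n) K, g.det ≠ 0 → D.map (evm g) *ᵥ v = g.det ^ M • v}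
  add_mem' := by
    intro a b ha hb g hg
    rw [mulVec_add, ha g hg, hb g hg, smul_add]
  zero_mem' := by intro g hg; simp
  smul_mem' := by
    intro c v hv g hg
    rw [mulVec_smul, hv g hg, smul_comm]

theorem finrank_semi {D : Matrix ι ι (MvPolynomial (Fin n × Fin n) K)} (hD : PRep D) (M : ℕ) :
    (Module.finrank K (semi D M) : K) = Lam n K M D.trace := by
  set e : Matrix ι ι K := D.map (Lam n K M) with he
  have h1 : ∀ g, D.map (evm g) * e = g.det ^ M • e := by
    intro g
    ext i j
    rw [Matrix.mul_apply, Matrix.smul_apply, smul_eq_mul, he]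
    simp only [Matrix.map_apply]
    rw [← Lam_lsub]
    have : lsub (lmul g) (D i j) = ∑ k, evm g (D i k) • D k j := by
      apply evm_ext
      intro x
      rw [evm_lsub]
      have := congrFun (congrFun (hD.mul g x) i) j
      rw [Matrix.mul_apply] at this
      simp only [Matrix.map_apply] at this
      rw [this, map_sum]
      simp [smul_eq_C_mul, evm]
    rw [this, map_sum]
    simp
  have hproj : LinearMap.IsProj (semi D M) (Matrix.toLin' e) := by
    constructor
    · intro v g hg
      rw [Matrix.toLin'_apply, Matrix.mulVec_mulVec, h1, Matrix.smul_mulVec]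
    · intro v hv
      rw [Matrix.toLin'_apply]
      have h2 : ∀ i, ∑ j, v j • D i j = v i • gdet n K ^ M := by
        intro i
        apply evm_ext'
        intro x hx
        have := congrFun (hv x hx) i
        simp only [Matrix.mulVec, dotProduct, Matrix.map_apply, Pi.smul_apply, smul_eq_mul] at this
        rw [map_sum, smul_eq_C_mul, map_mul, map_pow, evm_gdet]
        simp only [smul_eq_C_mul, map_mul]
        have hC : ∀ c : K, evm x (C c) = c := by intro c; simp [evm]
        simp only [hC]
        rw [mul_comm (v i), ← this]
        apply Finset.sum_congr rfl; intros; ring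
      ext i
      have := congrArg (Lam n K M) (h2 i)
      rw [map_sum, map_smul, Lam_gdet] at this
      simp only [map_smul, smul_eq_mul, mul_one] at this
      rw [← this]
      simp only [Matrix.mulVec, dotProduct, he, Matrix.map_apply]
      apply Finset.sum_congr rfl; intros; ring
  have := hproj.trace
  rw [Matrix.trace_toLin'_eq] at this
  rw [← this, Matrix.trace, Matrix.trace, map_sum]
  rfl

end Lam


section subMat
variable {V : Type*} [Fintype V] [DecidableEq V] {R : Type*} [CommRing R] {Mo : Type*} [AddCommMonoid Mo]

def subMat (s : Finset (V →₀ ℕ)) (G : Matrix V V R) : Matrix s s R :=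
  fun m' m => coeff (m' : V →₀ ℕ) (lsub G (monomial (m : V →₀ ℕ) 1))

/-- the matrix respects weights -/
def WtMat (w : V → Mo) (G : Matrix V V R) : Prop := ∀ v u, w u = w v ∨ G v u = 0

lemma lsub_wh {w : V → Mo} {G : Matrix V V R} (hG : WtMat w G) (m : V →₀ ℕ) :
    IsWeightedHomogeneous w (lsub G (monomial m 1)) (Finsupp.weight w m) := by
  have : lsub G (monomial m 1) = ∏ v, (∑ u, C (G v u) * X u) ^ m v := by
    rw [monomial_eq, Finsupp.prod_fintype _ _ (by simp)]
    simp [lsub]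
  rw [this, Finsupp.weight_apply, Finsupp.sum_fintype _ _ (by simp)]
  apply IsWeightedHomogeneous.prod
  intro v _
  apply IsWeightedHomogeneous.pow
  apply IsWeightedHomogeneous.sum
  intro u _
  rcases hG v u with h | h
  · rw [← h]; exact (isWeightedHomogeneous_X R w u).C_mul _
  · rw [h]; simp [isWeightedHomogeneous_zero]

lemma lsub_lsub (G H : Matrix V V R) (p : MvPolynomial V R) : lsub G (lsub H p) = lsub (H * G) p := by
  have : (lsub G).comp (lsub H) = lsub (H * G) := by
    ext1 v
    rw [AlgHom.comp_apply, lsub_X, lsub_X, map_sum]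
    simp only [map_mul, lsub_X, Matrix.mul_apply, map_sum, Finset.sum_mul, Finset.mul_sum]
    rw [Finset.sum_comm]
    apply Finset.sum_congr rfl; intro u _
    apply Finset.sum_congr rfl; intro u' _
    simp [lsub]; ring
  exact AlgHom.congr_fun this p

lemma wh_eq_sum {w : V → Mo} {β : Mo} {s : Finset (V →₀ ℕ)} (hs : ∀ m, m ∈ s ↔ Finsupp.weight w m = β)
    {p : MvPolynomial V R} (hp : IsWeightedHomogeneous w p β) :
    p = ∑ m : s, coeff (m : V →₀ ℕ) p • monomial (m : V →₀ ℕ) 1 := by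
  ext d
  rw [coeff_sum]
  simp only [coeff_smul, coeff_monomial, smul_eq_mul, mul_ite, mul_one, mul_zero]
  rw [Finset.sum_coe_sort s (fun m => if m = d then coeff m p else 0), Finset.sum_ite_eq']
  split_ifs with h
  · rfl
  · by_contra h'
    exact h ((hs d).2 (hp h'))

lemma subMat_mul {w : V → Mo} {β : Mo} {s : Finset (V →₀ ℕ)} (hs : ∀ m, m ∈ s ↔ Finsupp.weight w m = β)
    (G H : Matrix V V R) (hH : WtMat w H) : subMat s G * subMat s H = subMat s (H * G) := by
  ext m' m
  rw [Matrix.mul_apply]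
  unfold subMat
  have h1 := lsub_wh hH (m : V →₀ ℕ)
  rw [(hs _).1 m.2] at h1
  have h2 := congrArg (fun p => coeff (m' : V →₀ ℕ) (lsub G p)) (wh_eq_sum hs h1)
  simp only [lsub_lsub, map_sum, coeff_sum, map_smul, coeff_smul, smul_eq_mul] at h2
  rw [h2]
  apply Finset.sum_congr rfl; intros; ring

lemma subMat_one (s : Finset (V →₀ ℕ)) : subMat s (1 : Matrix V V R) = 1 := by
  have : lsub (1 : Matrix V V R) = AlgHom.id _ _ := by
    ext1 v
    rw [lsub_X]
    simp [Matrix.one_apply, ite_mul]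
  ext m' m
  unfold subMat
  rw [this, AlgHom.id_apply, coeff_monomial, Matrix.one_apply]
  by_cases h : m' = m
  · rw [if_pos h, if_pos (by rw [h])]
  · rw [if_neg h, if_neg (fun h' => h (Subtype.ext h'.symm))]

lemma subMat_map {R' : Type*} [CommRing R'] (f : R →+* R') (s : Finset (V →₀ ℕ)) (G : Matrix V V R) :
    (subMat s G).map f = subMat s (G.map f) := by
  ext m' m
  rw [Matrix.map_apply]
  unfold subMat
  rw [← coeff_map]
  congr 1
  have : ((MvPolynomial.map f).comp (lsub G : MvPolynomial V R →+* MvPolynomial V R)) =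
    (lsub (G.map f) : MvPolynomial V R' →+* MvPolynomial V R').comp (MvPolynomial.map f) := by
    ext i
    · simp [lsub]
    · simp [lsub_X]
  have := RingHom.congr_fun this (monomial (m : V →₀ ℕ) 1)
  simpa using this

end subMat

section L2
variable {n : ℕ} {K : Type*} [Field K] [CharZero K]

def colw (v : Fin n × Fin n) : Fin n → ℕ := Pi.single v.2 1

lemma weight_colw (m : Fin n × Fin n →₀ ℕ) (j : Fin n) : Finsupp.weight colw m j = ∑ i, m (i, j) := by
  rw [Finsupp.weight_apply, Finsupp.sum_fintype _ _ (by simp), Finset.sum_apply, Fintype.sum_prod_type]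
  apply Finset.sum_congr rfl; intro i _
  simp [colw, Pi.single_apply]

lemma WtMat_lmul {R : Type*} [CommRing R] (g : Matrix (Fin n) (Fin n) R) : WtMat colw (lmul g) := by
  intro v u
  by_cases h : v.2 = u.2
  · left; simp [colw, h]
  · right; simp [lmul, h]

lemma lmul_mul {R : Type*} [CommRing R] (g h : Matrix (Fin n) (Fin n) R) : lmul (g * h) = lmul g * lmul h := by
  ext v u
  simp [lmul, Matrix.mul_apply, Fintype.sum_prod_type, Finset.sum_mul]

lemma lmul_one {R : Type*} [CommRing R] : lmul (1 : Matrix (Fin n) (Fin n) R) = 1 := by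
  ext v u
  simp only [lmul, Matrix.one_apply, Prod.ext_iff, ite_and]
  by_cases h1 : v.1 = u.1 <;> by_cases h2 : v.2 = u.2 <;> simp [h1, h2]

lemma lmul_map {R S : Type*} [CommRing R] [CommRing S] (f : R →+* S) (g : Matrix (Fin n) (Fin n) R) :
    (lmul g).map f = lmul (g.map f) := by
  ext v u
  simp [lmul, apply_ite f]

lemma gX_map (g : Matrix (Fin n) (Fin n) K) : (mvPolynomialX (Fin n) (Fin n) K).map (evm g) = g := by
  ext i j; simp [evm, mvPolynomialX]

lemma gadj_map (g : Matrix (Fin n) (Fin n) K) : (mvPolynomialX (Fin n) (Fin n) K).adjugate.map (evm g) = g.adjugate := by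
  rw [← RingHom.mapMatrix_apply, RingHom.map_adjugate, RingHom.mapMatrix_apply, gX_map]

def colS (n : ℕ) (β : Fin n → ℕ) : Finset (Fin n × Fin n →₀ ℕ) :=
  (Finset.univ.finsuppAntidiag (∑ j, β j)).filter fun m => ∀ j, ∑ i, m (i, j) = β j

lemma mem_colS (β : Fin n → ℕ) (m) : m ∈ colS n β ↔ Finsupp.weight colw m = β := by
  unfold colS
  rw [Finset.mem_filter, Finset.mem_finsuppAntidiag]
  constructor
  · rintro ⟨_, h⟩
    ext j; rw [weight_colw, h]
  · rintro h
    have h' : ∀ j, ∑ i, m (i, j) = β j := by intro j; rw [← weight_colw, h]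
    refine ⟨⟨?_, by simp⟩, h'⟩
    rw [Fintype.sum_prod_type, Finset.sum_comm]
    exact Finset.sum_congr rfl fun j _ => h' j

lemma evm_smul_wh {β : Fin n → ℕ} {p : MvPolynomial (Fin n × Fin n) K} (hp : IsWeightedHomogeneous colw p β)
    (c : K) (y : Matrix (Fin n) (Fin n) K) : evm (c • y) p = c ^ (∑ j, β j) * evm y p := by
  unfold evm
  rw [eval_eq', eval_eq', Finset.mul_sum]
  apply Finset.sum_congr rfl
  intro d hd
  have h1 := (mem_colS β d).2 (hp (mem_support_iff.mp hd))
  unfold colS at h1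
  rw [Finset.mem_filter, Finset.mem_finsuppAntidiag] at h1
  rw [← h1.1.1]
  simp only [Matrix.smul_apply, smul_eq_mul, mul_pow, Finset.prod_mul_distrib, Finset.prod_pow_eq_pow_sum]
  ring

variable {ι : Type*} [Fintype ι] [DecidableEq ι]

def Uw (D : Matrix ι ι (MvPolynomial (Fin n × Fin n) K)) (β : Fin n → ℕ) : Submodule K (ι → K) where
  carrier := {u | ∀ i, IsWeightedHomogeneous colw (∑ j, u j • D i j) β}
  add_mem' := by
    intro a b ha hb i
    simp only [Pi.add_apply, add_smul, Finset.sum_add_distrib]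
    exact (ha i).add (hb i)
  zero_mem' := by intro i; simp [isWeightedHomogeneous_zero]
  smul_mem' := by
    intro c v hv i
    simp only [Pi.smul_apply, smul_eq_mul, mul_smul, ← Finset.smul_sum]
    rw [smul_eq_C_mul]
    exact (hv i).C_mul c

/-- generic S -/
def Sadj (K : Type*) [Field K] (n : ℕ) (β : Fin n → ℕ) : Matrix (colS n β) (colS n β) (MvPolynomial (Fin n × Fin n) K) :=
  subMat (colS n β) (lmul (mvPolynomialX (Fin n) (Fin n) K).adjugate)

lemma Sadj_map (β : Fin n → ℕ) (g : Matrix (Fin n) (Fin n) K) :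
    (Sadj K n β).map (evm g) = subMat (colS n β) (lmul g.adjugate) := by
  unfold Sadj
  rw [subMat_map, lmul_map, gadj_map]

open Kronecker in
lemma PRep_kron {κ : Type*} [Fintype κ] [DecidableEq κ] {D : Matrix ι ι (MvPolynomial (Fin n × Fin n) K)}
    {E : Matrix κ κ (MvPolynomial (Fin n × Fin n) K)} (hD : PRep D) (hE : PRep E) :
    PRep (D ⊗ₖ E) := by
  have : ∀ g, (D ⊗ₖ E).map (evm g) = (D.map (evm g)) ⊗ₖ (E.map (evm g)) := by
    intro g; ext i j; simp [kroneckerMap_apply]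
  constructor
  · rw [this, hD.one, hE.one, one_kronecker_one]
  · intro g h
    rw [this, this, this, hD.mul, hE.mul, mul_kronecker_mul]

lemma PRep_Sadj (β : Fin n → ℕ) : PRep (Sadj K n β) := by
  constructor
  · rw [Sadj_map, Matrix.adjugate_one, lmul_one, subMat_one]
  · intro g h
    rw [Sadj_map, Sadj_map, Sadj_map, Matrix.adjugate_mul_distrib, lmul_mul, subMat_mul (mem_colS β) _ _ (WtMat_lmul _)]

def polyOf {β : Fin n → ℕ} (v : ι × colS n β → K) (i : ι) : MvPolynomial (Fin n × Fin n) K :=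
  ∑ m : colS n β, v (i, m) • monomial (m : Fin n × Fin n →₀ ℕ) 1

lemma polyOf_wh {β : Fin n → ℕ} (v : ι × colS n β → K) (i : ι) : IsWeightedHomogeneous colw (polyOf v i) β := by
  unfold polyOf
  apply IsWeightedHomogeneous.sum
  intro m _
  rw [smul_eq_C_mul]
  exact (isWeightedHomogeneous_monomial _ _ _ ((mem_colS β _).1 m.2)).C_mul _

lemma coeff_polyOf {β : Fin n → ℕ} (v : ι × colS n β → K) (i : ι) (m : colS n β) :
    coeff (m : Fin n × Fin n →₀ ℕ) (polyOf v i) = v (i, m) := by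
  unfold polyOf
  rw [coeff_sum, Finset.sum_eq_single m]
  · simp
  · intro b _ hb
    rw [coeff_smul, coeff_monomial, if_neg (fun h => hb (Subtype.ext h))]; simp
  · simp

lemma lsub_lmul_wh {β : Fin n → ℕ} {p : MvPolynomial (Fin n × Fin n) K} (hp : IsWeightedHomogeneous colw p β)
    (g : Matrix (Fin n) (Fin n) K) : IsWeightedHomogeneous colw (lsub (lmul g) p) β := by
  rw [wh_eq_sum (mem_colS β) hp, map_sum]
  apply IsWeightedHomogeneous.sum
  intro m _
  rw [map_smul, smul_eq_C_mul]
  have h := lsub_wh (WtMat_lmul g) (m : Fin n × Fin n →₀ ℕ)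
  rw [(mem_colS β _).1 m.2] at h
  exact h.C_mul _

open Kronecker in
lemma kron_apply (D : Matrix ι ι (MvPolynomial (Fin n × Fin n) K)) {β : Fin n → ℕ} (v : ι × colS n β → K)
    (g : Matrix (Fin n) (Fin n) K) (i : ι) (m : colS n β) :
    ((D ⊗ₖ Sadj K n β).map (evm g) *ᵥ v) (i, m) =
      coeff (m : Fin n × Fin n →₀ ℕ) (∑ j, evm g (D i j) • lsub (lmul g.adjugate) (polyOf v j)) := by
  rw [coeff_sum]
  simp only [Matrix.mulVec, dotProduct, Fintype.sum_prod_type, Matrix.map_apply, kroneckerMap_apply, map_mul]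
  apply Finset.sum_congr rfl
  intro j _
  rw [coeff_smul, polyOf, map_sum, coeff_sum, smul_eq_mul, Finset.mul_sum]
  apply Finset.sum_congr rfl
  intro m' _
  have := congrFun (congrFun (Sadj_map (K := K) β g) m) m'
  rw [Matrix.map_apply] at this
  rw [this, map_smul, coeff_smul, smul_eq_mul]
  unfold subMat
  ring

lemma wh_ext {β : Fin n → ℕ} {p q : MvPolynomial (Fin n × Fin n) K} (hp : IsWeightedHomogeneous colw p β)
    (hq : IsWeightedHomogeneous colw q β) (h : ∀ m : colS n β, coeff (m : Fin n × Fin n →₀ ℕ) p = coeff (m : Fin n × Fin n →₀ ℕ) q) :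
    p = q := by
  rw [wh_eq_sum (mem_colS β) hp, wh_eq_sum (mem_colS β) hq]
  simp [h]

set_option maxHeartbeats 1000000 in
open Kronecker in
theorem finrank_Uw {D : Matrix ι ι (MvPolynomial (Fin n × Fin n) K)} (hD : PRep D) (β : Fin n → ℕ) :
    (Module.finrank K (Uw D β) : K) = Lam n K (∑ j, β j) (D.trace * (Sadj K n β).trace) := by
  rw [← Matrix.trace_kronecker, ← finrank_semi (PRep_kron hD (PRep_Sadj β))]
  congr 1
  let φ : (ι → K) →ₗ[K] (ι × colS n β → K) :=
    { toFun := fun u im => coeff (im.2 : Fin n × Fin n →₀ ℕ) (∑ j, u j • D im.1 j)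
      map_add' := by intro a b; ext im; simp [add_smul, Finset.sum_add_distrib]
      map_smul' := by intro c a; ext im; simp [mul_smul, ← Finset.smul_sum] }
  have hφ : ∀ u i (m : colS n β), φ u (i, m) = coeff (m : Fin n × Fin n →₀ ℕ) (∑ j, u j • D i j) := fun _ _ _ => rfl
  have hpoly : ∀ u ∈ Uw D β, ∀ i, polyOf (φ u) i = ∑ j, u j • D i j := by
    intro u hu i
    apply wh_ext (polyOf_wh _ _) (hu i)
    intro m
    rw [coeff_polyOf, hφ]
  have hevD : ∀ (u : ι → K) g i, evm g (∑ j, u j • D i j) = ((D.map (evm g)) *ᵥ u) i := by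
    intro u g i
    rw [map_sum]
    simp only [Matrix.mulVec, dotProduct, Matrix.map_apply, smul_eq_C_mul, map_mul]
    apply Finset.sum_congr rfl
    intro j _
    rw [show evm g (C (u j)) = u j by simp [evm]]; ring
  have hker : Function.Injective (φ.domRestrict (Uw D β)) := by
    rw [← LinearMap.ker_eq_bot, LinearMap.ker_eq_bot']
    rintro ⟨u, hu⟩ h0
    ext i
    have h0' : φ u = 0 := h0
    have h1 := hpoly u hu i
    rw [h0'] at h1
    have h2 := congrArg (evm (1 : Matrix (Fin n) (Fin n) K)) h1
    rw [hevD, hD.one] at h2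
    simp [polyOf] at h2
    simpa using h2.symm
  have hrange : LinearMap.range (φ.domRestrict (Uw D β)) = semi (D ⊗ₖ Sadj K n β) (∑ j, β j) := by
    ext v
    constructor
    · rintro ⟨⟨u, hu⟩, rfl⟩ g hg
      change _ *ᵥ φ u = _ • φ u
      ext ⟨i, m⟩
      rw [kron_apply, Pi.smul_apply, hφ, ← coeff_smul]
      congr 1
      apply evm_ext
      intro y
      rw [map_sum, smul_eq_C_mul, map_mul, hevD, show ∀ c : K, evm y (C c) = c by intro c; simp [evm]]
      have h3 : g * (g.adjugate * y) = g.det • y := by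
        rw [← Matrix.mul_assoc, Matrix.mul_adjugate, smul_mul, one_mul]
      have h4 := evm_smul_wh (hu i) g.det y
      rw [hevD, hevD, ← h3, hD.mul, ← mulVec_mulVec] at h4
      rw [← h4]
      simp only [Matrix.mulVec, dotProduct, Matrix.map_apply]
      apply Finset.sum_congr rfl
      intro j _
      rw [hpoly u hu, smul_eq_C_mul, map_mul, evm_lsub, hevD]
      rw [show ∀ c : K, evm y (C c) = c by intro c; simp [evm]]
      simp only [Matrix.mulVec, dotProduct, Matrix.map_apply]
    · intro hv
      obtain ⟨u, hudef⟩ : ∃ u : ι → K, ∀ i, u i = evm 1 (polyOf v i) := ⟨_, fun _ => rfl⟩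
      have h5 : ∀ i, polyOf v i = ∑ j, u j • D i j := by
        intro i
        apply evm_ext'
        intro g hg
        have h6 : ∑ j, evm g (D i j) • lsub (lmul g.adjugate) (polyOf v j) = g.det ^ (∑ j, β j) • polyOf v i := by
          apply wh_ext (β := β)
          · apply IsWeightedHomogeneous.sum
            intro j _
            rw [smul_eq_C_mul]
            exact (lsub_lmul_wh (polyOf_wh v j) _).C_mul _
          · rw [smul_eq_C_mul]; exact (polyOf_wh v i).C_mul _
          · intro m
            rw [← kron_apply, hv g hg, coeff_smul, coeff_polyOf]; rfl
        have h7 := congrArg (evm g) h6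
        have hC : ∀ c : K, evm g (C c) = c := by intro c; simp [evm]
        rw [map_sum, smul_eq_C_mul, map_mul, hC] at h7
        have h8 : ∀ j, evm g (evm g (D i j) • lsub (lmul g.adjugate) (polyOf v j)) = g.det ^ (∑ j, β j) * (evm g (D i j) * u j) := by
          intro j
          rw [smul_eq_C_mul, map_mul, hC, evm_lsub, Matrix.adjugate_mul, evm_smul_wh (polyOf_wh v j), hudef]
          ring
        rw [Finset.sum_congr rfl fun j _ => h8 j, ← Finset.mul_sum] at h7
        rw [hevD, ← mul_left_cancel₀ (pow_ne_zero _ hg) h7]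
        rfl
      refine ⟨⟨u, fun i => ?_⟩, ?_⟩
      · have h9 := polyOf_wh v i
        rw [h5 i] at h9
        exact h9
      · rw [LinearMap.domRestrict_apply]
        ext ⟨i, m⟩
        rw [hφ, ← h5 i, coeff_polyOf]
  rw [← hrange, LinearMap.finrank_range_of_inj hker]

end L2


/-- geometric series -/
lemma geom_mul {R : Type*} [CommRing R] (y : R) :
    (PowerSeries.mk fun k => y ^ k) * (1 - PowerSeries.C y * PowerSeries.X) = 1 := by
  have h := PowerSeries.mk_one_mul_one_sub_eq_one R
  have h2 := congrArg (PowerSeries.rescale y) h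
  rw [map_mul, map_sub, map_one, PowerSeries.rescale_X] at h2
  have h3 : (PowerSeries.mk fun k => y ^ k) = PowerSeries.rescale y (PowerSeries.mk 1) := by
    ext k; simp [PowerSeries.coeff_rescale]
  rw [h3]; exact h2

lemma gen_mul {R V : Type*} [CommRing R] [Fintype V] [DecidableEq V] (y : V → R) :
    (PowerSeries.mk fun k => ∑ a ∈ Finset.univ.finsuppAntidiag k, ∏ v : V, y v ^ (a v)) *
      ∏ v : V, (1 - PowerSeries.C (y v) * PowerSeries.X) = 1 := by
  have : (PowerSeries.mk fun k => ∑ a ∈ Finset.univ.finsuppAntidiag k, ∏ v : V, y v ^ (a v)) =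
      ∏ v : V, PowerSeries.mk fun k => y v ^ k := by
    ext k
    rw [PowerSeries.coeff_prod]
    simp
  rw [this, ← Finset.prod_mul_distrib]
  simp [geom_mul]

section JT
variable {R : Type*} [CommRing R]

def hh {n : ℕ} (z : Fin n → R) (k : ℕ) : R := ∑ a ∈ Finset.univ.finsuppAntidiag k, ∏ i : Fin n, z i ^ (a i)

lemma JT_det (e1 e2 e3 e4 : R) (h : ℕ → R) (h0 : h 0 = 0) (h1 : h 1 = 0) (h2 : h 2 = 0) (h3 : h 3 = 1)
    (hr : ∀ m, h (m + 4) = e1 * h (m + 3) - e2 * h (m + 2) + e3 * h (m + 1) - e4 * h m) (N : ℕ) :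
    (Matrix.of fun i j : Fin 4 => h (3 + N + i - j)).det = e4 ^ N := by
  induction N with
  | zero =>
    rw [Matrix.det_of_isLowerTriangular]
    · simp [Fin.prod_univ_four, h3]
    · intro i j hij
      have hij' : i < j := hij
      fin_cases i <;> fin_cases j <;> simp_all
  | succ N ih =>
    have : (Matrix.of fun i j : Fin 4 => h (3 + (N + 1) + i - j)) =
        !![0, 1, 0, 0; 0, 0, 1, 0; 0, 0, 0, 1; -e4, e3, -e2, e1] * (Matrix.of fun i j : Fin 4 => h (3 + N + i - j)) := by
      ext i j
      rw [Matrix.mul_apply, Fin.sum_univ_four]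
      fin_cases i
      · simp [add_assoc, add_comm 1 N]
      · simp; congr 1
      · simp; congr 1
      · have := hr (3 + N - j)
        have hj : (j : ℕ) ≤ 3 := by omega
        simp
        rw [show 3 + (N + 1) + 3 - (j : ℕ) = 3 + N - j + 4 by omega, this,
          show 3 + N + 1 - (j : ℕ) = 3 + N - j + 1 by omega, show 3 + N + 2 - (j : ℕ) = 3 + N - j + 2 by omega,
          show 3 + N + 3 - (j : ℕ) = 3 + N - j + 3 by omega]
        ring
    rw [this, Matrix.det_mul, ih, pow_succ']
    congr 1
    simp [Matrix.det_succ_row_zero, Fin.sum_univ_succ, Fin.succAbove]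

lemma JT_hh (z : Fin 4 → R) (N : ℕ) (hN : 3 ≤ N) :
    ∑ σ : Equiv.Perm (Fin 4), ((Equiv.Perm.sign σ : ℤ) : R) * ∏ j : Fin 4, hh z (N + σ j - j) = (∏ i, z i) ^ N := by
  set H : PowerSeries R := PowerSeries.mk (hh z) with hH
  have hg : H * ∏ v : Fin 4, (1 - PowerSeries.C (z v) * PowerSeries.X) = 1 := gen_mul z
  let h : ℕ → R := fun m => PowerSeries.coeff m (PowerSeries.X ^ 3 * H)
  have hh' : ∀ m, h m = if 3 ≤ m then hh z (m - 3) else 0 := by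
    intro m; simp only [h]; rw [PowerSeries.coeff_X_pow_mul']; simp [hH]
  have hz0 : hh z 0 = 1 := by
    simp [hh]
  set e1 := z 0 + z 1 + z 2 + z 3 with he1
  set e2 := z 0 * z 1 + z 0 * z 2 + z 0 * z 3 + z 1 * z 2 + z 1 * z 3 + z 2 * z 3 with he2
  set e3 := z 0 * z 1 * z 2 + z 0 * z 1 * z 3 + z 0 * z 2 * z 3 + z 1 * z 2 * z 3 with he3
  set e4 := z 0 * z 1 * z 2 * z 3 with he4
  have hr : ∀ m, h (m + 4) = e1 * h (m + 3) - e2 * h (m + 2) + e3 * h (m + 1) - e4 * h m := by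
    intro m
    have h1 : PowerSeries.X ^ 3 * H = PowerSeries.C e1 * (PowerSeries.X * (PowerSeries.X ^ 3 * H))
        - PowerSeries.C e2 * (PowerSeries.X ^ 2 * (PowerSeries.X ^ 3 * H))
        + PowerSeries.C e3 * (PowerSeries.X ^ 3 * (PowerSeries.X ^ 3 * H))
        - PowerSeries.C e4 * (PowerSeries.X ^ 4 * (PowerSeries.X ^ 3 * H)) + PowerSeries.X ^ 3 := by
      rw [Fin.prod_univ_four] at hg
      rw [he1, he2, he3, he4]
      simp only [map_add, map_mul]
      linear_combination (PowerSeries.X ^ 3) * hg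
    have h2 := congrArg (PowerSeries.coeff (m + 4)) h1
    rw [map_add, map_sub, map_add, map_sub] at h2
    simp only [PowerSeries.coeff_C_mul] at h2
    have := PowerSeries.coeff_X_pow_mul (PowerSeries.X ^ 3 * H) 2 (m + 2)
    have h3 := PowerSeries.coeff_X_pow_mul (PowerSeries.X ^ 3 * H) 3 (m + 1)
    have h4 := PowerSeries.coeff_X_pow_mul (PowerSeries.X ^ 3 * H) 4 m
    rw [show m + 2 + 2 = m + 4 by ring] at this
    rw [show m + 1 + 3 = m + 4 by ring] at h3
    rw [this, h3, h4, show m + 4 = (m + 3) + 1 by ring, PowerSeries.coeff_succ_X_mul, PowerSeries.coeff_X_pow, if_neg (by omega), add_zero] at h2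
    exact h2
  have hdet := JT_det e1 e2 e3 e4 h (by simp [hh']) (by simp [hh']) (by simp [hh']) (by simp [hh', hz0]) hr N
  rw [Fin.prod_univ_four, ← hdet, Matrix.det_apply]
  apply Finset.sum_congr rfl
  intro σ _
  rw [Units.smul_def, zsmul_eq_mul]
  congr 1
  apply Finset.prod_congr rfl
  intro j _
  rw [Matrix.of_apply, hh', if_pos (by omega)]
  congr 1; omega

end JT

section diag
variable {n : ℕ} {F : Type*} [Field F]

def Tr {R : Type*} [CommRing R] (β : Fin n → ℕ) (A : Matrix (Fin n) (Fin n) R) : R := (subMat (colS n β) (lmul A)).trace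

lemma Tr_map {R S : Type*} [CommRing R] [CommRing S] (f : R →+* S) (β : Fin n → ℕ) (A : Matrix (Fin n) (Fin n) R) :
    f (Tr β A) = Tr β (A.map f) := by
  unfold Tr
  rw [← lmul_map, ← subMat_map]
  simp [Matrix.trace]

lemma Tr_comm {R : Type*} [CommRing R] (β : Fin n → ℕ) (A B : Matrix (Fin n) (Fin n) R) : Tr β (A * B) = Tr β (B * A) := by
  unfold Tr
  rw [lmul_mul, lmul_mul, ← subMat_mul (mem_colS β) _ _ (WtMat_lmul _), ← subMat_mul (mem_colS β) _ _ (WtMat_lmul _),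
    Matrix.trace_mul_comm]

set_option maxHeartbeats 1000000 in
lemma Tr_diag {R : Type*} [CommRing R] (β : Fin n → ℕ) (z : Fin n → R) : Tr β (Matrix.diagonal z) = ∏ j, hh z (β j) := by
  have h1 : ∀ m : Fin n × Fin n →₀ ℕ, lsub (lmul (Matrix.diagonal z)) (monomial m 1) = monomial m (∏ v : Fin n × Fin n, z v.1 ^ m v) := by
    intro m
    rw [monomial_eq, Finsupp.prod_fintype _ _ (by simp)]
    have : ∀ v : Fin n × Fin n, lsub (lmul (Matrix.diagonal z)) (X v) = C (z v.1) * X v := by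
      intro v
      rw [lsub_X, Finset.sum_eq_single v]
      · simp [lmul]
      · intro u _ hu
        have : ¬ (v.1 = u.1 ∧ v.2 = u.2) := fun h => hu (Prod.ext h.1.symm h.2.symm)
        simp only [lmul, Matrix.diagonal_apply]
        by_cases h1 : v.1 = u.1 <;> by_cases h2 : v.2 = u.2 <;> simp_all
      · simp
    rw [C_1, one_mul, map_prod, monomial_eq, Finsupp.prod_fintype _ _ (by simp), map_prod, ← Finset.prod_mul_distrib]
    apply Finset.prod_congr rfl
    intro v _
    rw [map_pow, this, mul_pow, C_pow]
  have h2 : Tr β (Matrix.diagonal z) = ∑ m ∈ colS n β, ∏ v : Fin n × Fin n, z v.1 ^ m v := by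
    unfold Tr Matrix.trace
    rw [← Finset.sum_coe_sort (colS n β) (fun m => ∏ v : Fin n × Fin n, z v.1 ^ m v)]
    apply Finset.sum_congr rfl
    intro m _
    have h3 : (subMat (colS n β) (lmul (Matrix.diagonal z))).diag m = coeff (m : Fin n × Fin n →₀ ℕ) (lsub (lmul (Matrix.diagonal z)) (monomial (m : Fin n × Fin n →₀ ℕ) 1)) := rfl
    rw [h3, h1, coeff_monomial, if_pos rfl]
  rw [h2]
  unfold hh
  rw [Finset.prod_univ_sum]
  symm
  refine Finset.sum_bij' (fun a _ => Finsupp.equivFunOnFinite.symm fun v : Fin n × Fin n => a v.2 v.1)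
    (fun m _ j => Finsupp.equivFunOnFinite.symm fun i => m (i, j)) ?_ ?_ ?_ ?_ ?_
  · intro a ha
    rw [mem_colS]
    ext j
    rw [weight_colw]
    have := (Fintype.mem_piFinset.1 ha) j
    rw [Finset.mem_finsuppAntidiag] at this
    simpa using this.1
  · intro m hm
    rw [Fintype.mem_piFinset]
    intro j
    rw [Finset.mem_finsuppAntidiag]
    refine ⟨?_, by simp⟩
    rw [← (mem_colS β m).1 hm, weight_colw]
    simp
  · intro a _; ext j i; simp
  · intro m _; ext v; simp
  · intro a _
    rw [Fintype.prod_prod_type, Finset.prod_comm]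
    simp

lemma exists_diag [IsAlgClosed F] (A : Matrix (Fin n) (Fin n) F) (h : A.charpoly.Separable) :
    ∃ (P : Matrix (Fin n) (Fin n) F) (z : Fin n → F), IsUnit P ∧ A * P = P * Matrix.diagonal z := by
  classical
  have hnd := Polynomial.nodup_roots h
  have hcard : A.charpoly.roots.card = n := by
    rw [← (IsAlgClosed.splits A.charpoly).natDegree_eq_card_roots, Matrix.charpoly_natDegree_eq_dim]; simp
  have hc2 : A.charpoly.roots.toFinset.card = n := by rw [Multiset.toFinset_card_of_nodup hnd, hcard]
  let eq := (Finset.equivFinOfCardEq hc2).symm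
  let z : Fin n → F := fun i => (eq i : F)
  have hz : Function.Injective z := fun i j hij => eq.injective (Subtype.ext hij)
  have hroot : ∀ i, A.charpoly.IsRoot (z i) := by
    intro i
    have := (eq i).2
    rw [Multiset.mem_toFinset] at this
    exact Polynomial.isRoot_of_mem_roots this
  have hev : ∀ i, ∃ v, Module.End.HasEigenvector (Matrix.toLin' A) (z i) v := by
    intro i
    have : Module.End.HasEigenvalue (Matrix.toLin' A) (z i) := by
      rw [Module.End.hasEigenvalue_iff_isRoot_charpoly, Matrix.charpoly_toLin']
      exact hroot i
    exact this.exists_hasEigenvector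
  choose v hv using hev
  have hli := Module.End.eigenvectors_linearIndependent' (Matrix.toLin' A) z hz v hv
  refine ⟨Matrix.of fun i j => v j i, z, ?_, ?_⟩
  · rw [← Matrix.linearIndependent_cols_iff_isUnit]
    exact hli
  · ext i j
    have := congrFun (hv j).apply_eq_smul i
    rw [Matrix.toLin'_apply] at this
    rw [Matrix.mul_diagonal, Matrix.mul_apply]
    simp only [Matrix.of_apply]
    simp only [Matrix.mulVec, dotProduct, Pi.smul_apply, smul_eq_mul] at this
    rw [this, mul_comm]

lemma poly_dense [CharZero F] (hn : 0 < n) (p : MvPolynomial (Fin n × Fin n) F)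
    (h : ∀ A : Matrix (Fin n) (Fin n) F, A.charpoly.Separable → evm A p = 0) : p = 0 := by
  set Y := mvPolynomialX (Fin n) (Fin n) F with hY
  set δ := Polynomial.resultant Y.charpoly (Polynomial.derivative Y.charpoly) n (n - 1) with hδ
  have hev : ∀ A : Matrix (Fin n) (Fin n) F, evm A δ = Polynomial.resultant A.charpoly (Polynomial.derivative A.charpoly) := by
    intro A
    rw [hδ, ← Polynomial.resultant_map_map, ← Polynomial.derivative_map, ← Matrix.charpoly_map, gX_map]
    rw [Polynomial.natDegree_derivative, Matrix.charpoly_natDegree_eq_dim]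
    simp
  have hδ0 : δ ≠ 0 := by
    intro h0
    have := hev (Matrix.diagonal fun i => ((i : ℕ) : F))
    rw [h0, map_zero] at this
    refine Polynomial.resultant_ne_zero _ _ ?_ this.symm
    change Polynomial.Separable _
    rw [Matrix.charpoly_diagonal]
    rw [Polynomial.separable_prod_X_sub_C_iff]
    intro i j hij
    have hij' : ((i : ℕ) : F) = ((j : ℕ) : F) := hij
    exact Fin.ext (Nat.cast_injective hij')
  have : δ * p = 0 := by
    apply evm_ext
    intro A
    rw [map_mul, map_zero, hev]
    by_cases hA : A.charpoly.Separable
    · rw [h A hA, mul_zero]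
    · have : Polynomial.resultant A.charpoly (Polynomial.derivative A.charpoly) = 0 := by
        rw [Polynomial.resultant_eq_zero_iff]
        refine ⟨Or.inl (Matrix.charpoly_monic A).ne_zero, hA⟩
      rw [this, zero_mul]
  exact (mul_eq_zero.1 this).resolve_left hδ0

lemma JT_field [CharZero F] (A : Matrix (Fin 4) (Fin 4) F) (N : ℕ) (hN : 3 ≤ N) :
    ∑ σ : Equiv.Perm (Fin 4), ((Equiv.Perm.sign σ : ℤ) : F) * Tr (fun j => N + σ j - j) A = A.det ^ N := by
  let L := AlgebraicClosure F
  have : CharZero L := charZero_of_injective_algebraMap (algebraMap F L).injective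
  have key : ∑ σ : Equiv.Perm (Fin 4), ((Equiv.Perm.sign σ : ℤ) : MvPolynomial (Fin 4 × Fin 4) L) * Tr (fun j => N + σ j - j) (mvPolynomialX (Fin 4) (Fin 4) L) - gdet 4 L ^ N = 0 := by
    apply poly_dense (by norm_num)
    intro A hA
    obtain ⟨P, z, hP, hAP⟩ := exists_diag A hA
    have hPd : IsUnit P.det := (Matrix.isUnit_iff_isUnit_det P).1 hP
    have hA' : A = P * (Matrix.diagonal z * P⁻¹) := by
      rw [← Matrix.mul_assoc, ← hAP, Matrix.mul_assoc, Matrix.mul_nonsing_inv _ hPd, Matrix.mul_one]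
    have hTr : ∀ β, Tr β A = Tr β (Matrix.diagonal z) := by
      intro β
      rw [hA', Tr_comm, Matrix.mul_assoc, Matrix.nonsing_inv_mul _ hPd, Matrix.mul_one]
    have hdet : A.det = ∏ i, z i := by
      rw [hA', Matrix.det_mul_comm, Matrix.mul_assoc, Matrix.nonsing_inv_mul _ hPd, Matrix.mul_one, Matrix.det_diagonal]
    rw [map_sub, map_pow, evm_gdet, map_sum, hdet, ← JT_hh z N hN, sub_eq_zero]
    apply Finset.sum_congr rfl
    intro σ _
    rw [map_mul, map_intCast, Tr_map, gX_map, hTr, Tr_diag]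
  apply (algebraMap F L).injective
  have := congrArg (evm (A.map (algebraMap F L))) key
  rw [map_sub, map_pow, evm_gdet, map_sum, map_zero, sub_eq_zero] at this
  rw [map_pow, RingHom.map_det, RingHom.mapMatrix_apply, ← this, map_sum]
  apply Finset.sum_congr rfl
  intro σ _
  rw [map_mul, map_intCast, Tr_map, map_mul, map_intCast, Tr_map, gX_map]

end diag

lemma gdet_dummy : True := trivial

section L4
variable {K : Type*} [Field K] [CharZero K] {ι : Type*} [Fintype ι] [DecidableEq ι]

set_option maxHeartbeats 1000000 in
theorem finrank_semi_eq {D : Matrix ι ι (MvPolynomial (Fin 4 × Fin 4) K)} (hD : PRep D) (N : ℕ) (hN : 3 ≤ N) :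
    (Module.finrank K (semi D N) : ℤ) =
      ∑ σ : Equiv.Perm (Fin 4), (Equiv.Perm.sign σ : ℤ) * (Module.finrank K (Uw D fun j => N + σ j - j) : ℤ) := by
  have hsum : ∀ σ : Equiv.Perm (Fin 4), ∑ j, (N + σ j - j : ℕ) = 4 * N := by
    intro σ
    have h1 : ∑ j, ((N + σ j - j : ℕ) + (j : ℕ)) = ∑ j : Fin 4, (N + (σ j : ℕ)) :=
      Finset.sum_congr rfl fun j _ => by omega
    rw [Finset.sum_add_distrib, Finset.sum_add_distrib, Equiv.sum_comp σ (fun j => (j : ℕ))] at h1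
    simpa using h1
  have hS : ∀ (β : Fin 4 → ℕ) g, evm g (Sadj K 4 β).trace = Tr β g.adjugate := by
    intro β g
    have h1 := Sadj_map β g
    unfold Tr
    rw [← h1]
    unfold Matrix.trace
    rw [map_sum]
    rfl
  have hT : ∑ σ : Equiv.Perm (Fin 4), ((Equiv.Perm.sign σ : ℤ) : MvPolynomial (Fin 4 × Fin 4) K) * (Sadj K 4 fun j => N + σ j - j).trace
      = gdet 4 K ^ (3 * N) := by
    apply evm_ext
    intro g
    rw [map_sum, map_pow, evm_gdet, pow_mul]
    have := JT_field g.adjugate N hN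
    rw [Matrix.det_adjugate] at this
    simp only [Fintype.card_fin] at this
    rw [← this]
    apply Finset.sum_congr rfl
    intro σ _
    rw [map_mul, map_intCast]
    rw [hS]
  have hE : PRep (gdet 4 K ^ (3 * N) • D) := by
    have : ∀ g, (gdet 4 K ^ (3 * N) • D).map (evm g) = g.det ^ (3 * N) • D.map (evm g) := by
      intro g; ext i j; simp [evm_gdet]
    constructor
    · rw [this, hD.one]; simp
    · intro g h
      rw [this, this, this, hD.mul, Matrix.det_mul, mul_pow, smul_mul_smul_comm]
  have hsemi : semi (gdet 4 K ^ (3 * N) • D) (4 * N) = semi D N := by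
    have : ∀ g, (gdet 4 K ^ (3 * N) • D).map (evm g) = g.det ^ (3 * N) • D.map (evm g) := by
      intro g; ext i j; simp [evm_gdet]
    ext v
    change (∀ g : Matrix (Fin 4) (Fin 4) K, _ → _) ↔ (∀ g : Matrix (Fin 4) (Fin 4) K, _ → _)
    apply forall_congr'; intro g
    apply forall_congr'; intro hg
    rw [this, Matrix.smul_mulVec, show 4 * N = 3 * N + N by ring, pow_add, mul_smul]
    exact (smul_right_injective _ (pow_ne_zero _ hg)).eq_iff
  have h1 := finrank_semi hE (4 * N)
  rw [hsemi, Matrix.trace_smul, ← hT, smul_eq_mul, Finset.sum_mul, map_sum] at h1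
  have : ((Module.finrank K (semi D N) : ℤ) : K) = ((∑ σ : Equiv.Perm (Fin 4), (Equiv.Perm.sign σ : ℤ) * (Module.finrank K (Uw D fun j => N + σ j - j) : ℤ) : ℤ) : K) := by
    push_cast
    rw [h1]
    apply Finset.sum_congr rfl
    intro σ _
    rw [finrank_Uw hD, hsum, mul_comm D.trace, mul_assoc, ← zsmul_eq_mul, map_zsmul, zsmul_eq_mul]
  exact_mod_cast this

end L4


section count
variable {n : ℕ} {K : Type*} [Field K] [CharZero K] {ι : Type*} [Fintype ι] [DecidableEq ι]

lemma mem_Uw_iff {D : Matrix ι ι (MvPolynomial (Fin n × Fin n) K)} (hD : PRep D) (wt : ι → Fin n → ℕ)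
    (hcol : ∀ i b, IsWeightedHomogeneous colw (D i b) (wt b)) (β : Fin n → ℕ) (u : ι → K) :
    u ∈ Uw D β ↔ ∀ b, wt b ≠ β → u b = 0 := by
  constructor
  · intro hu b hb
    have h1 := hu b
    have h2 := h1.weightedHomogeneousComponent_ne (wt b) hb
    rw [map_sum] at h2
    have h3 : ∀ j, weightedHomogeneousComponent colw (wt b) (u j • D b j) = if wt j = wt b then u j • D b j else 0 := by
      intro j
      rw [map_smul]
      split_ifs with h
      · rw [← h, (hcol b j).weightedHomogeneousComponent_same]
      · rw [(hcol b j).weightedHomogeneousComponent_ne (wt b) (Ne.symm h), smul_zero]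
    simp only [h3] at h2
    have h4 := congrArg (evm (1 : Matrix (Fin n) (Fin n) K)) h2
    rw [map_sum, map_zero, Finset.sum_eq_single b] at h4
    · rw [if_pos rfl, smul_eq_C_mul, map_mul] at h4
      have h5 := congrFun (congrFun hD.one b) b
      rw [Matrix.map_apply] at h5
      rw [h5] at h4
      simpa [evm] using h4
    · intro j _ hj
      split_ifs with h
      · have h5 := congrFun (congrFun hD.one b) j
        rw [Matrix.map_apply, Matrix.one_apply_ne hj.symm] at h5
        rw [smul_eq_C_mul, map_mul, h5, mul_zero]
      · simp
    · simp
  · intro h i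
    apply IsWeightedHomogeneous.sum
    intro j _
    by_cases hj : wt j = β
    · rw [smul_eq_C_mul, ← hj]; exact (hcol i j).C_mul _
    · rw [h j hj, zero_smul]; exact isWeightedHomogeneous_zero _ _ _

lemma finrank_Uw_count {D : Matrix ι ι (MvPolynomial (Fin n × Fin n) K)} (hD : PRep D) (wt : ι → Fin n → ℕ)
    (hcol : ∀ i b, IsWeightedHomogeneous colw (D i b) (wt b)) (β : Fin n → ℕ) :
    Module.finrank K (Uw D β) = (Finset.univ.filter fun b => wt b = β).card := by
  let e : Uw D β ≃ₗ[K] ({b // wt b = β} → K) :=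
    { toFun := fun u b => u.1 b.1
      map_add' := by intro a b; rfl
      map_smul' := by intro a b; rfl
      invFun := fun f => ⟨fun b => if h : wt b = β then f ⟨b, h⟩ else 0, by
        rw [mem_Uw_iff hD wt hcol]
        intro b hb
        rw [dif_neg hb]⟩
      left_inv := by
        intro u
        ext b
        by_cases h : wt b = β
        · simp [h]
        · simp only [dif_neg h]
          exact ((mem_Uw_iff hD wt hcol β u.1).1 u.2 b h).symm
      right_inv := by
        intro f; ext b; simp [b.2] }
  rw [e.finrank_eq, Module.finrank_fintype_fun_eq_card, Fintype.card_subtype]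

end count

section concrete
variable {K : Type*} [Field K] [CharZero K]

abbrev sK (k : ℕ) : Finset (MatVar 4 →₀ ℕ) := Finset.univ.finsuppAntidiag k

lemma mem_sK (k : ℕ) (m : MatVar 4 →₀ ℕ) : m ∈ sK k ↔ Finsupp.weight (fun _ : MatVar 4 => (1 : ℕ)) m = k := by
  rw [Finset.mem_finsuppAntidiag, Finsupp.weight_apply, Finsupp.sum_fintype _ _ (by simp)]
  simp

open Kronecker in
def Gm {R : Type*} [CommRing R] (g : Matrix (Fin 4) (Fin 4) R) : Matrix (MatVar 4) (MatVar 4) R :=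
  Matrix.fromBlocks (g.adjugate ⊗ₖ gᵀ) 0 0 (g.adjugate ⊗ₖ gᵀ)

lemma Gm_one {R : Type*} [CommRing R] : Gm (1 : Matrix (Fin 4) (Fin 4) R) = 1 := by
  unfold Gm
  rw [Matrix.adjugate_one, Matrix.transpose_one, Matrix.one_kronecker_one, Matrix.fromBlocks_one]

lemma Gm_mul {R : Type*} [CommRing R] (g h : Matrix (Fin 4) (Fin 4) R) : Gm (g * h) = Gm h * Gm g := by
  unfold Gm
  rw [Matrix.adjugate_mul_distrib, Matrix.transpose_mul, Matrix.mul_kronecker_mul, Matrix.fromBlocks_multiply]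
  simp

lemma Gm_map (g : Matrix (Fin 4) (Fin 4) K) : (Gm (mvPolynomialX (Fin 4) (Fin 4) K)).map (evm g) = Gm g := by
  unfold Gm
  rw [Matrix.fromBlocks_map]
  have h1 := gX_map g
  have h2 := gadj_map g
  congr 1
  · ext i j
    have a1 := congrFun (congrFun h1 j.2) i.2
    have a2 := congrFun (congrFun h2 i.1) j.1
    rw [Matrix.map_apply] at a1 a2
    simp only [Matrix.map_apply, kroneckerMap_apply, map_mul, a2, Matrix.transpose_apply, a1]
  · ext i j
    have a1 := congrFun (congrFun h1 j.2) i.2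
    have a2 := congrFun (congrFun h2 i.1) j.1
    rw [Matrix.map_apply] at a1 a2
    simp only [Matrix.map_apply, kroneckerMap_apply, map_mul, a2, Matrix.transpose_apply, a1]

abbrev II (k : ℕ) := (Fin 4 × Fin 4) × sK k

open Kronecker in
def Dk (K : Type*) [Field K] (k : ℕ) : Matrix (II k) (II k) (MvPolynomial (Fin 4 × Fin 4) K) :=
  gdet 4 K ^ 3 • (((mvPolynomialX (Fin 4) (Fin 4) K) ⊗ₖ (mvPolynomialX (Fin 4) (Fin 4) K).adjugateᵀ) ⊗ₖ
    subMat (sK k) (Gm (mvPolynomialX (Fin 4) (Fin 4) K)))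

lemma PRep_X : PRep (mvPolynomialX (Fin 4) (Fin 4) K) := by
  constructor
  · rw [gX_map]
  · intro g h; rw [gX_map, gX_map, gX_map]

lemma PRep_adjT : PRep (mvPolynomialX (Fin 4) (Fin 4) K).adjugateᵀ := by
  constructor
  · rw [Matrix.transpose_map, gadj_map]; simp
  · intro g h
    rw [Matrix.transpose_map, gadj_map, Matrix.transpose_map, gadj_map, Matrix.transpose_map, gadj_map,
      Matrix.adjugate_mul_distrib, Matrix.transpose_mul]

lemma PRep_sub (k : ℕ) : PRep (subMat (sK k) (Gm (mvPolynomialX (Fin 4) (Fin 4) K))) := by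
  constructor
  · rw [subMat_map, Gm_map, Gm_one, subMat_one]
  · intro g h
    rw [subMat_map, Gm_map, subMat_map, Gm_map, subMat_map, Gm_map, Gm_mul,
      subMat_mul (mem_sK k) _ _ (fun _ _ => Or.inl rfl)]

lemma PRep_smul {ι : Type*} [Fintype ι] [DecidableEq ι] {D : Matrix ι ι (MvPolynomial (Fin 4 × Fin 4) K)} (hD : PRep D) (N : ℕ) :
    PRep (gdet 4 K ^ N • D) := by
  have : ∀ g, (gdet 4 K ^ N • D).map (evm g) = g.det ^ N • D.map (evm g) := by
    intro g; ext i j; simp [evm_gdet]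
  constructor
  · rw [this, hD.one]; simp
  · intro g h
    rw [this, this, this, hD.mul, Matrix.det_mul, mul_pow, smul_mul_smul_comm]

lemma PRep_Dk (k : ℕ) : PRep (Dk K k) := PRep_smul (PRep_kron (PRep_kron PRep_X PRep_adjT) (PRep_sub k)) 3

/-! weights -/
def wadj (i : Fin 4) : Fin 4 → ℕ := ∑ l : Fin 3, Pi.single (i.succAbove l) 1

lemma wadj_add (i : Fin 4) : wadj i + Pi.single i 1 = 1 := by
  revert i; unfold wadj; decide

lemma wh_X (i j : Fin 4) : IsWeightedHomogeneous colw (mvPolynomialX (Fin 4) (Fin 4) K i j) (Pi.single j 1) :=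
  isWeightedHomogeneous_X K colw (i, j)

lemma wh_smul_units {p : MvPolynomial (Fin 4 × Fin 4) K} {w : Fin 4 → ℕ} (hp : IsWeightedHomogeneous colw p w) (u : ℤˣ) :
    IsWeightedHomogeneous colw (u • p) w := by
  rcases Int.units_eq_one_or u with h | h
  · rw [h, one_smul]; exact hp
  · rw [h]; simp only [Units.neg_smul, one_smul]
    rw [show -p = C (-1) * p by simp]; exact hp.C_mul _

lemma wh_adj (i j : Fin 4) : IsWeightedHomogeneous colw ((mvPolynomialX (Fin 4) (Fin 4) K).adjugate i j) (wadj i) := by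
  rw [Matrix.adjugate_fin_succ_eq_det_submatrix, show ((-1 : MvPolynomial (Fin 4 × Fin 4) K) ^ (j + i : ℕ)) = C ((-1) ^ (j + i : ℕ)) by simp]
  apply IsWeightedHomogeneous.C_mul
  rw [Matrix.det_apply]
  apply IsWeightedHomogeneous.sum
  intro σ _
  apply wh_smul_units
  apply IsWeightedHomogeneous.prod
  intro l _
  exact wh_X _ _

lemma wh_det : IsWeightedHomogeneous colw (gdet 4 K) 1 := by
  have : gdet 4 K = (mvPolynomialX (Fin 4) (Fin 4) K).det := rfl
  rw [this, Matrix.det_apply, show (1 : Fin 4 → ℕ) = ∑ i : Fin 4, Pi.single i 1 by decide]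
  apply IsWeightedHomogeneous.sum
  intro σ _
  apply wh_smul_units
  apply IsWeightedHomogeneous.prod
  intro l _
  exact wh_X _ _

def pr (v : MatVar 4) : Fin 4 × Fin 4 := Sum.elim id id v

lemma coeff_lsub_wh {V : Type*} [Fintype V] [DecidableEq V] (G : Matrix V V (MvPolynomial (Fin 4 × Fin 4) K)) (w : V → Fin 4 → ℕ)
    (hG : ∀ v u, IsWeightedHomogeneous colw (G v u) (w v)) (m m' : V →₀ ℕ) :
    IsWeightedHomogeneous colw (coeff m' (lsub G (monomial m 1))) (∑ v, m v • w v) := by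
  let P : MvPolynomial V (MvPolynomial (Fin 4 × Fin 4) K) → (Fin 4 → ℕ) → Prop :=
    fun p γ => ∀ m', IsWeightedHomogeneous colw (coeff m' p) γ
  have hone : P 1 0 := by
    intro m'
    classical
    rw [coeff_one]
    split_ifs
    · exact isWeightedHomogeneous_one _ _
    · exact isWeightedHomogeneous_zero _ _ _
  have hmul : ∀ p q a b, P p a → P q b → P (p * q) (a + b) := by
    intro p q a b hp hq m'
    classical
    rw [coeff_mul]
    apply IsWeightedHomogeneous.sum
    intro x _
    exact (hp _).mul (hq _)
  have hpow : ∀ p a (k : ℕ), P p a → P (p ^ k) (k • a) := by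
    intro p a k hp
    induction k with
    | zero => simpa using hone
    | succ k ih => rw [pow_succ, succ_nsmul]; exact hmul _ _ _ _ ih hp
  have hprod : ∀ (s : Finset V) (f : V → MvPolynomial V (MvPolynomial (Fin 4 × Fin 4) K)) (a : V → Fin 4 → ℕ),
      (∀ v, P (f v) (a v)) → P (∏ v ∈ s, f v) (∑ v ∈ s, a v) := by
    intro s f a h
    classical
    induction s using Finset.induction_on with
    | empty => simpa using hone
    | insert x s hx ih => rw [Finset.prod_insert hx, Finset.sum_insert hx]; exact hmul _ _ _ _ (h x) ih
  have : lsub G (monomial m 1) = ∏ v, (∑ u, C (G v u) * X u) ^ m v := by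
    rw [monomial_eq, Finsupp.prod_fintype _ _ (by simp)]
    simp [lsub]
  rw [this]
  refine hprod _ _ _ (fun v => hpow _ _ _ ?_) m'
  intro m'
  rw [coeff_sum]
  apply IsWeightedHomogeneous.sum
  intro u _
  rw [coeff_C_mul, coeff_X]
  split_ifs
  · rw [mul_one]; exact hG v u
  · rw [mul_zero]; exact isWeightedHomogeneous_zero _ _ _

lemma wh_Gm (v u : MatVar 4) : IsWeightedHomogeneous colw (Gm (mvPolynomialX (Fin 4) (Fin 4) K) v u)
    (wadj (pr v).1 + Pi.single (pr v).2 1) := by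
  rcases v with v | v <;> rcases u with u | u <;> simp only [Gm, Matrix.fromBlocks_apply₁₁, Matrix.fromBlocks_apply₁₂,
    Matrix.fromBlocks_apply₂₁, Matrix.fromBlocks_apply₂₂, kroneckerMap_apply, Matrix.transpose_apply]
  · exact (wh_adj _ _).mul (wh_X _ _)
  · exact isWeightedHomogeneous_zero _ _ _
  · exact isWeightedHomogeneous_zero _ _ _
  · exact (wh_adj _ _).mul (wh_X _ _)

def wtb {k : ℕ} (b : II k) : Fin 4 → ℕ :=
  3 • 1 + (Pi.single b.1.1 1 + wadj b.1.2 + ∑ v, (b.2 : MatVar 4 →₀ ℕ) v • (wadj (pr v).1 + Pi.single (pr v).2 1))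

lemma Dk_apply (k : ℕ) (a b : II k) : Dk K k a b = gdet 4 K ^ 3 *
    ((mvPolynomialX (Fin 4) (Fin 4) K a.1.1 b.1.1 * (mvPolynomialX (Fin 4) (Fin 4) K).adjugate b.1.2 a.1.2) *
      coeff (a.2 : MatVar 4 →₀ ℕ) (lsub (Gm (mvPolynomialX (Fin 4) (Fin 4) K)) (monomial (b.2 : MatVar 4 →₀ ℕ) 1))) := rfl

lemma wh_Dk (k : ℕ) (a b : II k) : IsWeightedHomogeneous colw (Dk K k a b) (wtb b) := by
  rw [Dk_apply]
  unfold wtb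
  exact (wh_det.pow 3).mul (((wh_X _ _).mul (wh_adj _ _)).mul (coeff_lsub_wh _ _ wh_Gm _ _))

lemma dim_semi (k : ℕ) : (Module.finrank K (semi (Dk K k) (k + 4)) : ℤ) =
    ∑ σ : Equiv.Perm (Fin 4), (Equiv.Perm.sign σ : ℤ) *
      ((Finset.univ.filter fun b : II k => wtb b = fun j => k + 4 + σ j - j).card : ℤ) := by
  rw [finrank_semi_eq (PRep_Dk k) (k + 4) (by omega)]
  apply Finset.sum_congr rfl
  intro σ _
  rw [finrank_Uw_count (PRep_Dk k) wtb (wh_Dk k)]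

end concrete


section eqv
variable {K : Type*} [Field K] [CharZero K]

def psi (K : Type*) [Field K] (k : ℕ) : (II k → K) →ₗ[K] Matrix (Fin 4) (Fin 4) (MvPolynomial (MatVar 4) K) where
  toFun v := fun i j => ∑ m : sK k, v ((i, j), m) • monomial (m : MatVar 4 →₀ ℕ) 1
  map_add' := by
    intro a b; ext1 i j
    simp only [Pi.add_apply, add_smul, Finset.sum_add_distrib, Matrix.add_apply]
    rfl
  map_smul' := by
    intro c a; ext1 i j
    simp only [Pi.smul_apply, smul_eq_mul, mul_smul, ← Finset.smul_sum, Matrix.smul_apply, RingHom.id_apply]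
    rfl

lemma psi_apply (k : ℕ) (v : II k → K) (i j : Fin 4) : psi K k v i j = ∑ m : sK k, v ((i, j), m) • monomial (m : MatVar 4 →₀ ℕ) 1 := rfl

lemma psi_coeff (k : ℕ) (v : II k → K) (i j : Fin 4) (m : sK k) : coeff (m : MatVar 4 →₀ ℕ) (psi K k v i j) = v ((i, j), m) := by
  rw [psi_apply, coeff_sum, Finset.sum_eq_single m]
  · simp
  · intro b _ hb
    rw [coeff_smul, coeff_monomial, if_neg (fun h => hb (Subtype.ext h))]; simp
  · simp

lemma psi_inj (k : ℕ) : Function.Injective (psi K k) := by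
  intro v v' h
  ext ⟨⟨i, j⟩, m⟩
  rw [← psi_coeff k v, ← psi_coeff k v', h]

lemma psi_hom (k : ℕ) (v : II k → K) (i j : Fin 4) : (psi K k v i j).IsHomogeneous k := by
  rw [psi_apply]
  apply IsHomogeneous.sum
  intro m _
  rw [smul_eq_C_mul]
  exact IsWeightedHomogeneous.C_mul (isWeightedHomogeneous_monomial _ _ _ ((mem_sK k _).1 m.2)) _

lemma psi_surj (k : ℕ) (M : Matrix (Fin 4) (Fin 4) (MvPolynomial (MatVar 4) K)) (hM : ∀ i j, (M i j).IsHomogeneous k) :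
    ∃ v, psi K k v = M := by
  refine ⟨fun b => coeff (b.2 : MatVar 4 →₀ ℕ) (M b.1.1 b.1.2), ?_⟩
  ext1 i j
  rw [psi_apply]
  exact (wh_eq_sum (mem_sK k) (hM i j)).symm

lemma eval_pair_smul (k : ℕ) (p : MvPolynomial (MatVar 4) K) (hp : p.IsHomogeneous k) (c : K) (A B : Matrix (Fin 4) (Fin 4) K) :
    eval (pairSub (c • A) (c • B)) p = c ^ k * eval (pairSub A B) p := by
  rw [eval_eq', eval_eq', Finset.mul_sum]
  apply Finset.sum_congr rfl
  intro d hd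
  have h1 := hp (mem_support_iff.mp hd)
  have h2 := (mem_sK k d).2 h1
  rw [Finset.mem_finsuppAntidiag] at h2
  have h3 : ∀ v, pairSub (c • A) (c • B) v = c * pairSub A B v := by
    rintro (v | v) <;> simp [pairSub]
  rw [← h2.1]
  simp only [h3, mul_pow, Finset.prod_mul_distrib, Finset.prod_pow_eq_pow_sum]
  ring

def EE (k : ℕ) (M : Matrix (Fin 4) (Fin 4) (MvPolynomial (MatVar 4) K)) (g A B : Matrix (Fin 4) (Fin 4) K) : Prop :=
  g * M.map (eval (pairSub (g.adjugate * A * g) (g.adjugate * B * g))) * g.adjugate = g.det ^ (k + 1) • M.map (eval (pairSub A B))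

lemma EE_iff (k : ℕ) (M : Matrix (Fin 4) (Fin 4) (MvPolynomial (MatVar 4) K)) (hM : ∀ i j, (M i j).IsHomogeneous k)
    (a : GL (Fin 4) K) (A B : Matrix (Fin 4) (Fin 4) K) :
    EE k M a ((a : Matrix (Fin 4) (Fin 4) K) * A * ((a⁻¹ : GL (Fin 4) K) : Matrix (Fin 4) (Fin 4) K))
        ((a : Matrix (Fin 4) (Fin 4) K) * B * ((a⁻¹ : GL (Fin 4) K) : Matrix (Fin 4) (Fin 4) K)) ↔
    M.map (MvPolynomial.eval
        (pairSub ((a : Matrix (Fin 4) (Fin 4) K) * A * ((a⁻¹ : GL (Fin 4) K) : Matrix (Fin 4) (Fin 4) K))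
          ((a : Matrix (Fin 4) (Fin 4) K) * B * ((a⁻¹ : GL (Fin 4) K) : Matrix (Fin 4) (Fin 4) K)))) =
      (a : Matrix (Fin 4) (Fin 4) K) * M.map (MvPolynomial.eval (pairSub A B)) *
        ((a⁻¹ : GL (Fin 4) K) : Matrix (Fin 4) (Fin 4) K) := by
  set g := (a : Matrix (Fin 4) (Fin 4) K) with hg
  set gi := ((a⁻¹ : GL (Fin 4) K) : Matrix (Fin 4) (Fin 4) K) with hgi
  have h1 : g * gi = 1 := by rw [hg, hgi, ← Units.val_mul]; simp
  have h2 : gi * g = 1 := by rw [hg, hgi, ← Units.val_mul]; simp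
  have hdet : g.det ≠ 0 := by
    intro h
    have := congrArg Matrix.det h1
    rw [Matrix.det_mul, h, zero_mul, Matrix.det_one] at this
    exact zero_ne_one this
  have hadj : g.adjugate = g.det • gi := by
    have := congrArg (· * gi) (Matrix.adjugate_mul g)
    simp only [Matrix.mul_assoc, h1, Matrix.mul_one, Matrix.smul_mul, Matrix.one_mul] at this
    exact this
  have hc : ∀ A, g.adjugate * (g * A * gi) * g = g.det • A := by
    intro A
    rw [hadj]
    simp only [Matrix.smul_mul]
    congr 1
    calc gi * (g * A * gi) * g = (gi * g) * A * (gi * g) := by simp only [Matrix.mul_assoc]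
      _ = A := by rw [h2, Matrix.one_mul, Matrix.mul_one]
  unfold EE
  rw [hc, hc]
  have hM2 : M.map (eval (pairSub (g.det • A) (g.det • B))) = g.det ^ k • M.map (eval (pairSub A B)) := by
    ext i j
    rw [Matrix.map_apply, eval_pair_smul k _ (hM i j)]; rfl
  rw [hM2, hadj, Matrix.mul_smul, Matrix.mul_smul, Matrix.smul_mul, smul_smul, ← pow_succ']
  constructor
  · intro h; exact (smul_right_injective _ (pow_ne_zero _ hdet) h).symm
  · intro h; rw [h]

lemma eqv_iff (k : ℕ) (M : Matrix (Fin 4) (Fin 4) (MvPolynomial (MatVar 4) K)) (hM : ∀ i j, (M i j).IsHomogeneous k) :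
    IsMatEquivariant M ↔ ∀ g : Matrix (Fin 4) (Fin 4) K, g.det ≠ 0 → ∀ A B, EE k M g A B := by
  constructor
  · intro h g hg A B
    let a : GL (Fin 4) K := Matrix.GeneralLinearGroup.mkOfDetNeZero g hg
    have ha : (a : Matrix (Fin 4) (Fin 4) K) = g := rfl
    have h1 : (a : Matrix (Fin 4) (Fin 4) K) * ((a⁻¹ : GL (Fin 4) K) : Matrix (Fin 4) (Fin 4) K) = 1 := by
      rw [← Units.val_mul]; simp
    have := (EE_iff k M hM a (((a⁻¹ : GL (Fin 4) K) : Matrix (Fin 4) (Fin 4) K) * A * a)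
      (((a⁻¹ : GL (Fin 4) K) : Matrix (Fin 4) (Fin 4) K) * B * a)).2 (h a _ _)
    have h3 : ∀ A, (a : Matrix (Fin 4) (Fin 4) K) * (((a⁻¹ : GL (Fin 4) K) : Matrix (Fin 4) (Fin 4) K) * A * a) * ((a⁻¹ : GL (Fin 4) K) : Matrix (Fin 4) (Fin 4) K) = A := by
      intro A
      rw [← Matrix.mul_assoc, ← Matrix.mul_assoc, h1, Matrix.one_mul, Matrix.mul_assoc, h1, Matrix.mul_one]
    rw [h3, h3, ha] at this
    exact this
  · intro h a A B
    refine (EE_iff k M hM a A B).1 (h _ ?_ _ _)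
    exact a.det.ne_zero

lemma pair_ext {p q : MvPolynomial (MatVar 4) K} (h : ∀ A B, eval (pairSub A B) p = eval (pairSub A B) q) : p = q := by
  apply MvPolynomial.funext
  intro x
  have : x = pairSub (Matrix.of fun i j => x (Sum.inl (i, j))) (Matrix.of fun i j => x (Sum.inr (i, j))) := by
    ext v; rcases v with v | v <;> rfl
  rw [this, h]

lemma eval_lsub_Gm (g A B : Matrix (Fin 4) (Fin 4) K) (p : MvPolynomial (MatVar 4) K) :
    eval (pairSub A B) (lsub (Gm g) p) = eval (pairSub (g.adjugate * A * g) (g.adjugate * B * g)) p := by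
  have : (eval (pairSub A B)).comp (lsub (Gm g) : MvPolynomial (MatVar 4) K →+* MvPolynomial (MatVar 4) K) =
      eval (pairSub (g.adjugate * A * g) (g.adjugate * B * g)) := by
    ext v
    · simp [lsub]
    · rw [RingHom.comp_apply, AlgHom.coe_toRingHom, lsub_X, eval_X, map_sum]
      have key : ∀ (A : Matrix (Fin 4) (Fin 4) K) (v : Fin 4 × Fin 4), (∑ u : Fin 4 × Fin 4, g.adjugate v.1 u.1 * g u.2 v.2 * A u.1 u.2) = (g.adjugate * A * g) v.1 v.2 := by
        intro A v
        rw [Matrix.mul_apply, Fintype.sum_prod_type, Finset.sum_comm]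
        apply Finset.sum_congr rfl
        intro b _
        rw [Matrix.mul_apply, Finset.sum_mul]
        apply Finset.sum_congr rfl
        intros; ring
      rcases v with v | v
      · simp [Gm, pairSub, kroneckerMap_apply]
        exact key A v
      · simp [Gm, pairSub, kroneckerMap_apply]
        exact key B v
  exact RingHom.congr_fun this p

lemma EE_poly (k : ℕ) (M : Matrix (Fin 4) (Fin 4) (MvPolynomial (MatVar 4) K)) (g : Matrix (Fin 4) (Fin 4) K) :
    (∀ A B, EE k M g A B) ↔ ∀ i j, ∑ i', ∑ j', (g i i' * g.adjugate j' j) • lsub (Gm g) (M i' j') = g.det ^ (k + 1) • M i j := by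
  have h : ∀ A B i j, (g * M.map (eval (pairSub (g.adjugate * A * g) (g.adjugate * B * g))) * g.adjugate) i j =
      eval (pairSub A B) (∑ i', ∑ j', (g i i' * g.adjugate j' j) • lsub (Gm g) (M i' j')) := by
    intro A B i j
    rw [map_sum, Finset.sum_congr rfl fun i' _ => map_sum _ _ _, Finset.sum_comm, Matrix.mul_apply]
    apply Finset.sum_congr rfl
    intro j' _
    rw [Matrix.mul_apply, Finset.sum_mul]
    apply Finset.sum_congr rfl
    intro i' _
    rw [smul_eval, eval_lsub_Gm, Matrix.map_apply]
    ring
  constructor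
  · intro hE i j
    apply pair_ext
    intro A B
    rw [← h, hE A B, smul_eval]; rfl
  · intro hE A B
    ext i j
    rw [h, hE, smul_eval]; rfl

set_option maxHeartbeats 1000000 in
lemma semi_iff (k : ℕ) (v : II k → K) :
    v ∈ semi (Dk K k) (k + 4) ↔ ∀ g : Matrix (Fin 4) (Fin 4) K, g.det ≠ 0 → ∀ A B, EE k (psi K k v) g A B := by
  change (∀ g : Matrix (Fin 4) (Fin 4) K, g.det ≠ 0 → _) ↔ _
  apply forall_congr'; intro g
  apply forall_congr'; intro hg
  rw [EE_poly]
  have hD : ∀ a b : II k, evm g (Dk K k a b) = g.det ^ 3 * ((g a.1.1 b.1.1 * g.adjugate b.1.2 a.1.2) *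
      coeff (a.2 : MatVar 4 →₀ ℕ) (lsub (Gm g) (monomial (b.2 : MatVar 4 →₀ ℕ) 1))) := by
    intro a b
    have h1 := congrFun (congrFun (gX_map g) a.1.1) b.1.1
    have h2 := congrFun (congrFun (gadj_map g) b.1.2) a.1.2
    have h3 := congrFun (congrFun (subMat_map (evm g) (sK k) (Gm (mvPolynomialX (Fin 4) (Fin 4) K))) a.2) b.2
    rw [Gm_map] at h3
    rw [Matrix.map_apply] at h1 h2 h3
    unfold subMat at h3
    rw [Dk_apply, map_mul, map_mul, map_mul, map_pow, evm_gdet, h1, h2, h3]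
  have hmv : ∀ i j (m : sK k), ((Dk K k).map (evm g) *ᵥ v) ((i, j), m) = g.det ^ 3 * coeff (m : MatVar 4 →₀ ℕ)
      (∑ i', ∑ j', (g i i' * g.adjugate j' j) • lsub (Gm g) (psi K k v i' j')) := by
    intro i j m
    rw [Matrix.mulVec, dotProduct, Fintype.sum_prod_type, Fintype.sum_prod_type, coeff_sum, Finset.mul_sum]
    apply Finset.sum_congr rfl; intro i' _
    rw [coeff_sum, Finset.mul_sum]
    apply Finset.sum_congr rfl; intro j' _
    rw [coeff_smul, psi_apply, map_sum, coeff_sum, smul_eq_mul, Finset.mul_sum, Finset.mul_sum]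
    apply Finset.sum_congr rfl; intro m' _
    rw [Matrix.map_apply, hD, map_smul, coeff_smul, smul_eq_mul]
    ring
  have hhom : ∀ i j, IsWeightedHomogeneous (fun _ => (1 : ℕ)) (∑ i', ∑ j', (g i i' * g.adjugate j' j) • lsub (Gm g) (psi K k v i' j')) k := by
    intro i j
    apply IsWeightedHomogeneous.sum; intro i' _
    apply IsWeightedHomogeneous.sum; intro j' _
    rw [smul_eq_C_mul]
    apply IsWeightedHomogeneous.C_mul
    rw [psi_apply, map_sum]
    apply IsWeightedHomogeneous.sum; intro m _
    rw [map_smul, smul_eq_C_mul]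
    apply IsWeightedHomogeneous.C_mul
    have := lsub_wh (w := fun _ => (1 : ℕ)) (G := Gm g) (fun _ _ => Or.inl rfl) (m : MatVar 4 →₀ ℕ)
    rwa [(mem_sK k _).1 m.2] at this
  have h3 : g.det ^ 3 ≠ 0 := pow_ne_zero _ hg
  have key : ∀ i j (m : sK k), (((Dk K k).map (evm g) *ᵥ v) ((i, j), m) = (g.det ^ (k + 4) • v) ((i, j), m)) ↔
      coeff (m : MatVar 4 →₀ ℕ) (∑ i', ∑ j', (g i i' * g.adjugate j' j) • lsub (Gm g) (psi K k v i' j')) =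
        coeff (m : MatVar 4 →₀ ℕ) (g.det ^ (k + 1) • psi K k v i j) := by
    intro i j m
    rw [hmv, Pi.smul_apply, coeff_smul, psi_coeff, smul_eq_mul, smul_eq_mul, show k + 4 = 3 + (k + 1) by ring, pow_add, mul_assoc]
    exact mul_right_inj' h3
  constructor
  · intro h i j
    have hr : IsWeightedHomogeneous (fun _ => (1 : ℕ)) (g.det ^ (k + 1) • psi K k v i j) k := by
      rw [smul_eq_C_mul]; exact IsWeightedHomogeneous.C_mul (psi_hom k v i j) _
    rw [wh_eq_sum (mem_sK k) (hhom i j), wh_eq_sum (mem_sK k) hr]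
    apply Finset.sum_congr rfl
    intro m _
    rw [(key i j m).1 (congrFun h _)]
  · intro h
    ext ⟨⟨i, j⟩, m⟩
    rw [key, h]

lemma comp_eq (k : ℕ) : mixedComponent1 K 4 k = ((semi (Dk K k) (k + 4)).map (psi K k) : Set _) := by
  ext M
  constructor
  · rintro ⟨h1, h2⟩
    obtain ⟨v, rfl⟩ := psi_surj k M h2
    exact ⟨v, (semi_iff k v).2 ((eqv_iff k _ h2).1 h1), rfl⟩
  · rintro ⟨v, hv, rfl⟩
    exact ⟨(eqv_iff k _ (psi_hom k v)).2 ((semi_iff k v).1 hv), psi_hom k v⟩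

lemma mixedDim_eq (k : ℕ) : mixedDim1 K 4 k = Module.finrank K (semi (Dk K k) (k + 4)) := by
  unfold mixedDim1
  rw [comp_eq, Set.finrank, Submodule.span_eq]
  exact (Submodule.equivMapOfInjective _ (psi_inj k) _).finrank_eq.symm

theorem dim_count (k : ℕ) : (mixedDim1 K 4 k : ℤ) =
    ∑ σ : Equiv.Perm (Fin 4), (Equiv.Perm.sign σ : ℤ) *
      ((Finset.univ.filter fun b : II k => wtb b = fun j => k + 4 + σ j - j).card : ℤ) := by
  rw [mixedDim_eq, dim_semi]

end eqv


abbrev Ex := Fin 4 → ℤ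
abbrev LA := AddMonoidAlgebra ℚ Ex
abbrev LS := PowerSeries LA

def mo (e : Ex) : LA := AddMonoidAlgebra.single e 1

lemma mo_add (e f : Ex) : mo (e + f) = mo e * mo f := by
  simp [mo, AddMonoidAlgebra.single_mul_single]
lemma mo_zero : mo 0 = 1 := rfl
lemma mo_nsmul (n : ℕ) (e : Ex) : mo (n • e) = mo e ^ n := by
  induction n with
  | zero => simp [mo_zero]
  | succ n ih => rw [succ_nsmul, mo_add, ih, pow_succ]
lemma mo_sum {ι : Type*} (s : Finset ι) (f : ι → Ex) : mo (∑ i ∈ s, f i) = ∏ i ∈ s, mo (f i) := by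
  classical
  induction s using Finset.induction_on with
  | empty => simp [mo_zero]
  | insert a s ha ih => rw [Finset.sum_insert ha, Finset.prod_insert ha, mo_add, ih]

def c0 : LA →+ ℚ where
  toFun a := a.coeff 0
  map_zero' := rfl
  map_add' _ _ := rfl

lemma c0_mo (e : Ex) : c0 (mo e) = if e = 0 then 1 else 0 := by
  change (AddMonoidAlgebra.single e (1 : ℚ)).coeff 0 = _
  rw [AddMonoidAlgebra.coeff_single, Finsupp.single_apply]

lemma c0_smul (r : ℚ) (a : LA) : c0 (algebraMap ℚ LA r * a) = r * c0 a := by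
  rw [← Algebra.smul_def]; rfl

def CT : LS →+ PowerSeries ℚ where
  toFun f := PowerSeries.mk fun k => c0 (PowerSeries.coeff k f)
  map_zero' := by ext k; simp
  map_add' f g := by ext k; simp

lemma coeff_CT (f : LS) (k : ℕ) : PowerSeries.coeff k (CT f) = c0 (PowerSeries.coeff k f) := by
  change PowerSeries.coeff k (PowerSeries.mk (R := ℚ) fun k => c0 (PowerSeries.coeff k f)) = _
  rw [PowerSeries.coeff_mk]

/-- scalars -/
def io : PowerSeries ℚ →+* LS := PowerSeries.map (algebraMap ℚ LA)

lemma CT_io (f : PowerSeries ℚ) (g : LS) : CT (io f * g) = f * CT g := by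
  ext k
  rw [coeff_CT, PowerSeries.coeff_mul, PowerSeries.coeff_mul, map_sum]
  apply Finset.sum_congr rfl
  intro p _
  rw [coeff_CT, io, PowerSeries.coeff_map, c0_smul]

lemma CT_io' (f : PowerSeries ℚ) : CT (io f) = f := by
  have := CT_io f 1
  rw [mul_one] at this
  rw [this]
  have h : CT 1 = 1 := by
    ext k
    rw [coeff_CT, PowerSeries.coeff_one, PowerSeries.coeff_one]
    split_ifs
    · rw [← mo_zero, c0_mo, if_pos rfl]
    · simp
  rw [h, mul_one]

lemma io_X : io PowerSeries.X = PowerSeries.X := by simp [io]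

def tt : LS := PowerSeries.X
def zz (i : Fin 4) : LS := PowerSeries.C (mo (Pi.single i 1))
def zi (i : Fin 4) : LS := PowerSeries.C (mo (-Pi.single i 1))

lemma zz_zi (i : Fin 4) : zz i * zi i = 1 := by
  rw [zz, zi, ← map_mul, ← mo_add, add_neg_cancel, mo_zero, map_one]

/-! inverses -/
def iv (f : LS) : LS := PowerSeries.invOfUnit f 1

lemma mul_iv {f : LS} (h : PowerSeries.constantCoeff f = 1) : f * iv f = 1 :=
  PowerSeries.mul_invOfUnit f 1 (by simpa using h)

lemma cc_iv (f : LS) : PowerSeries.constantCoeff (iv f) = 1 := by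
  simp [iv]

lemma cc_tt : PowerSeries.constantCoeff tt = 0 := by simp [tt]
lemma cc_sub (f : LS) (n : ℕ) (hn : n ≠ 0) : PowerSeries.constantCoeff (1 - tt ^ n * f) = 1 := by
  simp [tt, hn]

/-! weights -/
def Ge (w : Ex →+ ℤ) (n : ℤ) (f : LS) : Prop := ∀ k e, (PowerSeries.coeff k f).coeff e ≠ 0 → n ≤ w e

lemma Ge.mono {w : Ex →+ ℤ} {n m : ℤ} {f : LS} (h : Ge w n f) (hm : m ≤ n) : Ge w m f :=
  fun k e he => hm.trans (h k e he)

lemma Ge.add {w : Ex →+ ℤ} {n : ℤ} {f g : LS} (hf : Ge w n f) (hg : Ge w n g) : Ge w n (f + g) := by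
  intro k e he
  by_contra hlt
  apply he
  rw [map_add, AddMonoidAlgebra.coeff_add, Finsupp.add_apply]
  rw [not_imp_comm.1 (hf k e) hlt, not_imp_comm.1 (hg k e) hlt, add_zero]

lemma Ge.neg {w : Ex →+ ℤ} {n : ℤ} {f : LS} (hf : Ge w n f) : Ge w n (-f) := by
  intro k e he
  apply hf k e
  intro h
  apply he
  rw [map_neg, AddMonoidAlgebra.coeff_neg, Finsupp.neg_apply, h, neg_zero]

lemma Ge.sub {w : Ex →+ ℤ} {n : ℤ} {f g : LS} (hf : Ge w n f) (hg : Ge w n g) : Ge w n (f - g) := by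
  rw [sub_eq_add_neg]; exact hf.add hg.neg

lemma Ge.zero (w : Ex →+ ℤ) (n : ℤ) : Ge w n 0 := by
  intro k e he; simp at he

lemma Ge_sum {ι : Type*} (s : Finset ι) (f : ι → LS) {w : Ex →+ ℤ} {n : ℤ} (h : ∀ i ∈ s, Ge w n (f i)) : Ge w n (∑ i ∈ s, f i) := by
  classical
  induction s using Finset.induction_on with
  | empty => exact Ge.zero _ _
  | insert a s ha ih =>
    rw [Finset.sum_insert ha]
    exact (h a (by simp)).add (ih fun i hi => h i (by simp [hi]))

/-- coefficient version -/
def GeA (w : Ex →+ ℤ) (n : ℤ) (a : LA) : Prop := ∀ e, a.coeff e ≠ 0 → n ≤ w e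

lemma GeA.mul {w : Ex →+ ℤ} {n m : ℤ} {a b : LA} (ha : GeA w n a) (hb : GeA w m b) : GeA w (n + m) (a * b) := by
  classical
  intro e he
  have h1 : e ∈ (a * b).coeff.support := Finsupp.mem_support_iff.2 he
  have h2 := AddMonoidAlgebra.support_coeff_mul_subset a b h1
  obtain ⟨x, hx, y, hy, rfl⟩ := Finset.mem_add.1 h2
  rw [map_add]
  exact add_le_add (ha x (Finsupp.mem_support_iff.1 hx)) (hb y (Finsupp.mem_support_iff.1 hy))

lemma GeA.add {w : Ex →+ ℤ} {n : ℤ} {f g : LA} (hf : GeA w n f) (hg : GeA w n g) : GeA w n (f + g) := by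
  intro e he
  by_contra hlt
  apply he
  rw [AddMonoidAlgebra.coeff_add, Finsupp.add_apply]
  rw [not_imp_comm.1 (hf e) hlt, not_imp_comm.1 (hg e) hlt, add_zero]

lemma GeA.zero (w : Ex →+ ℤ) (n : ℤ) : GeA w n 0 := by
  intro e he; simp at he

lemma GeA_sum {ι : Type*} (s : Finset ι) (f : ι → LA) {w : Ex →+ ℤ} {n : ℤ} (h : ∀ i ∈ s, GeA w n (f i)) : GeA w n (∑ i ∈ s, f i) := by
  classical
  induction s using Finset.induction_on with
  | empty => exact GeA.zero _ _
  | insert a s ha ih =>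
    rw [Finset.sum_insert ha]
    exact (h a (by simp)).add (ih fun i hi => h i (by simp [hi]))

lemma GeA.neg {w : Ex →+ ℤ} {n : ℤ} {f : LA} (hf : GeA w n f) : GeA w n (-f) := by
  intro e he
  apply hf e
  intro h
  apply he
  rw [AddMonoidAlgebra.coeff_neg, Finsupp.neg_apply, h, neg_zero]

lemma GeA_mo {w : Ex →+ ℤ} {n : ℤ} {e : Ex} (h : n ≤ w e) : GeA w n (mo e) := by
  intro e' he
  have : (mo e).coeff = Finsupp.single e 1 := rfl
  rw [this, Finsupp.single_apply] at he
  split_ifs at he with h'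
  · rw [← h']; exact h
  · exact absurd rfl he

lemma Ge.mul {w : Ex →+ ℤ} {n m : ℤ} {f g : LS} (hf : Ge w n f) (hg : Ge w m g) : Ge w (n + m) (f * g) := by
  intro k
  rw [PowerSeries.coeff_mul]
  exact GeA_sum _ _ fun p _ => GeA.mul (hf p.1) (hg p.2)

lemma Ge.mul0 {w : Ex →+ ℤ} {n : ℤ} {f g : LS} (hf : Ge w n f) (hg : Ge w 0 g) : Ge w n (f * g) := by
  have := hf.mul hg; rwa [add_zero] at this

lemma Ge_C {w : Ex →+ ℤ} {n : ℤ} {a : LA} (h : GeA w n a) : Ge w n (PowerSeries.C a) := by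
  intro k
  rw [PowerSeries.coeff_C]
  split_ifs
  · exact h
  · exact GeA.zero _ _

lemma Ge_one (w : Ex →+ ℤ) : Ge w 0 1 := by
  rw [← map_one PowerSeries.C, ← mo_zero]; exact Ge_C (GeA_mo (by simp))

lemma Ge.pow {w : Ex →+ ℤ} {f : LS} (hf : Ge w 0 f) (k : ℕ) : Ge w 0 (f ^ k) := by
  induction k with
  | zero => rw [pow_zero]; exact Ge_one w
  | succ k ih => rw [pow_succ]; exact ih.mul0 hf

lemma Ge_io (w : Ex →+ ℤ) (f : PowerSeries ℚ) : Ge w 0 (io f) := by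
  intro k e he
  rw [io, PowerSeries.coeff_map] at he
  have : (algebraMap ℚ LA (PowerSeries.coeff k f)).coeff = Finsupp.single 0 (PowerSeries.coeff k f) := rfl
  rw [this, Finsupp.single_apply] at he
  split_ifs at he with h'
  · rw [← h', map_zero]
  · exact absurd rfl he

lemma Ge_tt (w : Ex →+ ℤ) : Ge w 0 tt := by
  have := Ge_io w PowerSeries.X
  rwa [io_X] at this

lemma Ge_nat (w : Ex →+ ℤ) (n : ℕ) [n.AtLeastTwo] : Ge w 0 (OfNat.ofNat n) := by
  have := Ge_io w (OfNat.ofNat n)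
  rwa [map_ofNat] at this

lemma Ge_zz {w : Ex →+ ℤ} {n : ℤ} {i : Fin 4} (h : n ≤ w (Pi.single i 1)) : Ge w n (zz i) := Ge_C (GeA_mo h)
lemma Ge_zi {w : Ex →+ ℤ} {n : ℤ} {i : Fin 4} (h : n ≤ w (-Pi.single i 1)) : Ge w n (zi i) := Ge_C (GeA_mo h)

lemma Ge_inv {w : Ex →+ ℤ} {f g : LS} (hf : Ge w 0 f) (hc : PowerSeries.constantCoeff f = 1) (h : f * g = 1) : Ge w 0 g := by
  intro k
  induction k using Nat.strong_induction_on with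
  | _ k ih =>
    have h1 := congrArg (PowerSeries.coeff k) h
    rw [PowerSeries.coeff_mul, Finset.Nat.sum_antidiagonal_eq_sum_range_succ (fun i j => PowerSeries.coeff i f * PowerSeries.coeff j g),
      Finset.sum_range_succ'] at h1
    rw [PowerSeries.coeff_zero_eq_constantCoeff_apply, hc, one_mul, Nat.sub_zero] at h1
    rw [eq_sub_of_add_eq' h1, sub_eq_add_neg]
    refine GeA.add ?_ (GeA.neg (GeA_sum _ _ ?_))
    · exact Ge_one w k
    · intro i hi
      rw [Finset.mem_range] at hi
      have := GeA.mul (hf (i + 1)) (ih (k - (i + 1)) (by omega))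
      rwa [add_zero] at this

lemma Ge.iv {w : Ex →+ ℤ} {f : LS} (hf : Ge w 0 f) (hc : PowerSeries.constantCoeff f = 1) : Ge w 0 (iv f) :=
  Ge_inv hf hc (mul_iv hc)

lemma CT_Ge {w : Ex →+ ℤ} {f : LS} (h : Ge w 1 f) : CT f = 0 := by
  ext k
  rw [coeff_CT, map_zero]
  by_contra hne
  have := h k 0 hne
  rw [map_zero] at this
  omega

/-! permutations -/
def pe (σ : Equiv.Perm (Fin 4)) : Ex →+ Ex where
  toFun e := fun i => e (σ.symm i)
  map_zero' := rfl
  map_add' _ _ := rfl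

lemma pe_single (σ : Equiv.Perm (Fin 4)) (i : Fin 4) (c : ℤ) : pe σ (Pi.single i c) = Pi.single (σ i) c := by
  ext j
  change (Pi.single i c : Ex) (σ.symm j) = _
  rw [Pi.single_apply, Pi.single_apply]
  simp [Equiv.symm_apply_eq]

def paA (σ : Equiv.Perm (Fin 4)) : LA →+* LA := AddMonoidAlgebra.mapDomainRingHom ℚ (pe σ)

lemma paA_mo (σ : Equiv.Perm (Fin 4)) (e : Ex) : paA σ (mo e) = mo (pe σ e) := by
  simp [paA, mo]

lemma c0_paA (σ : Equiv.Perm (Fin 4)) (a : LA) : c0 (paA σ a) = c0 a := by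
  have hinj : Function.Injective (pe σ) := by
    intro e f h; ext i
    have := congrFun h (σ i)
    simpa [pe] using this
  have h0 : (0 : Ex) = pe σ 0 := rfl
  change (AddMonoidAlgebra.mapDomain (pe σ) a).coeff 0 = a.coeff 0
  rw [AddMonoidAlgebra.coeff_mapDomain]
  conv_lhs => rw [h0]
  exact Finsupp.mapDomain_apply hinj _ _

def pa (σ : Equiv.Perm (Fin 4)) : LS →+* LS := PowerSeries.map (paA σ)

lemma CT_pa (σ : Equiv.Perm (Fin 4)) (f : LS) : CT (pa σ f) = CT f := by
  ext k
  rw [coeff_CT, coeff_CT, pa, PowerSeries.coeff_map, c0_paA]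

lemma pa_tt (σ : Equiv.Perm (Fin 4)) : pa σ tt = tt := by simp [pa, tt]
lemma pa_zz (σ : Equiv.Perm (Fin 4)) (i : Fin 4) : pa σ (zz i) = zz (σ i) := by
  rw [pa, zz, PowerSeries.map_C, paA_mo, pe_single]; rfl
lemma pa_zi (σ : Equiv.Perm (Fin 4)) (i : Fin 4) : pa σ (zi i) = zi (σ i) := by
  rw [pa, zi, PowerSeries.map_C, paA_mo, map_neg, pe_single]; rfl

lemma iv_unique {f g : LS} (hc : PowerSeries.constantCoeff f = 1) (h : f * g = 1) : iv f = g := by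
  have h1 := mul_iv hc
  calc iv f = iv f * (f * g) := by rw [h, mul_one]
    _ = (f * iv f) * g := by ring
    _ = g := by rw [h1, one_mul]

lemma pa_iv (σ : Equiv.Perm (Fin 4)) {f : LS} (hc : PowerSeries.constantCoeff f = 1) : pa σ (iv f) = iv (pa σ f) := by
  symm
  apply iv_unique
  · rw [pa, ← PowerSeries.coeff_zero_eq_constantCoeff_apply, PowerSeries.coeff_map, PowerSeries.coeff_zero_eq_constantCoeff_apply, hc, map_one]
  · rw [← map_mul, mul_iv hc, map_one]


def ee (i : Fin 4) : Ex := Pi.single i 1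
def yv (v : MatVar 4) : LA := mo (ee (pr v).2 - ee (pr v).1)
def dsg (σ : Equiv.Perm (Fin 4)) : Ex := fun j => ((j : ℕ) : ℤ) - ((σ j : ℕ) : ℤ)
def Vp : LA := ∑ σ : Equiv.Perm (Fin 4), ((Equiv.Perm.sign σ : ℤ) : LA) * mo (dsg σ)
def Sp : LA := ∑ p : Fin 4 × Fin 4, mo (ee p.1 - ee p.2)
def Hp : LS := PowerSeries.mk fun k => ∑ a ∈ sK k, ∏ v, yv v ^ a v

def exb {k : ℕ} (b : II k) : Ex := (ee b.1.1 - ee b.1.2) + ∑ v, (b.2 : MatVar 4 →₀ ℕ) v • (ee (pr v).2 - ee (pr v).1)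

lemma wadj_z (i j : Fin 4) : ((wadj i j : ℕ) : ℤ) = 1 - ee i j := by
  have h := congrFun (wadj_add i) j
  rw [Pi.add_apply, Pi.one_apply] at h
  have h2 : (((Pi.single i 1 : Fin 4 → ℕ) j : ℕ) : ℤ) = ee i j := by
    simp only [ee, Pi.single_apply]; split_ifs <;> rfl
  rw [← h2]
  omega

lemma sgl_z (i j : Fin 4) : (((Pi.single i 1 : Fin 4 → ℕ) j : ℕ) : ℤ) = ee i j := by
    simp only [ee, Pi.single_apply]; split_ifs <;> rfl

lemma wtb_z {k : ℕ} (b : II k) (j : Fin 4) : ((wtb b j : ℕ) : ℤ) = k + 4 + exb b j := by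
  have hk : ∑ v, (b.2 : MatVar 4 →₀ ℕ) v = k := by
    have := (mem_sK k _).1 b.2.2
    have h2 := (Finset.mem_finsuppAntidiag.1 b.2.2).1
    simpa using h2
  have hk' : ∑ v, (((b.2 : MatVar 4 →₀ ℕ) v : ℕ) : ℤ) = k := by exact_mod_cast hk
  simp only [wtb, exb, Pi.add_apply, Pi.smul_apply, Pi.sub_apply, Finset.sum_apply, Pi.one_apply]
  simp only [smul_eq_mul, nsmul_eq_mul]
  simp only [Nat.cast_add, Nat.cast_mul, Nat.cast_sum, Nat.cast_ofNat, Nat.cast_one, wadj_z, sgl_z]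
  rw [← hk']
  have : ∀ v : MatVar 4, (((b.2 : MatVar 4 →₀ ℕ) v : ℕ) : ℤ) * (1 - ee (pr v).1 j + ee (pr v).2 j) =
    (((b.2 : MatVar 4 →₀ ℕ) v : ℕ) : ℤ) + (((b.2 : MatVar 4 →₀ ℕ) v : ℕ) : ℤ) * (ee (pr v).2 j - ee (pr v).1 j) := by
    intro v; ring
  simp only [this, Finset.sum_add_distrib]
  ring

lemma wtb_iff {k : ℕ} (b : II k) (σ : Equiv.Perm (Fin 4)) :
    (wtb b = fun j => k + 4 + (σ j : ℕ) - (j : ℕ)) ↔ dsg σ + exb b = 0 := by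
  rw [funext_iff, funext_iff]
  apply forall_congr'
  intro j
  have h := wtb_z b j
  have hj := j.2
  have hd : dsg σ j = ((j : ℕ) : ℤ) - ((σ j : ℕ) : ℤ) := rfl
  rw [Pi.add_apply, Pi.zero_apply, hd]
  omega

lemma mo_exb {k : ℕ} (b : II k) : mo (exb b) = mo (ee b.1.1 - ee b.1.2) * ∏ v, yv v ^ (b.2 : MatVar 4 →₀ ℕ) v := by
  rw [exb, mo_add, mo_sum]
  simp only [mo_nsmul, yv]

lemma sum_exb (k : ℕ) : ∑ b : II k, mo (exb b) = Sp * ∑ a ∈ sK k, ∏ v, yv v ^ a v := by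
  simp only [mo_exb]
  rw [Sp, Finset.sum_mul_sum, Fintype.sum_prod_type]
  apply Finset.sum_congr rfl
  intro p _
  exact Finset.sum_coe_sort (sK k) (fun a : MatVar 4 →₀ ℕ => mo (ee p.1 - ee p.2) * ∏ v, yv v ^ a v)

lemma c0_int (z : ℤ) (a : LA) : c0 ((z : LA) * a) = z * c0 a := by
  rw [← zsmul_eq_mul, map_zsmul, zsmul_eq_mul]

theorem PS_eq (K : Type*) [Field K] [CharZero K] :
    mixedPS1 K 4 = CT (PowerSeries.C Vp * PowerSeries.C Sp * Hp) := by
  ext k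
  rw [coeff_CT, mixedPS1, PowerSeries.coeff_mk, ← map_mul, PowerSeries.coeff_C_mul, Hp, PowerSeries.coeff_mk,
    mul_assoc, ← sum_exb, Vp, Finset.sum_mul, map_sum]
  have h := congrArg (fun z : ℤ => (z : ℚ)) (dim_count (K := K) k)
  simp only [Int.cast_natCast] at h
  rw [h]
  push_cast
  apply Finset.sum_congr rfl
  intro σ _
  rw [mul_assoc, c0_int, Finset.mul_sum, map_sum]
  congr 1
  simp only [← mo_add, c0_mo]
  rw [Finset.card_filter]
  push_cast
  apply Finset.sum_congr rfl
  intro b _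
  simp only [wtb_iff]

theorem Hp_mul : Hp * ∏ v : MatVar 4, (1 - PowerSeries.C (yv v) * PowerSeries.X) = 1 := gen_mul yv


abbrev FF := FractionRing LS
def jj : LS →+* FF := algebraMap LS FF
lemma jj_inj {f g : LS} (h : jj f = jj g) : f = g := IsFractionRing.injective LS FF h
lemma jj_ne {f : LS} (h : PowerSeries.constantCoeff f = 1) : jj f ≠ 0 := by
  intro h0
  have h1 := congrArg jj (mul_iv h)
  rw [map_mul, h0, zero_mul, map_one] at h1
  exact zero_ne_one h1
lemma jj_iv {f : LS} (h : PowerSeries.constantCoeff f = 1) : jj (iv f) = (jj f)⁻¹ := by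
  have h1 := congrArg jj (mul_iv h)
  rw [map_mul, map_one] at h1
  exact eq_inv_of_mul_eq_one_right h1
lemma jj_zz (i : Fin 4) : jj (zz i) ≠ 0 := by
  intro h0
  have h1 := congrArg jj (zz_zi i)
  rw [map_mul, h0, zero_mul, map_one] at h1
  exact zero_ne_one h1
lemma jj_zi (i : Fin 4) : jj (zi i) = (jj (zz i))⁻¹ := by
  have h1 := congrArg jj (zz_zi i)
  rw [map_mul, map_one] at h1
  exact eq_inv_of_mul_eq_one_right h1

def D3 : LS := (zz 1 - zz 0) * (zz 2 - zz 0) * (zz 2 - zz 1)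
def D4 : LS := D3 * ((zz 3 - zz 0) * (zz 3 - zz 1) * (zz 3 - zz 2))
def Dn : LS := (∏ p : Fin 4, ∏ q : Fin 4, (1 - tt * (zz q * zi p))) ^ 2
def Qs : LS := (∑ i, zz i) * (∑ i, zi i) * iv Dn * D4 * (∏ i, zi i) ^ 3

lemma cc1 (f : LS) : PowerSeries.constantCoeff (1 - tt * f) = 1 := by simp [tt]

lemma cc_Dn : PowerSeries.constantCoeff Dn = 1 := by
  simp only [Dn, map_pow, map_prod, cc1, Finset.prod_const_one, one_pow]

lemma C_mo_dsg (σ : Equiv.Perm (Fin 4)) : PowerSeries.C (mo (dsg σ)) = (∏ j : Fin 4, zz j ^ (j : ℕ)) * ∏ j, zi j ^ (σ j : ℕ) := by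
  have h : dsg σ = ∑ j : Fin 4, ((j : ℕ) • (Pi.single j 1 : Ex) + (σ j : ℕ) • (-Pi.single j 1 : Ex)) := by
    funext i
    rw [Finset.sum_apply, Finset.sum_eq_single i]
    · simp [dsg]; ring
    · intro j _ hj
      simp [hj.symm]
    · simp
  rw [h, mo_sum, map_prod, ← Finset.prod_mul_distrib]
  apply Finset.prod_congr rfl
  intro j _
  rw [mo_add, mo_nsmul, mo_nsmul, map_mul, map_pow, map_pow]
  rfl

lemma C_Vp : PowerSeries.C Vp = (∏ j : Fin 4, zz j ^ (j : ℕ)) * ∏ i : Fin 4, ∏ j > i, (zi j - zi i) := by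
  rw [← Matrix.det_vandermonde, ← Matrix.det_transpose, Matrix.det_apply', Vp, map_sum, Finset.mul_sum]
  apply Finset.sum_congr rfl
  intro σ _
  rw [map_mul, C_mo_dsg, map_intCast]
  simp only [Matrix.transpose_apply, Matrix.vandermonde_apply]
  ring

lemma C_Vp' : PowerSeries.C Vp = (zz 1 * zz 2 ^ 2 * zz 3 ^ 3) * D4 * (∏ i, zi i) ^ 3 := by
  rw [C_Vp]
  have e0 : Finset.Ioi (0 : Fin 4) = {1, 2, 3} := by decide
  have e1 : Finset.Ioi (1 : Fin 4) = {2, 3} := by decide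
  have e2 : Finset.Ioi (2 : Fin 4) = {3} := by decide
  have e3 : Finset.Ioi (3 : Fin 4) = ∅ := by decide
  rw [Fin.prod_univ_four, Fin.prod_univ_four, Fin.prod_univ_four, e0, e1, e2, e3]
  have d1 : (1 : Fin 4) ∉ ({2, 3} : Finset (Fin 4)) := by decide
  have d2 : (2 : Fin 4) ∉ ({3} : Finset (Fin 4)) := by decide
  rw [Finset.prod_insert d1, Finset.prod_insert d2, Finset.prod_insert d2, Finset.prod_singleton, Finset.prod_singleton, Finset.prod_singleton, Finset.prod_empty]
  apply jj_inj
  simp only [D4, D3, map_mul, map_sub, map_pow, jj_zi, map_one]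
  have h0 := jj_zz 0
  have h1 := jj_zz 1
  have h2 := jj_zz 2
  have h3 := jj_zz 3
  simp only [show ((0 : Fin 4) : ℕ) = 0 from rfl, show ((1 : Fin 4) : ℕ) = 1 from rfl, show ((2 : Fin 4) : ℕ) = 2 from rfl, show ((3 : Fin 4) : ℕ) = 3 from rfl]
  field_simp
  ring

lemma C_ee (i j : Fin 4) : PowerSeries.C (mo (ee i - ee j)) = zz i * zi j := by
  rw [zz, zi, ← map_mul, ← mo_add, ← sub_eq_add_neg]; rfl

lemma C_Sp : PowerSeries.C Sp = (∑ i, zz i) * (∑ i, zi i) := by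
  rw [Sp, map_sum, Finset.sum_mul_sum, Fintype.sum_prod_type]
  simp only [C_ee]

lemma Hp_eq : Hp = iv Dn := by
  symm
  apply iv_unique cc_Dn
  rw [mul_comm]
  have h := Hp_mul
  rw [Fintype.prod_sum_type] at h
  simp only [yv, C_ee, Fintype.prod_prod_type, pr, Sum.elim_inl, Sum.elim_inr, id] at h
  rw [← h, Dn, sq]
  have : ∀ x : LS, 1 - x * PowerSeries.X = 1 - tt * x := by intro x; rw [tt]; ring
  simp only [this]

theorem PS_eq2 (K : Type*) [Field K] [CharZero K] :
    mixedPS1 K 4 = CT (Qs * (zz 1 * zz 2 ^ 2 * zz 3 ^ 3)) := by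
  rw [PS_eq, C_Vp', C_Sp, Hp_eq, Qs]
  refine congrArg (fun f : LS => CT f) ?_
  ring

lemma pa_sumz (σ : Equiv.Perm (Fin 4)) : pa σ (∑ i, zz i) = ∑ i, zz i := by
  rw [map_sum]; simp only [pa_zz]; exact Equiv.sum_comp σ zz
lemma pa_sumzi (σ : Equiv.Perm (Fin 4)) : pa σ (∑ i, zi i) = ∑ i, zi i := by
  rw [map_sum]; simp only [pa_zi]; exact Equiv.sum_comp σ zi
lemma pa_prodzi (σ : Equiv.Perm (Fin 4)) : pa σ (∏ i, zi i) = ∏ i, zi i := by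
  rw [map_prod]; simp only [pa_zi]; exact Equiv.prod_comp σ zi
lemma pa_Dn (σ : Equiv.Perm (Fin 4)) : pa σ Dn = Dn := by
  rw [Dn, map_pow, map_prod]
  simp only [map_prod, map_sub, map_one, map_mul, pa_tt, pa_zz, pa_zi]
  refine congrArg (fun f : LS => f ^ 2) ?_
  rw [Equiv.prod_comp σ (fun p => ∏ q, (1 - tt * (zz (σ q) * zi p)))]
  apply Finset.prod_congr rfl
  intro p _
  exact Equiv.prod_comp σ (fun q => (1 - tt * (zz q * zi p)))

lemma pa_Qs {σ : Equiv.Perm (Fin 4)} (h : pa σ D4 = -D4) : pa σ Qs = -Qs := by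
  rw [Qs]
  simp only [map_mul, map_pow, pa_sumz, pa_sumzi, pa_prodzi, pa_iv σ cc_Dn, pa_Dn, h]
  ring

lemma CT_Qs {σ : Equiv.Perm (Fin 4)} (h : pa σ D4 = -D4) (f : LS) : CT (Qs * pa σ f) = -CT (Qs * f) := by
  rw [← CT_pa σ (Qs * f), map_mul (pa σ), pa_Qs h, neg_mul, map_neg, neg_neg]

lemma s01 : pa (Equiv.swap 0 1) D4 = -D4 := by
  simp only [D4, D3, map_mul, map_sub, pa_zz, show Equiv.swap (0 : Fin 4) 1 0 = 1 by decide, show Equiv.swap (0 : Fin 4) 1 1 = 0 by decide,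
    show Equiv.swap (0 : Fin 4) 1 2 = 2 by decide, show Equiv.swap (0 : Fin 4) 1 3 = 3 by decide]
  ring
lemma s02 : pa (Equiv.swap 0 2) D4 = -D4 := by
  simp only [D4, D3, map_mul, map_sub, pa_zz, show Equiv.swap (0 : Fin 4) 2 0 = 2 by decide, show Equiv.swap (0 : Fin 4) 2 1 = 1 by decide,
    show Equiv.swap (0 : Fin 4) 2 2 = 0 by decide, show Equiv.swap (0 : Fin 4) 2 3 = 3 by decide]
  ring
lemma s12 : pa (Equiv.swap 1 2) D4 = -D4 := by
  simp only [D4, D3, map_mul, map_sub, pa_zz, show Equiv.swap (1 : Fin 4) 2 0 = 0 by decide, show Equiv.swap (1 : Fin 4) 2 1 = 2 by decide,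
    show Equiv.swap (1 : Fin 4) 2 2 = 1 by decide, show Equiv.swap (1 : Fin 4) 2 3 = 3 by decide]
  ring
lemma s03 : pa (Equiv.swap 0 3) D4 = -D4 := by
  simp only [D4, D3, map_mul, map_sub, pa_zz, show Equiv.swap (0 : Fin 4) 3 0 = 3 by decide, show Equiv.swap (0 : Fin 4) 3 1 = 1 by decide,
    show Equiv.swap (0 : Fin 4) 3 2 = 2 by decide, show Equiv.swap (0 : Fin 4) 3 3 = 0 by decide]
  ring
lemma s13 : pa (Equiv.swap 1 3) D4 = -D4 := by
  simp only [D4, D3, map_mul, map_sub, pa_zz, show Equiv.swap (1 : Fin 4) 3 0 = 0 by decide, show Equiv.swap (1 : Fin 4) 3 1 = 3 by decide,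
    show Equiv.swap (1 : Fin 4) 3 2 = 2 by decide, show Equiv.swap (1 : Fin 4) 3 3 = 1 by decide]
  ring
lemma s23 : pa (Equiv.swap 2 3) D4 = -D4 := by
  simp only [D4, D3, map_mul, map_sub, pa_zz, show Equiv.swap (2 : Fin 4) 3 0 = 0 by decide, show Equiv.swap (2 : Fin 4) 3 1 = 1 by decide,
    show Equiv.swap (2 : Fin 4) 3 2 = 3 by decide, show Equiv.swap (2 : Fin 4) 3 3 = 2 by decide]
  ring

lemma six : CT (Qs * (zz 3 ^ 3 * D3)) = 6 * CT (Qs * (zz 1 * zz 2 ^ 2 * zz 3 ^ 3)) := by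
  have a1 := CT_Qs s01 (zz 1 * zz 2 ^ 2 * zz 3 ^ 3)
  have a2 := CT_Qs s02 (zz 1 * zz 2 ^ 2 * zz 3 ^ 3)
  have a3 := CT_Qs s12 (zz 1 * zz 2 ^ 2 * zz 3 ^ 3)
  have a4 := CT_Qs s01 (zz 2 * zz 1 ^ 2 * zz 3 ^ 3)
  have a5 := CT_Qs s12 (zz 0 * zz 2 ^ 2 * zz 3 ^ 3)
  simp only [map_mul, map_pow, pa_zz, show Equiv.swap (0 : Fin 4) 1 0 = 1 by decide, show Equiv.swap (0 : Fin 4) 1 1 = 0 by decide,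
    show Equiv.swap (0 : Fin 4) 1 2 = 2 by decide, show Equiv.swap (0 : Fin 4) 1 3 = 3 by decide,
    show Equiv.swap (0 : Fin 4) 2 0 = 2 by decide, show Equiv.swap (0 : Fin 4) 2 1 = 1 by decide,
    show Equiv.swap (0 : Fin 4) 2 2 = 0 by decide, show Equiv.swap (0 : Fin 4) 2 3 = 3 by decide,
    show Equiv.swap (1 : Fin 4) 2 0 = 0 by decide, show Equiv.swap (1 : Fin 4) 2 1 = 2 by decide,
    show Equiv.swap (1 : Fin 4) 2 2 = 1 by decide, show Equiv.swap (1 : Fin 4) 2 3 = 3 by decide] at a1 a2 a3 a4 a5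
  have : Qs * (zz 3 ^ 3 * D3) = Qs * (zz 1 * zz 2 ^ 2 * zz 3 ^ 3) - Qs * (zz 0 * zz 2 ^ 2 * zz 3 ^ 3) - Qs * (zz 1 * zz 0 ^ 2 * zz 3 ^ 3)
     - Qs * (zz 2 * zz 1 ^ 2 * zz 3 ^ 3) + Qs * (zz 2 * zz 0 ^ 2 * zz 3 ^ 3) + Qs * (zz 0 * zz 1 ^ 2 * zz 3 ^ 3) := by
    rw [D3]; ring
  rw [this]
  simp only [map_add, map_sub]
  rw [a4, a5, a3, a2, a1]
  ring

def Fs (s : LS) : LS := (zz 3 - s * zz 0) * (zz 3 - s * zz 1) * (zz 3 - s * zz 2)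

lemma four (s : PowerSeries ℚ) (hs : ∀ σ, pa σ (io s) = io s) : 4 * CT (Qs * (Fs (io s) * D3)) = (1 + s + s ^ 2 + s ^ 3) * CT (Qs * D4) := by
  have a1 := CT_Qs s03 (Fs (io s) * D3)
  have a2 := CT_Qs s13 (Fs (io s) * D3)
  have a3 := CT_Qs s23 (Fs (io s) * D3)
  have key : Qs * (Fs (io s) * D3) - Qs * pa (Equiv.swap 0 3) (Fs (io s) * D3) - Qs * pa (Equiv.swap 1 3) (Fs (io s) * D3)
      - Qs * pa (Equiv.swap 2 3) (Fs (io s) * D3) = io (1 + s + s ^ 2 + s ^ 3) * (Qs * D4) := by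
    simp only [Fs, D3, D4, map_mul, map_sub, map_add, map_one, map_pow, hs, pa_zz, 
     show Equiv.swap (0 : Fin 4) 3 0 = 3 by decide, show Equiv.swap (0 : Fin 4) 3 1 = 1 by decide,
    show Equiv.swap (0 : Fin 4) 3 2 = 2 by decide, show Equiv.swap (0 : Fin 4) 3 3 = 0 by decide,
    show Equiv.swap (1 : Fin 4) 3 0 = 0 by decide, show Equiv.swap (1 : Fin 4) 3 1 = 3 by decide,
    show Equiv.swap (1 : Fin 4) 3 2 = 2 by decide, show Equiv.swap (1 : Fin 4) 3 3 = 1 by decide,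
    show Equiv.swap (2 : Fin 4) 3 0 = 0 by decide, show Equiv.swap (2 : Fin 4) 3 1 = 1 by decide,
    show Equiv.swap (2 : Fin 4) 3 2 = 3 by decide, show Equiv.swap (2 : Fin 4) 3 3 = 2 by decide]
    ring
  rw [← CT_io (1 + s + s ^ 2 + s ^ 3), ← key]
  simp only [map_sub, a1, a2, a3]
  ring

theorem PS_eq3 (K : Type*) [Field K] [CharZero K] :
    6 * (1 + PowerSeries.X + PowerSeries.X ^ 2 + PowerSeries.X ^ 3) * mixedPS1 K 4 = CT (Qs * (Fs tt * D3)) := by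
  have h1 := four PowerSeries.X (by intro σ; rw [io_X]; exact pa_tt σ)
  have h0 := four 0 (by intro σ; rw [map_zero, map_zero])
  rw [io_X] at h1
  have e0 : Fs (io 0) = zz 3 ^ 3 := by rw [Fs, map_zero]; ring
  rw [e0, six, ← PS_eq2 K] at h0
  change 4 * CT (Qs * (Fs tt * D3)) = _ at h1
  have h4 : (4 : PowerSeries ℚ) ≠ 0 := by
    intro h
    have := congrArg PowerSeries.constantCoeff h
    rw [map_ofNat, map_zero] at this
    norm_num at this
  apply mul_left_cancel₀ h4
  rw [h1]
  linear_combination (1 + PowerSeries.X + PowerSeries.X ^ 2 + PowerSeries.X ^ 3) * h0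


/-! elimination of the last variable -/
def wv (i : Fin 4) : Ex →+ ℤ := Pi.evalAddMonoidHom (fun _ => ℤ) i
lemma wv_s (i j : Fin 4) : wv i (Pi.single j 1) = if i = j then 1 else 0 := by
  change (Pi.single j (1 : ℤ) : Ex) i = _
  rw [Pi.single_apply]
lemma Ge_zz0 {i j : Fin 4} (h : i ≠ j) : Ge (wv i) 0 (zz j) := Ge_zz (by rw [wv_s, if_neg h])
lemma Ge_zi0 {i j : Fin 4} (h : i ≠ j) : Ge (wv i) 0 (zi j) := Ge_zi (by rw [map_neg, wv_s, if_neg h, neg_zero])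
lemma Ge_zz1 (i : Fin 4) : Ge (wv i) 1 (zz i) := Ge_zz (by rw [wv_s, if_pos rfl])
lemma Ge_zz0n {i j : Fin 4} (h : i ≠ j) : Ge (-wv i) 0 (zz j) := Ge_zz (by rw [AddMonoidHom.neg_apply, wv_s, if_neg h, neg_zero])
lemma Ge_zi0n {i j : Fin 4} (h : i ≠ j) : Ge (-wv i) 0 (zi j) := Ge_zi (by rw [AddMonoidHom.neg_apply, map_neg, wv_s, if_neg h, neg_zero, neg_zero])
lemma Ge_zi1n (i : Fin 4) : Ge (-wv i) 1 (zi i) := Ge_zi (by rw [AddMonoidHom.neg_apply, map_neg, wv_s, if_pos rfl, neg_neg])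

/-- both `f` and its specialisation `f0` are regular and congruent modulo `u - B` -/
def Cg (w : Ex →+ ℤ) (u B f f0 : LS) : Prop := Ge w 0 f ∧ Ge w 0 f0 ∧ ∃ q, Ge w 0 q ∧ f = f0 + (u - B) * q

section
variable {w : Ex →+ ℤ} {u B : LS}
lemma Cg.const {f : LS} (h : Ge w 0 f) : Cg w u B f f := ⟨h, h, 0, Ge.zero _ _, by ring⟩
lemma Cg.self (hu : Ge w 0 u) (hB : Ge w 0 B) : Cg w u B u B := ⟨hu, hB, 1, Ge_one _, by ring⟩
lemma Cg.add {f f0 g g0 : LS} (hf : Cg w u B f f0) (hg : Cg w u B g g0) : Cg w u B (f + g) (f0 + g0) := by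
  obtain ⟨a, b, q, hq, e⟩ := hf
  obtain ⟨a', b', q', hq', e'⟩ := hg
  exact ⟨a.add a', b.add b', q + q', hq.add hq', by rw [e, e']; ring⟩
lemma Cg.sub {f f0 g g0 : LS} (hf : Cg w u B f f0) (hg : Cg w u B g g0) : Cg w u B (f - g) (f0 - g0) := by
  obtain ⟨a, b, q, hq, e⟩ := hf
  obtain ⟨a', b', q', hq', e'⟩ := hg
  exact ⟨a.sub a', b.sub b', q - q', hq.sub hq', by rw [e, e']; ring⟩
lemma Cg.mul {f f0 g g0 : LS} (hf : Cg w u B f f0) (hg : Cg w u B g g0) : Cg w u B (f * g) (f0 * g0) := by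
  obtain ⟨a, b, q, hq, e⟩ := hf
  obtain ⟨a', b', q', hq', e'⟩ := hg
  exact ⟨a.mul0 a', b.mul0 b', q * g + f0 * q', (hq.mul0 a').add (b.mul0 hq'), by rw [e, e']; ring⟩
lemma Cg.ivv {f f0 : LS} (hf : Cg w u B f f0) (hc : PowerSeries.constantCoeff f = 1) (hc0 : PowerSeries.constantCoeff f0 = 1) :
    Cg w u B (iv f) (iv f0) := by
  obtain ⟨a, b, q, hq, e⟩ := hf
  have h1 := mul_iv hc
  have h0 := mul_iv hc0
  refine ⟨a.iv hc, b.iv hc0, -(q * (iv f * iv f0)), (hq.mul0 ((a.iv hc).mul0 (b.iv hc0))).neg, ?_⟩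
  linear_combination (-iv f) * h0 + iv f0 * h1 - (iv f * iv f0) * e
end

/-- the basic residue computation -/
lemma elim (w : Ex →+ ℤ) (u v B h h0 E : LS) (huv : u * v = 1) (hu : Ge w 1 u) (hv : Ge (-w) 1 v)
    (hB : Ge (-w) 0 B) (hE : Ge w 0 E) (hE' : Ge (-w) 0 E) (hh : Cg w u (tt * B) h h0) (hh0 : Ge (-w) 0 h0) :
    CT (E * h * iv (1 - tt * (B * v))) = CT (E * h0) := by
  obtain ⟨_, _, q, hq, e⟩ := hh
  have hi := mul_iv (cc1 (B * v))
  have key : E * h * iv (1 - tt * (B * v)) = E * h0 + u * (E * q) + v * (tt * B * (E * h0) * iv (1 - tt * (B * v))) := by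
    rw [e]
    linear_combination (E * h0 + u * E * q) * hi + E * q * tt * B * iv (1 - tt * (B * v)) * huv
  have hg : Ge (-w) 0 (iv (1 - tt * (B * v))) := by
    refine Ge.iv ?_ (cc1 _)
    refine (Ge_one _).sub ((Ge_tt _).mul0 ?_)
    exact ((hB.mul hv).mono (by norm_num))
  rw [key, map_add, map_add, CT_Ge (hu.mul0 (hE.mul0 hq)), CT_Ge (hv.mul0 ((((Ge_tt _).mul0 hB).mul0 (hE'.mul0 hh0)).mul0 hg)), add_zero, add_zero]

lemma iv_mul {f g : LS} (hf : PowerSeries.constantCoeff f = 1) (hg : PowerSeries.constantCoeff g = 1) : iv (f * g) = iv f * iv g := by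
  apply iv_unique
  · rw [map_mul, hf, hg, one_mul]
  · linear_combination (g * iv g) * mul_iv hf + mul_iv hg

/-! pieces -/
def e3 : LS := zz 0 + zz 1 + zz 2
def f3 : LS := zi 0 + zi 1 + zi 2
def H3d : LS := (1 - tt * (zz 0 * zi 1)) * (1 - tt * (zz 1 * zi 0)) * (1 - tt * (zz 0 * zi 2)) * (1 - tt * (zz 2 * zi 0)) * 
   (1 - tt * (zz 1 * zi 2)) * (1 - tt * (zz 2 * zi 1))
def Hu (v : LS) : LS := (1 - tt * (v * zi 0)) * (1 - tt * (v * zi 1)) * (1 - tt * (v * zi 2))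
def Iu (k : Fin 4) : LS := iv (1 - tt * (zz k * zi 3))
def hfn (v : LS) : LS := (v + e3) * (1 + v * f3) * ((1 - v * zi 0) * (1 - v * zi 1) * (1 - v * zi 2)) * (iv (Hu v) * iv (Hu v))
def E3 : LS := iv (1 - tt) ^ 8 * (-(iv H3d * iv H3d * D3 * (zi 0 * zi 1 * zi 2) ^ 2))

lemma cc_t : PowerSeries.constantCoeff (1 - tt) = 1 := by simp [tt]
lemma cc_H3d : PowerSeries.constantCoeff H3d = 1 := by simp only [H3d, map_mul, cc1, one_mul]
lemma cc_Hu (v : LS) : PowerSeries.constantCoeff (Hu v) = 1 := by simp only [Hu, map_mul, cc1, one_mul]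

lemma Dn_eq : Dn = (1 - tt) ^ 8 * (H3d * H3d) * (Hu (zz 3) * Hu (zz 3)) *
    ((1 - tt * (zz 0 * zi 3)) * (1 - tt * (zz 1 * zi 3)) * (1 - tt * (zz 2 * zi 3))) ^ 2 := by
  simp only [Dn, Fin.prod_univ_four, zz_zi, H3d, Hu, mul_one]
  generalize 1 - tt * (zz 1 * zi 0) = a10
  generalize 1 - tt * (zz 2 * zi 0) = a20
  generalize 1 - tt * (zz 3 * zi 0) = a30
  generalize 1 - tt * (zz 0 * zi 1) = a01
  generalize 1 - tt * (zz 2 * zi 1) = a21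
  generalize 1 - tt * (zz 3 * zi 1) = a31
  generalize 1 - tt * (zz 0 * zi 2) = a02
  generalize 1 - tt * (zz 1 * zi 2) = a12
  generalize 1 - tt * (zz 3 * zi 2) = a32
  generalize 1 - tt * (zz 0 * zi 3) = a03
  generalize 1 - tt * (zz 1 * zi 3) = a13
  generalize 1 - tt * (zz 2 * zi 3) = a23
  generalize 1 - tt = d
  ring

lemma ivDn_eq : iv Dn = iv (1 - tt) ^ 8 * (iv H3d * iv H3d) * (iv (Hu (zz 3)) * iv (Hu (zz 3))) * (Iu 0 * Iu 1 * Iu 2) ^ 2 := by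
  apply iv_unique cc_Dn
  rw [Dn_eq]
  have h1 := mul_iv cc_t
  have h2 := mul_iv cc_H3d
  have h3 := mul_iv (cc_Hu (zz 3))
  have h4 : (1 - tt * (zz 0 * zi 3)) * Iu 0 = 1 := mul_iv (cc1 _)
  have h5 : (1 - tt * (zz 1 * zi 3)) * Iu 1 = 1 := mul_iv (cc1 _)
  have h6 : (1 - tt * (zz 2 * zi 3)) * Iu 2 = 1 := mul_iv (cc1 _)
  generalize 1 - tt * (zz 0 * zi 3) = a at *
  generalize 1 - tt * (zz 1 * zi 3) = b at *
  generalize 1 - tt * (zz 2 * zi 3) = c at *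
  generalize 1 - tt = d at *
  calc _ = (d * iv d) ^ 8 * (H3d * iv H3d) ^ 2 * (Hu (zz 3) * iv (Hu (zz 3))) ^ 2 * (a * Iu 0) ^ 2 * (b * Iu 1) ^ 2 * (c * Iu 2) ^ 2 := by ring
    _ = 1 := by rw [h1, h2, h3, h4, h5, h6]; ring

lemma alg1 {R : Type*} [CommRing R] {S S' d8 H A I F D V t v Z Pi' Sig u3 : R} (h1 : S = v * S') (h3 : F * I = u3)
    (h2 : V * u3 = -(D * Z * Pi')) (h4 : t * v * D * I = Sig) :
    t * (S * (d8 * H * A * I ^ 2) * V * (F * D)) = d8 * (-(H * D * Z)) * (S' * Pi' * A) * Sig := by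
  subst h1 h3 h4
  linear_combination (t * v * S' * d8 * H * A * I * D) * h2

lemma t_int : tt * (Qs * (Fs tt * D3)) = E3 * hfn (zz 3) * (zz 0 * (zz 2 - zz 1) * Iu 0 + zz 1 * (zz 0 - zz 2) * Iu 1 + zz 2 * (zz 1 - zz 0) * Iu 2) := by
  have h1 : (∑ i, zz i) * (∑ i, zi i) = zi 3 * ((zz 3 + e3) * (1 + zz 3 * f3)) := by
    rw [Fin.sum_univ_four, Fin.sum_univ_four, e3, f3]
    linear_combination (-(zz 3 + zz 0 + zz 1 + zz 2) * (zi 0 + zi 1 + zi 2)) * zz_zi 3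
  have h4 : (1 - tt * (zz 0 * zi 3)) * Iu 0 = 1 := mul_iv (cc1 _)
  have h5 : (1 - tt * (zz 1 * zi 3)) * Iu 1 = 1 := mul_iv (cc1 _)
  have h6 : (1 - tt * (zz 2 * zi 3)) * Iu 2 = 1 := mul_iv (cc1 _)
  have h3 : Fs tt * (Iu 0 * Iu 1 * Iu 2) = zz 3 ^ 3 := by
    have g0 : ∀ k, zz 3 - tt * zz k = zz 3 * (1 - tt * (zz k * zi 3)) := fun k => by linear_combination (tt * zz k) * zz_zi 3
    rw [Fs, g0, g0, g0]
    calc _ = zz 3 ^ 3 * (((1 - tt * (zz 0 * zi 3)) * Iu 0) * ((1 - tt * (zz 1 * zi 3)) * Iu 1) * ((1 - tt * (zz 2 * zi 3)) * Iu 2)) := by ring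
      _ = _ := by rw [h4, h5, h6]; ring
  have h2 : (D4 * (∏ i, zi i) ^ 3) * zz 3 ^ 3 = -(D3 * (zi 0 * zi 1 * zi 2) ^ 2 * ((1 - zz 3 * zi 0) * (1 - zz 3 * zi 1) * (1 - zz 3 * zi 2))) := by
    rw [Fin.prod_univ_four, D4]
    apply jj_inj
    generalize D3 = D
    simp only [map_mul, map_sub, map_pow, jj_zi, map_one, map_neg]
    have h0 := jj_zz 0
    have h1 := jj_zz 1
    have h2 := jj_zz 2
    have h3 := jj_zz 3
    field_simp
    ring
  have h7 : tt * zi 3 * D3 * (Iu 0 * Iu 1 * Iu 2) = (zz 0 * (zz 2 - zz 1) * Iu 0 + zz 1 * (zz 0 - zz 2) * Iu 1 + zz 2 * (zz 1 - zz 0) * Iu 2) := by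
    have g : tt * zi 3 * D3 = zz 0 * (zz 2 - zz 1) * ((1 - tt * (zz 1 * zi 3)) * (1 - tt * (zz 2 * zi 3))) +
       zz 1 * (zz 0 - zz 2) * ((1 - tt * (zz 0 * zi 3)) * (1 - tt * (zz 2 * zi 3))) + zz 2 * (zz 1 - zz 0) * ((1 - tt * (zz 0 * zi 3)) * (1 - tt * (zz 1 * zi 3))) := by
      rw [D3]; ring
    rw [g]
    generalize 1 - tt * (zz 0 * zi 3) = a at *
    generalize 1 - tt * (zz 1 * zi 3) = b at *
    generalize 1 - tt * (zz 2 * zi 3) = c at *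
    calc _ = zz 0 * (zz 2 - zz 1) * Iu 0 * ((b * Iu 1) * (c * Iu 2)) + zz 1 * (zz 0 - zz 2) * Iu 1 * ((a * Iu 0) * (c * Iu 2)) + zz 2 * (zz 1 - zz 0) * Iu 2 * ((a * Iu 0) * (b * Iu 1)) := by ring
      _ = _ := by rw [h4, h5, h6]; ring
  have h := alg1 (d8 := iv (1 - tt) ^ 8) (H := iv H3d * iv H3d) (A := iv (Hu (zz 3)) * iv (Hu (zz 3))) h1 h3 h2 h7
  rw [Qs, ivDn_eq, E3, hfn, mul_assoc _ D4]
  exact h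

lemma pa_e3 {σ : Equiv.Perm (Fin 4)} (h : zz (σ 0) + zz (σ 1) + zz (σ 2) = e3) : pa σ e3 = e3 := by
  simp only [e3, map_add, pa_zz] at *; exact h

lemma pa_term {σ : Equiv.Perm (Fin 4)} (h3 : σ 3 = 3) (he : pa σ e3 = e3) (hf : pa σ f3 = f3) (hD : pa σ D3 = - D3)
   (hH : pa σ H3d = H3d) (hp : pa σ (zi 0 * zi 1 * zi 2) = zi 0 * zi 1 * zi 2) 
   (hq : pa σ ((1 - zz 3 * zi 0) * (1 - zz 3 * zi 1) * (1 - zz 3 * zi 2)) = ((1 - zz 3 * zi 0) * (1 - zz 3 * zi 1) * (1 - zz 3 * zi 2)))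
   (hU : pa σ (Hu (zz 3)) = Hu (zz 3)) (f : LS) : CT (E3 * hfn (zz 3) * pa σ f) = -CT (E3 * hfn (zz 3) * f) := by
  have h1 : pa σ (E3 * hfn (zz 3)) = -(E3 * hfn (zz 3)) := by
    rw [E3, hfn, map_mul, map_mul (pa σ) (_ * _ * _), map_mul (pa σ) (_ * _) ((_ * _ * _ : LS)), hq]
    simp only [map_mul (pa σ) (iv _), map_mul (pa σ) (_ ^ 8), map_neg, map_pow, map_mul (pa σ) (_ * _) (_ ^ 2), hp, map_mul (pa σ) _ D3, hD,
      pa_iv σ cc_t, pa_iv σ cc_H3d, pa_iv σ (cc_Hu _), hU, hH, map_mul (pa σ) (_ + _) _, map_add, he, pa_zz, h3, map_one, map_mul (pa σ) (zz 3), hf,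
      map_sub, pa_tt]
    ring
  rw [← CT_pa σ (E3 * hfn (zz 3) * f), map_mul (pa σ), h1, neg_mul, map_neg, neg_neg]

lemma CT_t_int : CT (tt * (Qs * (Fs tt * D3))) = 3 * CT (E3 * hfn (zz 3) * (zz 0 * (zz 2 - zz 1) * Iu 0)) := by
  have a1 : CT (E3 * hfn (zz 3) * pa (Equiv.swap 0 1) (zz 0 * (zz 2 - zz 1) * Iu 0)) = -CT (E3 * hfn (zz 3) * (zz 0 * (zz 2 - zz 1) * Iu 0)) := by
    apply pa_term <;> simp only [e3, f3, D3, H3d, Hu, map_mul, map_sub, map_add, map_one, pa_tt, pa_zz, pa_zi, show Equiv.swap (0 : Fin 4) 1 0 = 1 by decide, show Equiv.swap (0 : Fin 4) 1 1 = 0 by decide,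
      show Equiv.swap (0 : Fin 4) 1 2 = 2 by decide, show Equiv.swap (0 : Fin 4) 1 3 = 3 by decide] <;> ring
  have a2 : CT (E3 * hfn (zz 3) * pa (Equiv.swap 0 2) (zz 0 * (zz 2 - zz 1) * Iu 0)) = -CT (E3 * hfn (zz 3) * (zz 0 * (zz 2 - zz 1) * Iu 0)) := by
    apply pa_term <;> simp only [e3, f3, D3, H3d, Hu, map_mul, map_sub, map_add, map_one, pa_tt, pa_zz, pa_zi, show Equiv.swap (0 : Fin 4) 2 0 = 2 by decide, show Equiv.swap (0 : Fin 4) 2 1 = 1 by decide,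
      show Equiv.swap (0 : Fin 4) 2 2 = 0 by decide, show Equiv.swap (0 : Fin 4) 2 3 = 3 by decide] <;> ring
  simp only [Iu, map_mul, map_sub, pa_zz, pa_zi, pa_tt, map_one, pa_iv _ (cc1 _), show Equiv.swap (0 : Fin 4) 1 0 = 1 by decide, show Equiv.swap (0 : Fin 4) 1 1 = 0 by decide,
      show Equiv.swap (0 : Fin 4) 1 2 = 2 by decide, show Equiv.swap (0 : Fin 4) 1 3 = 3 by decide, show Equiv.swap (0 : Fin 4) 2 0 = 2 by decide, show Equiv.swap (0 : Fin 4) 2 1 = 1 by decide,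
      show Equiv.swap (0 : Fin 4) 2 2 = 0 by decide, show Equiv.swap (0 : Fin 4) 2 3 = 3 by decide] at a1 a2
  have key : tt * (Qs * (Fs tt * D3)) = E3 * hfn (zz 3) * (zz 0 * (zz 2 - zz 1) * Iu 0) - E3 * hfn (zz 3) * (zz 1 * (zz 2 - zz 0) * Iu 1)
     - E3 * hfn (zz 3) * (zz 2 * (zz 0 - zz 1) * Iu 2) := by
    rw [t_int]; ring
  rw [key, map_sub, map_sub, Iu, Iu, Iu, a1, a2]
  ring


lemma Ge3a : Ge (wv 3) 0 (E3 * (zz 0 * (zz 2 - zz 1))) := by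
  unfold E3 D3
  refine Ge.mul0 (Ge.mul0 (((Ge_one _).sub (Ge_tt _)).iv cc_t |>.pow 8) (Ge.neg ?_)) ?_
  · have : Ge (wv 3) 0 (iv H3d) := by
      refine Ge.iv ?_ cc_H3d
      unfold H3d
      repeat' first | with_reducible apply Ge.mul0 | with_reducible apply Ge.sub | with_reducible exact Ge_one _ | with_reducible exact Ge_tt _ | with_reducible refine Ge_zz0 ?_ | with_reducible refine Ge_zi0 ?_ | decide
    repeat' first | with_reducible exact this | with_reducible apply Ge.mul0 | with_reducible apply Ge.pow | with_reducible apply Ge.sub | with_reducible exact Ge_one _ | with_reducible exact Ge_tt _ | with_reducible refine Ge_zz0 ?_ | with_reducible refine Ge_zi0 ?_ | decide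
  · repeat' first | with_reducible apply Ge.mul0 | with_reducible apply Ge.pow | with_reducible apply Ge.sub | with_reducible exact Ge_one _ | with_reducible exact Ge_tt _ | with_reducible refine Ge_zz0 ?_ | with_reducible refine Ge_zi0 ?_ | decide

lemma Ge3b : Ge (-wv 3) 0 (E3 * (zz 0 * (zz 2 - zz 1))) := by
  unfold E3 D3
  refine Ge.mul0 (Ge.mul0 (((Ge_one _).sub (Ge_tt _)).iv cc_t |>.pow 8) (Ge.neg ?_)) ?_
  · have : Ge (-wv 3) 0 (iv H3d) := by
      refine Ge.iv ?_ cc_H3d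
      unfold H3d
      repeat' first | with_reducible apply Ge.mul0 | with_reducible apply Ge.sub | with_reducible exact Ge_one _ | with_reducible exact Ge_tt _ | with_reducible refine Ge_zz0n ?_ | with_reducible refine Ge_zi0n ?_ | decide
    repeat' first | with_reducible exact this | with_reducible apply Ge.mul0 | with_reducible apply Ge.pow | with_reducible apply Ge.sub | with_reducible exact Ge_one _ | with_reducible exact Ge_tt _ | with_reducible refine Ge_zz0n ?_ | with_reducible refine Ge_zi0n ?_ | decide
  · repeat' first | with_reducible apply Ge.mul0 | with_reducible apply Ge.pow | with_reducible apply Ge.sub | with_reducible exact Ge_one _ | with_reducible exact Ge_tt _ | with_reducible refine Ge_zz0n ?_ | with_reducible refine Ge_zi0n ?_ | decide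

lemma Ge3c : Ge (-wv 3) 0 (hfn (tt * zz 0)) := by
  have : Ge (-wv 3) 0 (iv (Hu (tt * zz 0))) := by
    refine Ge.iv ?_ (cc_Hu _)
    unfold Hu
    repeat' first | with_reducible apply Ge.mul0 | with_reducible apply Ge.sub | with_reducible exact Ge_one _ | with_reducible exact Ge_tt _ | with_reducible refine Ge_zz0n ?_ | with_reducible refine Ge_zi0n ?_ | decide
  unfold hfn e3 f3
  repeat' first | with_reducible exact this | with_reducible apply Ge.mul0 | with_reducible apply Ge.add | with_reducible apply Ge.sub | with_reducible exact Ge_one _ | with_reducible exact Ge_tt _ | with_reducible refine Ge_zz0n ?_ | with_reducible refine Ge_zi0n ?_ | decide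

lemma Cg3 : Cg (wv 3) (zz 3) (tt * zz 0) (hfn (zz 3)) (hfn (tt * zz 0)) := by
  have hs : Cg (wv 3) (zz 3) (tt * zz 0) (zz 3) (tt * zz 0) := Cg.self ((Ge_zz1 3).mono (by norm_num)) ((Ge_tt _).mul0 (Ge_zz0 (by decide)))
  have c0 : Cg (wv 3) (zz 3) (tt * zz 0) (zi 0) (zi 0) := Cg.const (Ge_zi0 (by decide))
  have c1 : Cg (wv 3) (zz 3) (tt * zz 0) (zi 1) (zi 1) := Cg.const (Ge_zi0 (by decide))
  have c2 : Cg (wv 3) (zz 3) (tt * zz 0) (zi 2) (zi 2) := Cg.const (Ge_zi0 (by decide))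
  have o : Cg (wv 3) (zz 3) (tt * zz 0) 1 1 := Cg.const (Ge_one _)
  have t : Cg (wv 3) (zz 3) (tt * zz 0) tt tt := Cg.const (Ge_tt _)
  have ce : Cg (wv 3) (zz 3) (tt * zz 0) e3 e3 := Cg.const (((Ge_zz0 (by decide)).add (Ge_zz0 (by decide))).add (Ge_zz0 (by decide)))
  have cf : Cg (wv 3) (zz 3) (tt * zz 0) f3 f3 := Cg.const (((Ge_zi0 (by decide)).add (Ge_zi0 (by decide))).add (Ge_zi0 (by decide)))
  have hu : Cg (wv 3) (zz 3) (tt * zz 0) (iv (Hu (zz 3))) (iv (Hu (tt * zz 0))) := by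
    refine Cg.ivv ?_ (cc_Hu _) (cc_Hu _)
    exact ((o.sub (t.mul (hs.mul c0))).mul (o.sub (t.mul (hs.mul c1)))).mul (o.sub (t.mul (hs.mul c2)))
  exact (((hs.add ce).mul (o.add (hs.mul cf))).mul (((o.sub (hs.mul c0)).mul (o.sub (hs.mul c1))).mul (o.sub (hs.mul c2)))).mul (hu.mul hu)

lemma elim3 : CT (E3 * hfn (zz 3) * (zz 0 * (zz 2 - zz 1) * Iu 0)) = CT (E3 * (zz 0 * (zz 2 - zz 1)) * hfn (tt * zz 0)) := by
  have h := elim (wv 3) (zz 3) (zi 3) (zz 0) (hfn (zz 3)) (hfn (tt * zz 0)) (E3 * (zz 0 * (zz 2 - zz 1))) (zz_zi 3) (Ge_zz1 3) (Ge_zi1n 3)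
    (Ge_zz0n (by decide)) Ge3a Ge3b Cg3 Ge3c
  rw [← h]
  refine congrArg (fun f : LS => CT f) ?_
  rw [Iu]
  ring

def xx : LS := zz 0 * zi 1
def xi : LS := zz 1 * zi 0
def yy : LS := zz 0 * zi 2
def yi : LS := zz 2 * zi 0
def xy : LS := zz 2 * zi 1
def yx : LS := zz 1 * zi 2

lemma zq (i j : Fin 4) : zz i * zi j * (zz j * zi i) = 1 := by
  calc _ = (zz i * zi i) * (zz j * zi j) := by ring
    _ = 1 := by rw [zz_zi, zz_zi, one_mul]
lemma xx_xi : xx * xi = 1 := zq 0 1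
lemma yy_yi : yy * yi = 1 := zq 0 2
lemma xy_e : xy = xx * yi := by rw [xy, xx, yi]; linear_combination (-zz 2 * zi 1) * zz_zi 0
lemma yx_e : yx = yy * xi := by rw [yx, yy, xi]; linear_combination (-zz 1 * zi 2) * zz_zi 0


def Kk : LS := (1 + tt + xi + yi) * (1 + tt + tt * xx + tt * yy) * (1 - xx) * (1 - yy) *
  (iv (1 - tt * xx) * iv (1 - tt * yy)) * (iv (1 - tt * xi) * iv (1 - tt * yi)) ^ 2 *
  (iv (1 - tt * (tt * xx)) * iv (1 - tt * (tt * yy))) ^ 2 * (iv (1 - tt * yx) * iv (1 - tt * xy)) ^ 2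

lemma ivH3 : iv H3d = iv (1 - tt * xx) * iv (1 - tt * xi) * iv (1 - tt * yy) * iv (1 - tt * yi) * iv (1 - tt * yx) * iv (1 - tt * xy) := by
  change iv ((1 - tt * xx) * (1 - tt * xi) * (1 - tt * yy) * (1 - tt * yi) * (1 - tt * yx) * (1 - tt * xy)) = _
  rw [iv_mul (by simp only [map_mul, cc1, one_mul]) (cc1 _), iv_mul (by simp only [map_mul, cc1, one_mul]) (cc1 _), iv_mul (by simp only [map_mul, cc1, one_mul]) (cc1 _),
   iv_mul (by simp only [map_mul, cc1, one_mul]) (cc1 _), iv_mul (cc1 _) (cc1 _)]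

lemma ivHu : iv (Hu (tt * zz 0)) = iv (1 - tt * tt) * iv (1 - tt * (tt * xx)) * iv (1 - tt * (tt * yy)) := by
  have : Hu (tt * zz 0) = (1 - tt * tt) * (1 - tt * (tt * xx)) * (1 - tt * (tt * yy)) := by
    rw [Hu, mul_assoc tt (zz 0), zz_zi, mul_one, mul_assoc tt (zz 0), mul_assoc tt (zz 0)]; rfl
  rw [this, iv_mul (by simp only [map_mul, cc1, one_mul]) (cc1 _), iv_mul (cc1 _) (cc1 _)]

lemma laur : -(D3 * (zi 0 * zi 1 * zi 2) ^ 2) * (zz 0 * (zz 2 - zz 1)) * (tt * zz 0 + e3) =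
    (1 - xx) * (1 - yy) * (1 - yx) * (1 - xy) * (1 + tt + xi + yi) := by
  apply jj_inj
  simp only [D3, e3, xx, yy, yx, xy, xi, yi, map_mul, map_sub, map_add, map_pow, jj_zi, map_one, map_neg]
  have h0 := jj_zz 0
  have h1 := jj_zz 1
  have h2 := jj_zz 2
  field_simp
  ring

lemma alg2 {R : Type*} [CommRing R] {d d1 ax ay bx b_y ax' ay' dx dy gx gy m D W z T F S' Y : R}
   (hd : d * d1 = 1) (hm : S' * m = 1) (hx : ax' * ax = 1) (hy : ay' * ay = 1) (hL : -(D * W) * z * T = Y) :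
   (d ^ 7 * S' ^ 2) * (d1 ^ 8 * (-((ax * bx * ay * b_y * gx * gy) * (ax * bx * ay * b_y * gx * gy) * D * W)) * z * (T * F * (d * ax' * ay') * ((m * dx * dy) * (m * dx * dy)))) =
     Y * F * (ax * ay) * (bx * b_y) ^ 2 * (dx * dy) ^ 2 * (gx * gy) ^ 2 := by
  subst hL
  calc _ = (d * d1) ^ 8 * (S' * m) ^ 2 * (ax' * ax) * (ay' * ay) * (-(D * W) * z * T * F * (ax * ay) * (bx * b_y) ^ 2 * (dx * dy) ^ 2 * (gx * gy) ^ 2) := by ring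
    _ = _ := by rw [hd, hm, hx, hy]; ring

lemma K_eq : ((1 - tt) ^ 7 * (1 - tt * tt) ^ 2) * (E3 * (zz 0 * (zz 2 - zz 1)) * hfn (tt * zz 0)) = Kk * ((1 - yx) * (1 - xy)) := by
  have h := alg2 (bx := iv (1 - tt * xi)) (b_y := iv (1 - tt * yi)) (dx := iv (1 - tt * (tt * xx))) (dy := iv (1 - tt * (tt * yy))) 
    (gx := iv (1 - tt * yx)) (gy := iv (1 - tt * xy)) (F := 1 + tt + tt * xx + tt * yy) (mul_iv cc_t) (mul_iv (cc1 tt)) (mul_iv (cc1 xx)) (mul_iv (cc1 yy)) laur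
  rw [E3, hfn, ivH3, ivHu]
  have e1 : 1 + tt * zz 0 * f3 = 1 + tt + tt * xx + tt * yy := by
    rw [f3, xx, yy]; linear_combination tt * zz_zi 0
  have e2 : (1 - tt * zz 0 * zi 0) * (1 - tt * zz 0 * zi 1) * (1 - tt * zz 0 * zi 2) = (1 - tt) * (1 - tt * xx) * (1 - tt * yy) := by
    rw [mul_assoc tt (zz 0), zz_zi, mul_one, mul_assoc tt (zz 0), mul_assoc tt (zz 0)]; rfl
  rw [e1, e2, h, Kk]
  generalize iv (1 - tt * xx) * iv (1 - tt * yy) = q1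
  generalize iv (1 - tt * xi) * iv (1 - tt * yi) = q2
  generalize iv (1 - tt * (tt * xx)) * iv (1 - tt * (tt * yy)) = q3
  generalize iv (1 - tt * yx) * iv (1 - tt * xy) = q4
  ring

def Gg : LS := (1 + tt + xi + yi) * (1 + tt + tt * xx + tt * yy) * (1 - xx) * (1 - yy) * (1 - yx) *
  (iv (1 - tt * xx) * iv (1 - tt * yy)) * (iv (1 - tt * xi) * iv (1 - tt * yi)) ^ 2 *
  (iv (1 - tt * (tt * xx)) * iv (1 - tt * (tt * yy))) ^ 2 * (iv (1 - tt * yx) ^ 2 * iv (1 - tt * xy))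

lemma Gg_eq : Kk * ((1 - yx) * (1 - tt * xy)) = Gg := by
  have h := mul_iv (cc1 xy)
  rw [Kk, Gg]
  generalize iv (1 - tt * xx) * iv (1 - tt * yy) = q1
  generalize iv (1 - tt * xi) * iv (1 - tt * yi) = q2
  generalize iv (1 - tt * (tt * xx)) * iv (1 - tt * (tt * yy)) = q3
  generalize iv (1 - tt * yx) = q4
  generalize iv (1 - tt * xy) = q5 at *
  generalize 1 - tt * xy = q6 at *
  generalize (1 + tt + xi + yi) * (1 + tt + tt * xx + tt * yy) * (1 - xx) * (1 - yy) = q7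
  generalize 1 - yx = q8
  calc _ = q7 * q8 * q1 * q2 ^ 2 * q3 ^ 2 * (q4 ^ 2 * q5) * (q6 * q5) := by ring
    _ = _ := by rw [h, mul_one]

lemma ps_xx : pa (Equiv.swap 1 2) xx = yy := by
  rw [xx, yy, map_mul, pa_zz, pa_zi]; rfl
lemma ps_yy : pa (Equiv.swap 1 2) yy = xx := by
  rw [yy, xx, map_mul, pa_zz, pa_zi]; rfl
lemma ps_xi : pa (Equiv.swap 1 2) xi = yi := by
  rw [xi, yi, map_mul, pa_zz, pa_zi]; rfl
lemma ps_yi : pa (Equiv.swap 1 2) yi = xi := by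
  rw [yi, xi, map_mul, pa_zz, pa_zi]; rfl
lemma ps_xy : pa (Equiv.swap 1 2) xy = yx := by
  rw [xy, yx, map_mul, pa_zz, pa_zi]; rfl
lemma ps_yx : pa (Equiv.swap 1 2) yx = xy := by
  rw [yx, xy, map_mul, pa_zz, pa_zi]; rfl
lemma pa_K : pa (Equiv.swap 1 2) Kk = Kk := by
  simp only [Kk, map_mul, map_pow, pa_iv _ (cc1 _), map_add, map_sub, map_one, pa_tt, ps_xx, ps_yy, ps_xi, ps_yi, ps_xy, ps_yx]
  generalize iv (1 - tt * xx) = q1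
  generalize iv (1 - tt * yy) = q1'
  generalize iv (1 - tt * xi) = q2
  generalize iv (1 - tt * yi) = q2'
  generalize iv (1 - tt * (tt * xx)) = q3
  generalize iv (1 - tt * (tt * yy)) = q3'
  generalize iv (1 - tt * yx) = q4
  generalize iv (1 - tt * xy) = q5
  ring

lemma CT_K : (1 + PowerSeries.X) * CT (Kk * ((1 - yx) * (1 - xy))) = 2 * CT Gg := by
  have h := CT_pa (Equiv.swap 1 2) (Kk * ((1 - yx) * (1 - tt * xy)))
  rw [map_mul (pa _), pa_K, Gg_eq] at h
  simp only [map_mul (pa _), map_sub (pa _), map_one, pa_tt, ps_xx, ps_yy, ps_xi, ps_yi, ps_xy, ps_yx] at h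
  have hxy : yx * xy = 1 := zq 1 2
  have key : io (1 + PowerSeries.X) * (Kk * ((1 - yx) * (1 - xy))) = Gg + Kk * ((1 - xy) * (1 - tt * yx)) := by
    rw [← Gg_eq, map_add, map_one, io_X]
    change (1 + tt) * _ = _
    linear_combination (Kk - Kk * tt) * hxy
  rw [← CT_io, key, map_add, h]
  ring

theorem PS_eq4 (K : Type*) [Field K] [CharZero K] :
    PowerSeries.X * (1 - PowerSeries.X) ^ 5 * (1 - PowerSeries.X ^ 2) ^ 3 * (1 - PowerSeries.X ^ 4) * mixedPS1 K 4 = CT Gg := by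
  have h1 := PS_eq3 K
  have h2 := CT_t_int
  rw [elim3] at h2
  have h3 : CT (tt * (Qs * (Fs tt * D3))) = PowerSeries.X * CT (Qs * (Fs tt * D3)) := by
    rw [← CT_io, io_X]; rfl
  have h4 : ((1 - PowerSeries.X) ^ 7 * (1 - PowerSeries.X * PowerSeries.X) ^ 2) * CT (E3 * (zz 0 * (zz 2 - zz 1)) * hfn (tt * zz 0)) =
     CT (Kk * ((1 - yx) * (1 - xy))) := by
    rw [← K_eq, ← CT_io]
    simp only [map_mul io, map_pow io, map_sub io, map_one, io_X]
    rfl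
  have h5 := CT_K
  have h6 : (6 : PowerSeries ℚ) ≠ 0 := by
    intro h
    have := congrArg PowerSeries.constantCoeff h
    rw [map_ofNat, map_zero] at this
    norm_num at this
  apply mul_left_cancel₀ h6
  rw [h3, ← h1] at h2
  generalize CT (E3 * (zz 0 * (zz 2 - zz 1)) * hfn (tt * zz 0)) = A at *
  rw [← h4] at h5
  linear_combination ((1 - PowerSeries.X) ^ 7 * (1 - PowerSeries.X * PowerSeries.X) ^ 2) * (1 + PowerSeries.X) * h2 + 3 * h5


section cert
variable {R : Type*} [CommRing R]

def ev1 (t : R) : List ℤ → R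
  | [] => 0
  | c :: l => (c : R) + t * ev1 t l
def ev2 (t x : R) : List (List ℤ) → R
  | [] => 0
  | c :: l => ev1 t c + x * ev2 t x l
def ev3 (t x y : R) : List (List (List ℤ)) → R
  | [] => 0
  | c :: l => ev2 t x c + y * ev3 t x y l

def pA : List (List ℤ) :=
  [[0, 0, 0, -1, -1, -1], [0, 0, 0, -1, -3, -2, -1], [0, 1, 2, 3, 1], [0, 0, 1, 1, 1]]
def pB : List (List ℤ) :=
  [[0, 0, 0, 0, 1, 1, 1], [0, 0, -3, -5, -4, 3, 6, 4, 2, 1], [0, 0, -2, -8, -8, -1, 4, 2, -1], [1, 3, 6, 4, 0,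
  -1, -1, -3, -3, -2], [0, 1, 2, 2, 0, -1, -1]]
def pC : List (List ℤ) :=
  [[0, 0, 0, 0, -1, -1, 0, 2, 2, 1], [0, -2, -3, -4, -4, -5, -2, 7, 11, 8, 3, 0, -3, -4, -3, -1], [0, -1, -2,
  3, 10, 6, -4, -10, -7, -7, -3, 4, 5, -2, -6, -4, -1], [0, 0, 0, 7, 21, 26, 7, -15, -28, -28, -15, 7, 26, 21,
  7], [0, -1, -4, -6, -2, 5, 4, -3, -7, -7, -10, -4, 6, 10, 3, -2, -1], [0, 0, -1, -3, -4, -3, 0, 3, 8, 11, 7,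
  -2, -5, -4, -4, -3, -2], [0, 0, 0, 0, 0, 0, 0, 0, 1, 2, 2, 0, -1, -1]]
def pQ1 : List (List (List ℤ)) :=
  [[[], [], [0, 0, -1, -1, -1], [0, 0, -1, -3, -2, -1], [1, 2, 3, 1], [0, 1, 1, 1]], [[], [0, 0, 0, 2, 2, 2],
  [0, -1, -1, 1, 7, 6, 6, 4, 2, -1, -2, -1], [0, -1, -3, -5, -3, -1, 1, 6, 6, 2, -1, -1], [0, 1, -1, -3, -7,
  -7, -6, -1, 2, 2], [0, 0, 0, -1, -1, -2, -1, -1]], [[0, 0, 0, 0, -1, -1, -1], [0, 0, 2, 2, -1, -9, -8, -5],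
  [-1, -1, 2, 9, 5, -8, -16, -7, 0, 0, -3, -3, -1], [-1, -3, 1, 12, 16, 5, -10, -5, 4, 6, 1, -1, -1], [-1, -4,
  -4, 3, 12, 10, 2, -4, 1, 2, 2], [0, -1, -2, -1, 2, 4, 2, 0, -1]], [[0, 0, 0, 0, 1, 1, 1, -1, 0, 1, 2, 1], [0,
  0, -2, -2, -1, 5, 7, 4, -1, 1, 4, 4, 1], [1, 1, -1, -7, -8, -2, 7, 8, -1, -3, 1, 3, 1], [1, 3, 3, 0, -5, -6,
  -3, -3, -4, -7, -1, 1, 1], [0, 0, 0, 0, 0, 0, 0, 0, -2, -2, -2]], [[0, 0, 0, 0, 0, 1, 1, 0, -2, -2, -1], [0,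
  0, 0, -2, -2, 1, 6, 5, -2, -6, -5, -2], [0, 1, 1, -2, -6, -4, 4, 9, 6, 0, -1, -1], [0, 1, 2, 1, -2, -4, -2,
  1, 2, 2, 1, 1]]]
def pQ2 : List (List (List ℤ)) :=
  [[[], [], [0, 0, 0, 0, -1, -1, 0, 2, 2, 1], [0, -2, -3, -3, -1, -1, 0, 4, 6, 3, 1], [0, 0, -1, 2, 4, -1, -8,
  -8, -2], [0, 1, 2, 4, 6, 3, -4, -5, -3], [0, 0, 0, 0, 1, 1, 1]], [[], [0, 0, 0, 0, 0, 2, 2, 0, -4, -4, -2],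
  [0, 0, 3, 3, 2, 0, 6, 8, 1, -9, -11, -13, -9, -2, 3, 3, 1], [-1, -1, 3, 13, 6, -12, -18, 1, 21, 25, 15, -4,
  -17, -12, -2, 2, 1], [-1, -3, 1, 15, 19, -8, -37, -31, -2, 27, 31, 18, 0, -6, -3], [-1, -5, -8, -3, 8, 6, -6,
  -15, -8, 1, 8, 6, 3], [0, -1, -3, -3, 0, 4, 3, 0, -3, -2, -1]], [[0, 0, 0, 0, 0, 0, -1, -1, 0, 2, 2, 1], [0,
  0, 0, 0, 3, 3, -3, -15, -12, 4, 18, 13, 5], [0, 0, -3, -6, -6, 7, 9, -8, -26, -8, 16, 15, -1, -1, 5, 7, 4,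
  1], [1, 2, 0, -10, -20, -12, 13, 12, -10, -10, 12, 13, -12, -20, -10, 0, 2, 1], [1, 4, 7, 5, -1, -1, 15, 16,
  -8, -26, -8, 9, 7, -6, -6, -3], [0, 0, 0, 0, 0, 5, 13, 18, 4, -12, -15, -3, 3, 3], [0, 0, 0, 0, 0, 0, 1, 2,
  2, 0, -1, -1]], [[0, 0, 0, 0, 0, 0, 0, -1, -2, -3, 0, 3, 4, 0, -3, -3, -1], [0, 0, 0, 0, 0, 3, 6, 8, 1, -8,
  -15, -6, 6, 8, -3, -8, -5, -1], [0, 0, 0, -3, -6, 0, 18, 31, 27, -2, -31, -37, -8, 19, 15, 1, -3, -1], [0, 1,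
  2, -2, -12, -17, -4, 15, 25, 21, 1, -18, -12, 6, 13, 3, -1, -1], [0, 1, 3, 3, -2, -9, -13, -11, -9, 1, 8, 6,
  0, 2, 3, 3], [0, 0, 0, 0, 0, 0, 0, -2, -4, -4, 0, 2, 2]], [[0, 0, 0, 0, 0, 0, 0, 0, 0, 0, 0, 1, 1, 1], [0, 0,
  0, 0, 0, 0, 0, 0, 0, -3, -5, -4, 3, 6, 4, 2, 1], [0, 0, 0, 0, 0, 0, 0, 0, 0, -2, -8, -8, -1, 4, 2, -1], [0,
  0, 0, 0, 0, 0, 0, 1, 3, 6, 4, 0, -1, -1, -3, -3, -2], [0, 0, 0, 0, 0, 0, 0, 0, 1, 2, 2, 0, -1, -1]]]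
def pQ3 : List (List (List ℤ)) :=
  [[[], [], [0, 0, -1, -3, -4, -3, 0, 3, 7, 8, 5, -1, -4, -3, -1], [-1, -1, -1, -1, -2, -3, -5, -7, -1, 14, 20,
  8, -6, -10, -5, -1], [-1, -2, 3, 14, 23, 23, 5, -26, -47, -30, 4, 17, 4, -5, -3, 1, 1], [-1, -4, -5, 1, 12,
  17, 14, -8, -32, -28, 4, 29, 21, 5, 2, 5, 3, 1], [0, -1, -3, -4, -3, -1, 1, 1, -3, -6, 5, 13, 6, -9, -11,
  -4], [0, 0, 0, 0, 0, 0, 0, 1, 1, 1, 1, 4, 2, -4, -5, -3], [0, 0, 0, 0, 0, 0, 0, 0, 0, 0, 0, 1, 1, 1]], [[],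
  [0, 0, 0, 2, 6, 7, 3, -4, -7, -9, -8, -5, 1, 4, 3, 1], [0, 0, -3, -1, 10, 22, 16, 1, -2, 2, -14, -34, -32,
  -12, 8, 15, 13, 7, 2], [1, 2, 0, -8, -8, -4, -23, -48, -16, 71, 101, 35, -46, -56, -18, 24, 34, 18, -2, -9,
  -5, -1], [1, 4, 7, 4, -1, -6, -35, -99, -87, 51, 188, 152, -10, -120, -103, -28, 26, 30, 3, -11, -6, 2, 3,
  1], [0, 0, 0, -1, 0, 12, 10, -37, -88, -33, 103, 149, 48, -80, -101, -44, 16, 29, 8, -14, -12, -2, 2, 1], [0,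
  0, 0, 0, 3, 16, 32, 22, -25, -52, -16, 40, 28, -20, -39, -11, 23, 32, 18, 0, -6, -3], [0, 0, 0, 0, 0, 2, 7,
  8, -3, -20, -18, 2, 14, 4, -9, -7, 1, 8, 6, 3], [0, 0, 0, 0, 0, 0, 0, 0, -1, -3, -3, 0, 4, 3, 0, -3, -2,
  -1]], [[0, 0, 0, 0, 0, 0, 0, -2, -5, -5, 2, 9, 9, 2, -3, -3, -1], [0, 0, 0, 0, -2, -4, -4, -4, -16, -25, -8,
  37, 56, 29, -10, -23, -13, -3], [0, 0, 0, -3, -7, -12, 1, 26, 25, -32, -76, -23, 67, 79, 11, -33, -29, -10,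
  -4, -3, -1], [0, 1, 2, -2, -12, -18, 3, 69, 126, 55, -111, -188, -77, 47, 62, 20, 13, 11, -8, -19, -13, -3],
  [0, 1, 3, 2, -7, -17, -12, 42, 128, 142, -12, -183, -183, -47, 41, 44, 57, 65, 37, -3, -7, 3, 7, 4, 1], [0,
  0, 0, -1, -5, -14, -25, -24, 10, 55, 37, -39, -68, -6, 31, 11, -7, 18, 19, -7, -20, -10, 0, 2, 1], [0, 0, 0,
  0, 0, 0, -3, -11, -15, -7, 7, 5, 7, 25, 33, -3, -33, -21, 2, 5, -6, -6, -3], [0, 0, 0, 0, 0, 0, 0, -1, -3,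
  -3, 0, 4, 8, 13, 15, 2, -13, -15, -3, 3, 3], [0, 0, 0, 0, 0, 0, 0, 0, 0, 0, 0, 0, 0, 1, 2, 2, 0, -1, -1]],
  [[0, 0, 0, 0, 0, 0, 0, 0, 0, 2, 3, 2, -3, -5, -4, -1], [0, 0, 0, 0, 0, 0, 4, 8, 11, 9, 11, 7, -10, -29, -30,
  -15, -2, 7, 11, 10, 5, 1], [0, 0, 0, 0, 0, 0, 2, 9, 2, -19, -25, 3, 34, 23, 4, -9, -14, -13, 6, 21, 17, 4,
  -2, -1], [0, 0, 0, 0, 0, 0, 0, 3, -7, -50, -91, -47, 52, 120, 102, 44, -25, -75, -64, -14, 17, 9, -3, -4,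
  -1], [0, 0, 0, 0, 0, 0, 2, 9, 17, -3, -53, -70, -8, 64, 81, 53, 1, -48, -73, -35, 10, 18, 4, -2, -1], [0, 0,
  0, 0, 0, 0, 0, 4, 15, 22, 9, -17, -20, -5, 4, 3, 16, 13, -4, -11, 2, 10, 3, -1, -1], [0, 0, 0, 0, 0, 0, 0, 0,
  2, 6, 7, 3, -4, -9, -16, -20, -9, 9, 13, 6, 4, 3, 3], [0, 0, 0, 0, 0, 0, 0, 0, 0, 0, 0, 0, 0, 0, -2, -4, -4,
  0, 2, 2]], [[0, 0, 0, 0, 0, 0, 0, 0, 0, 0, 0, -1, -1, 0, 2, 2, 1], [0, 0, 0, 0, 0, 0, 0, 0, -2, -3, -4, -4,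
  -5, -2, 7, 11, 8, 3, 0, -3, -4, -3, -1], [0, 0, 0, 0, 0, 0, 0, 0, -1, -2, 3, 10, 6, -4, -10, -7, -7, -3, 4,
  5, -2, -6, -4, -1], [0, 0, 0, 0, 0, 0, 0, 0, 0, 0, 7, 21, 26, 7, -15, -28, -28, -15, 7, 26, 21, 7], [0, 0, 0,
  0, 0, 0, 0, 0, -1, -4, -6, -2, 5, 4, -3, -7, -7, -10, -4, 6, 10, 3, -2, -1], [0, 0, 0, 0, 0, 0, 0, 0, 0, -1,
  -3, -4, -3, 0, 3, 8, 11, 7, -2, -5, -4, -4, -3, -2], [0, 0, 0, 0, 0, 0, 0, 0, 0, 0, 0, 0, 0, 0, 0, 1, 2, 2,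
  0, -1, -1]]]

def pNn (t x y : R) : R := y * (x * y + y + x + t * x * y) * (1 + t + t * x + t * y) * (1 - y) * (x - y)
def pOut (t x y : R) : R := (1 - t ^ 2 * y) ^ 2 * (1 - t * y) * (x - t * y) ^ 2
def pc1 (t x : R) : R := (1 - t) ^ 2 * (1 + t) * (1 + t + t ^ 2) ^ 2 * (x - t ^ 2) ^ 2
def pc2 (t x : R) : R := (1 - t) * (1 + t) * (1 + t + t ^ 2) * (x - t ^ 2)
def pc3 (t x : R) : R := (1 - t ^ 3 * x) ^ 2 * (1 - t ^ 2 * x)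

set_option maxHeartbeats 1000000 in
lemma ce1 (t x y : R) : pc1 t x * pNn t x y = ev2 t x pA * pOut t x y + (y - t) * ev3 t x y pQ1 := by
  simp only [pc1, pNn, pA, pOut, pQ1, ev1, ev2, ev3, Int.cast_zero, Int.cast_one, Int.cast_neg, Int.cast_ofNat, zero_add, add_zero, mul_zero]
  ring
set_option maxHeartbeats 1000000 in
lemma ce2 (t x y : R) : pc2 t x * ev3 t x y pQ1 = ev2 t x pB * pOut t x y + (y - t) * ev3 t x y pQ2 := by
  simp only [pc2, pB, pOut, pQ1, pQ2, ev1, ev2, ev3, Int.cast_zero, Int.cast_one, Int.cast_neg, Int.cast_ofNat, zero_add, add_zero, mul_zero]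
  ring
set_option maxHeartbeats 2000000 in
lemma ce3 (t x y : R) : pc3 t x * ev3 t x y pQ2 = ev2 t x pC * pOut t x y + (y - t * x) * ev3 t x y pQ3 := by
  simp only [pc3, pC, pOut, pQ2, pQ3, ev1, ev2, ev3, Int.cast_zero, Int.cast_one, Int.cast_neg, Int.cast_ofNat, zero_add, add_zero, mul_zero]
  ring

def rA1 : List ℤ :=
  [0, 0, 0, -2, -2, -5, -2, -2]
def rQ1 : List (List ℤ) :=
  [[0, 0, -2, -2, -5, -2, -2], [0, -2, -2, -2, 7, 13, 18, 15, 9, 6, 2, 1], [0, 1, 2, 8, 14, 10, -9, -41, -48,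
  -44, -17, -4, 5, 3, -2, -4, -3, -1], [0, 1, 1, 1, 0, 0, -10, -13, -11, 15, 35, 43, 38, 25, 13, 0, -4, -3,
  -1], [0, -1, -3, -10, -18, -17, 3, 30, 47, 40, 5, -31, -58, -42, -20, 2, 4, 3, 1], [0, 1, 3, 4, 0, -7, -5, 5,
  16, 12, 1, -17, -22, -17, 2, 15, 14, 7, 1], [0, 0, 1, 3, 4, 2, -3, -7, -10, -10, -4, 7, 14, 11, 5, -1, -2,
  -5, -3, -2], [0, 0, 0, 0, 0, 0, 0, 0, -1, -2, -2, 1, 3, 3, 0, -1, -1]]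
def rA2 : List ℤ :=
  [0, 0, -4, -3, -8, -2, 3, 4, 7, 3, 2]
def rQ2 : List (List ℤ) :=
  [[0, -2, -1, -3, 0, 3, 2, 2, 1], [0, 1, 3, 8, 13, 14, 4, -10, -18, -16, -11, -3, 2, 2, 1], [0, 1, 0, -1, -7,
  -14, -24, -24, -14, 4, 17, 20, 22, 21, 15, 10, 4, -2, -4, -3, -1], [0, -1, -2, -7, -13, -13, 2, 34, 62, 67,
  34, -22, -53, -58, -35, -10, 3, 4, -3, -5, -3, -1], [0, 1, 3, 5, 3, -4, -6, -3, 6, 5, -7, -25, -34, -22, -3,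
  15, 26, 24, 16, 7, 2, 1], [0, 0, 1, 3, 4, 2, -4, -10, -14, -13, -3, 12, 25, 25, 14, -2, -15, -12, -9, -4, -1,
  -1], [0, 0, 0, 0, 0, 0, 0, 0, -1, -2, -2, 1, 4, 5, 2, -2, -4, -3, 0, 1, 1]]
def rA3 : List ℤ :=
  [0, -2, 1, -1, 3, 4, 1, 1, -1]
def rQ3 : List (List ℤ) :=
  [[0, 1, 0, 1, 2, 1, 0, 1], [0, 1, -1, -2, -1, -4, -4, -6, -4, -6, -5, 0, 1, 1], [0, -1, -1, -4, -4, 2, 8, 16,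
  17, 9, 1, -3, 5, 5, 6, 6, 2, -1, -2, -1], [0, 1, 2, 2, -1, -5, -1, 1, 5, 4, -11, -13, -20, -15, -8, -2, 5, 1,
  -2, -2, -1], [0, 0, 1, 2, 1, -2, -6, -6, -4, 1, 9, 10, 9, 2, -4, 1, 3, 7, 4, 1, 1], [0, 0, 0, 0, 0, 0, 0, 0,
  -1, -1, 0, 3, 3, 1, -1, -5, -1, -2, -1, 0, -1]]
def rA4 : List ℤ :=
  [0, 1, -1, 2, 0, -1, 1]
def rQ4 : List (List ℤ) :=
  [[0, 1, -1, 0, 2, -1, 1], [0, -1, 0, -2, -2, 4, -3, 0, -1, -5, -1, 0, 1], [0, 1, 1, 0, -2, -3, 6, 3, 6, 9,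
  -6, 0, -1, 0, 4, 3, 1, -1, -1], [0, 0, 1, 1, -1, -3, -4, 0, 1, 0, 6, -9, -6, -3, -6, 3, 2, 0, -1, -1], [0, 0,
  0, 0, 0, 0, 0, 0, -1, 0, 1, 5, 1, 0, 3, -4, 2, 2, 0, 1], [0, 0, 0, 0, 0, 0, 0, 0, 0, 0, 0, 0, 0, 0, -1, 1,
  -2, 0, 1, -1]]
def rA5 : List ℤ :=
  [0, 1, -1, 0, 1, 0, 1, 0, -1, 1]
def rQ5 : List (List ℤ) :=
  [[0, -1, 1, 0, -1, 2, -3, 4, -1, 1], [0, 1, 1, 1, -4, -5, 2, 0, 8, 0, -7, -2, -6, 0, 0, 1], [0, 0, 1, 1, 0,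
  -3, -3, 1, -1, 4, 12, -1, 11, -8, -5, 1, 3, 6, 3, 0, -1, -1], [0, 0, 0, 0, 0, 0, 0, 0, -2, -5, 1, 7, -1, 1,
  -9, -12, 2, -3, 3, 1, -1, -1, -1], [0, 0, 0, 0, 0, 0, 0, 0, 0, 0, 0, 2, 1, -2, 0, 4, -1, 6, -3, 0, 2, 0, 1],
  [0, 0, 0, 0, 0, 0, 0, 0, 0, 0, 0, 0, 0, 0, -1, 1, 0, -1, 0, -1, 0, 1, -1]]

def rN (t x : R) : R := x * ev2 t x pC * (1 - x)
def rO (t x : R) : R := (1 - t ^ 2 * x) ^ 3 * (1 - t ^ 3 * x) ^ 2 * (1 - t * x)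
set_option maxHeartbeats 1000000 in
lemma re1 (t x : R) : (1 - t) * (1 + t + t ^ 2) * rN t x = ev1 t rA1 * rO t x + (x - t) * ev2 t x rQ1 := by
  simp only [rN, pC, rO, rA1, rQ1, ev1, ev2, ev3, Int.cast_zero, Int.cast_one, Int.cast_neg, Int.cast_ofNat, zero_add, add_zero, mul_zero]
  ring
set_option maxHeartbeats 1000000 in
lemma re2 (t x : R) : (1 - t) * (1 + t) * (1 + t ^ 2) * ev2 t x rQ1 = ev1 t rA2 * rO t x + (x - t) * ev2 t x rQ2 := by
  simp only [rQ1, rO, rA2, rQ2, ev1, ev2, ev3, Int.cast_zero, Int.cast_one, Int.cast_neg, Int.cast_ofNat, zero_add, add_zero, mul_zero]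
  ring
set_option maxHeartbeats 1000000 in
lemma re3 (t x : R) : (1 - t) * ev2 t x rQ2 = ev1 t rA3 * rO t x + (x - t ^ 2) * ev2 t x rQ3 := by
  simp only [rQ2, rO, rA3, rQ3, ev1, ev2, ev3, Int.cast_zero, Int.cast_one, Int.cast_neg, Int.cast_ofNat, zero_add, add_zero, mul_zero]
  ring
set_option maxHeartbeats 1000000 in
lemma re4 (t x : R) : (1 - t) * ev2 t x rQ3 = ev1 t rA4 * rO t x + (x - t ^ 2) * ev2 t x rQ4 := by
  simp only [rQ3, rO, rA4, rQ4, ev1, ev2, ev3, Int.cast_zero, Int.cast_one, Int.cast_neg, Int.cast_ofNat, zero_add, add_zero, mul_zero]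
  ring
set_option maxHeartbeats 1000000 in
lemma re5 (t x : R) : (1 - t) * (1 + t + t ^ 2) * (1 + t ^ 2) * ev2 t x rQ4 = ev1 t rA5 * rO t x + (x - t ^ 2) * ev2 t x rQ5 := by
  simp only [rQ4, rO, rA5, rQ5, ev1, ev2, ev3, Int.cast_zero, Int.cast_one, Int.cast_neg, Int.cast_ofNat, zero_add, add_zero, mul_zero]
  ring
lemma rA5_e (t : R) : ev1 t rA5 = t * (1 - t + t ^ 3 + t ^ 5 - t ^ 7 + t ^ 8) := by
  simp only [rA5, ev1, ev2, ev3, Int.cast_zero, Int.cast_one, Int.cast_neg, Int.cast_ofNat, zero_add, add_zero, mul_zero]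
  ring

end cert


lemma yalg {R : Type*} [CommRing R] (t x y yi a b o : R) (h1 : y * yi = 1) (h2 : (y - t) * yi * a = 1)
    (h3 : (y - t * x) * yi * b = 1) (h4 : pOut t x y * o = 1) :
    pc1 t x * pc2 t x * pc3 t x * (pNn t x y * yi ^ 2 * a ^ 2 * b * o) =
      yi * (pc2 t x * pc3 t x * ev2 t x pA * yi * a ^ 2 * b) + yi * (pc3 t x * ev2 t x pB * a * b) +
      (ev2 t x pC + yi * (ev2 t x pC * t * x * b)) + y * (o * ev3 t x y pQ3) := by
  have e1 := ce1 t x y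
  have e2 := ce2 t x y
  have e3 := ce3 t x y
  generalize ev2 t x pA = A at *
  generalize ev2 t x pB = B at *
  generalize ev2 t x pC = C at *
  generalize ev3 t x y pQ1 = Q1 at *
  generalize ev3 t x y pQ2 = Q2 at *
  generalize ev3 t x y pQ3 = Q3 at *
  generalize pc1 t x = c1 at *
  generalize pc2 t x = c2 at *
  generalize pc3 t x = c3 at *
  generalize pOut t x y = Out at *
  generalize pNn t x y = N at *
  linear_combination (c2*c3*yi^2*a^2*b*o)*e1 + (c3*(y-t)*yi^2*a^2*b*o)*e2 + ((y-t)^2*yi^2*a^2*b*o)*e3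
    + (c2*c3*A*yi^2*a^2*b + c3*B*(y-t)*yi^2*a^2*b + C*(y-t)^2*yi^2*a^2*b) * h4
    + c3*B*yi*a*b*h2 + C*b*((y-t)*yi*a+1)*h2 + Q3*o*(y-t*x)*b*((y-t)*yi*a+1)*h2
    - ((y-t*x)*b*o*Q3)*h1 + y*o*Q3*h3 + C*h3 - C*b*h1

lemma xalg {R : Type*} [CommRing R] (t x xi a s o : R) (h1 : x * xi = 1) (h2 : (x - t) * xi * a = 1)
    (h3 : (x - t ^ 2) * xi * s = 1) (h4 : rO t x * o = 1) :
    ((1 - t) * (1 + t + t ^ 2)) * ((1 - t) * (1 + t) * (1 + t ^ 2)) * (1 - t) * (1 - t) * ((1 - t) * (1 + t + t ^ 2) * (1 + t ^ 2)) *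
      (rN t x * xi ^ 4 * a ^ 2 * s ^ 3 * o) =
      xi * (((1 - t) * (1 + t) * (1 + t ^ 2)) * (1 - t) * (1 - t) * ((1 - t) * (1 + t + t ^ 2) * (1 + t ^ 2)) * ev1 t rA1 * xi ^ 3 * a ^ 2 * s ^ 3)
      + xi * ((1 - t) * (1 - t) * ((1 - t) * (1 + t + t ^ 2) * (1 + t ^ 2)) * ev1 t rA2 * xi ^ 2 * a * s ^ 3)
      + xi * ((1 - t) * ((1 - t) * (1 + t + t ^ 2) * (1 + t ^ 2)) * ev1 t rA3 * xi * s ^ 3)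
      + xi * (((1 - t) * (1 + t + t ^ 2) * (1 + t ^ 2)) * ev1 t rA4 * s ^ 2)
      + (ev1 t rA5 + xi * (ev1 t rA5 * t ^ 2 * s)) + x * (o * ev2 t x rQ5) := by
  have e1 := re1 t x
  have e2 := re2 t x
  have e3 := re3 t x
  have e4 := re4 t x
  have e5 := re5 t x
  generalize ev1 t rA1 = A1 at *
  generalize ev1 t rA2 = A2 at *
  generalize ev1 t rA3 = A3 at *
  generalize ev1 t rA4 = A4 at *
  generalize ev1 t rA5 = A5 at *
  generalize ev2 t x rQ1 = Q1 at *
  generalize ev2 t x rQ2 = Q2 at *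
  generalize ev2 t x rQ3 = Q3 at *
  generalize ev2 t x rQ4 = Q4 at *
  generalize ev2 t x rQ5 = Q5 at *
  generalize rN t x = N at *
  generalize rO t x = O at *
  generalize (1 - t) * (1 + t + t ^ 2) * (1 + t ^ 2) = c5 at *
  generalize (1 - t) * (1 + t + t ^ 2) = c1 at *
  generalize (1 - t) * (1 + t) * (1 + t ^ 2) = c2 at *
  generalize 1 - t = c at *
  have hs : s = 1 + xi * (t ^ 2 * s) := by linear_combination h3 - s * h1
  have s1 : c1 * (N * xi ^ 4 * a ^ 2 * s ^ 3 * o) = A1 * xi ^ 4 * a ^ 2 * s ^ 3 + Q1 * xi ^ 3 * a * s ^ 3 * o := by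
    linear_combination xi ^ 4 * a ^ 2 * s ^ 3 * o * e1 + A1 * xi ^ 4 * a ^ 2 * s ^ 3 * h4 + Q1 * xi ^ 3 * a * s ^ 3 * o * h2
  have s2 : c2 * (Q1 * xi ^ 3 * a * s ^ 3 * o) = A2 * xi ^ 3 * a * s ^ 3 + Q2 * xi ^ 2 * s ^ 3 * o := by
    linear_combination xi ^ 3 * a * s ^ 3 * o * e2 + A2 * xi ^ 3 * a * s ^ 3 * h4 + Q2 * xi ^ 2 * s ^ 3 * o * h2
  have s3 : c * (Q2 * xi ^ 2 * s ^ 3 * o) = A3 * xi ^ 2 * s ^ 3 + Q3 * xi * s ^ 2 * o := by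
    linear_combination xi ^ 2 * s ^ 3 * o * e3 + A3 * xi ^ 2 * s ^ 3 * h4 + Q3 * xi * s ^ 2 * o * h3
  have s4 : c * (Q3 * xi * s ^ 2 * o) = A4 * xi * s ^ 2 + Q4 * s * o := by
    linear_combination xi * s ^ 2 * o * e4 + A4 * xi * s ^ 2 * h4 + Q4 * s * o * h3
  have s5 : c5 * (Q4 * s * o) = A5 * s + x * (o * Q5) := by
    linear_combination s * o * e5 + A5 * s * h4 - (x - t ^ 2) * Q5 * s * o * h1 + Q5 * o * x * h3
  linear_combination c2 * c * c * c5 * s1 + c * c * c5 * s2 + c * c5 * s3 + c5 * s4 + s5 + A5 * hs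

lemma Ge_int (w : Ex →+ ℤ) (c : ℤ) : Ge w 0 (c : LS) := by
  have := Ge_io w (c : PowerSeries ℚ)
  rwa [map_intCast] at this
lemma Ge_ev1 (w : Ex →+ ℤ) (l : List ℤ) : Ge w 0 (ev1 tt l) := by
  induction l with
  | nil => exact Ge.zero _ _
  | cons c l ih => exact (Ge_int w c).add ((Ge_tt w).mul0 ih)
lemma Ge_ev2 {w : Ex →+ ℤ} {x : LS} (hx : Ge w 0 x) (l : List (List ℤ)) : Ge w 0 (ev2 tt x l) := by
  induction l with
  | nil => exact Ge.zero _ _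
  | cons c l ih => exact (Ge_ev1 w c).add (hx.mul0 ih)
lemma Ge_ev3 {w : Ex →+ ℤ} {x y : LS} (hx : Ge w 0 x) (hy : Ge w 0 y) (l : List (List (List ℤ))) : Ge w 0 (ev3 tt x y l) := by
  induction l with
  | nil => exact Ge.zero _ _
  | cons c l ih => exact (Ge_ev2 hx c).add (hy.mul0 ih)

lemma Ge_i1 {w : Ex →+ ℤ} {f : LS} (h : Ge w 0 f) : Ge w 0 (iv (1 - tt * f)) :=
  ((Ge_one w).sub ((Ge_tt w).mul0 h)).iv (cc1 f)

lemma CT_yi {f : LS} (h : Ge (wv 2) 0 f) : CT (yi * f) = 0 :=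
  CT_Ge (((Ge_zz1 2).mul0 (Ge_zi0 (by decide))).mul0 h)
lemma CT_yy {f : LS} (h : Ge (-wv 2) 0 f) : CT (yy * f) = 0 := by
  have : Ge (-wv 2) 1 yy := by
    rw [yy, mul_comm]
    exact (Ge_zi1n 2).mul0 (Ge_zz0n (by decide))
  exact CT_Ge (this.mul0 h)
lemma CT_xi {f : LS} (h : Ge (wv 1) 0 f) : CT (xi * f) = 0 :=
  CT_Ge (((Ge_zz1 1).mul0 (Ge_zi0 (by decide))).mul0 h)
lemma CT_xx {f : LS} (h : Ge (-wv 1) 0 f) : CT (xx * f) = 0 := by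
  have : Ge (-wv 1) 1 xx := by
    rw [xx, mul_comm]
    exact (Ge_zi1n 1).mul0 (Ge_zz0n (by decide))
  exact CT_Ge (this.mul0 h)


def rX : LS := iv (1 - tt * xx) * iv (1 - tt * xi) ^ 2 * iv (1 - tt * (tt * xx)) ^ 2
def rC : LS := xi ^ 3 * iv (1 - tt * (tt * xi)) ^ 3 * iv (1 - tt * (tt * (tt * xx))) ^ 2 * iv (1 - tt * (tt * xx))
def oY : LS := iv (1 - tt * (tt * yy)) ^ 2 * iv (1 - tt * yy) * iv (1 - tt * yx) ^ 2 * xi ^ 2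
def oX : LS := iv (1 - tt * (tt * xx)) ^ 3 * iv (1 - tt * (tt * (tt * xx))) ^ 2 * iv (1 - tt * xx)
def Jx : LS := rN tt xx * xi ^ 4 * iv (1 - tt * xi) ^ 2 * iv (1 - tt * (tt * xi)) ^ 3 * oX
def tfp {R : Type*} [CommRing R] (t : R) : R := (1 - t) ^ 3 * (1 + t) ^ 2 * (1 + t + t ^ 2) ^ 3
def cxp {R : Type*} [CommRing R] (t : R) : R := ((1 - t) * (1 + t + t ^ 2)) * ((1 - t) * (1 + t) * (1 + t ^ 2)) * (1 - t) * (1 - t) * ((1 - t) * (1 + t + t ^ 2) * (1 + t ^ 2))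

lemma Gg_f : Gg = (1 - xx) * rX * (pNn tt xx yy * yi ^ 2 * iv (1 - tt * yi) ^ 2 * iv (1 - tt * xy) * oY) := by
  rw [Gg, rX, oY, pNn]
  have h1 := xx_xi
  have h2 := yy_yi
  have e1 : 1 + tt + xi + yi = (xx * yy + yy + xx + tt * xx * yy) * (xi * yi) := by
    linear_combination (-(1 + tt) * yy * yi - yi) * h1 + (-(1 + tt) - xi) * h2
  have e2 : 1 - yx = (xx - yy) * xi := by rw [yx_e]; linear_combination - h1
  rw [e1, e2]
  generalize iv (1 - tt * xx) = q1
  generalize iv (1 - tt * yy) = q2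
  generalize iv (1 - tt * xi) = q3
  generalize iv (1 - tt * yi) = q4
  generalize iv (1 - tt * (tt * xx)) = q5
  generalize iv (1 - tt * (tt * yy)) = q6
  generalize iv (1 - tt * yx) = q7
  generalize iv (1 - tt * xy) = q8
  generalize xx * yy + yy + xx + tt * xx * yy = P1
  linear_combination (-(P1 * xi ^ 2 * yi * (1 + tt + tt * xx + tt * yy) * (1 - xx) * (1 - yy) * (xx - yy) * q1 * q2 * q3 ^ 2 * q4 ^ 2 * q5 ^ 2 * q6 ^ 2 * q7 ^ 2 * q8)) * h2

lemma oY_h : pOut tt xx yy * oY = 1 := by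
  rw [pOut, oY]
  have h1 := mul_iv (cc1 (tt * yy))
  have h2 := mul_iv (cc1 yy)
  have h3 := mul_iv (cc1 yx)
  have hx := xx_xi
  generalize iv (1 - tt * yx) = q7 at *
  rw [yx_e] at h3
  have h3' : (xx - tt * yy) * (xi * q7) = 1 := by linear_combination h3 + q7 * hx
  generalize iv (1 - tt * yy) = q2 at *
  generalize iv (1 - tt * (tt * yy)) = q6 at *
  have : (1 - tt ^ 2 * yy) ^ 2 * (1 - tt * yy) * (xx - tt * yy) ^ 2 * (q6 ^ 2 * q2 * q7 ^ 2 * xi ^ 2) =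
    ((1 - tt * (tt * yy)) * q6) ^ 2 * ((1 - tt * yy) * q2) * ((xx - tt * yy) * (xi * q7)) ^ 2 := by ring
  rw [this, h1, h2, h3']; ring

lemma oX_h : rO tt xx * oX = 1 := by
  rw [rO, oX]
  have h1 := mul_iv (cc1 (tt * xx))
  have h2 := mul_iv (cc1 xx)
  have h3 := mul_iv (cc1 (tt * (tt * xx)))
  generalize iv (1 - tt * xx) = q2 at *
  generalize iv (1 - tt * (tt * xx)) = q6 at *
  generalize iv (1 - tt * (tt * (tt * xx))) = q7 at *
  have : (1 - tt ^ 2 * xx) ^ 3 * (1 - tt ^ 3 * xx) ^ 2 * (1 - tt * xx) * (q6 ^ 3 * q7 ^ 2 * q2) =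
    ((1 - tt * (tt * xx)) * q6) ^ 3 * ((1 - tt * (tt * (tt * xx))) * q7) ^ 2 * ((1 - tt * xx) * q2) := by ring
  rw [this, h1, h2, h3]; ring

lemma rC_h : rC * (pc1 tt xx * pc2 tt xx * pc3 tt xx) = tfp tt := by
  rw [rC, pc1, pc2, pc3, tfp]
  have h1 := mul_iv (cc1 (tt * xi))
  have h2 := mul_iv (cc1 (tt * xx))
  have h3 := mul_iv (cc1 (tt * (tt * xx)))
  have hx := xx_xi
  generalize iv (1 - tt * (tt * xi)) = q1 at *
  generalize iv (1 - tt * (tt * xx)) = q2 at *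
  generalize iv (1 - tt * (tt * (tt * xx))) = q3 at *
  have h1' : (xx - tt ^ 2) * (xi * q1) = 1 := by linear_combination h1 + q1 * hx
  have : xi ^ 3 * q1 ^ 3 * q3 ^ 2 * q2 * ((1 - tt) ^ 2 * (1 + tt) * (1 + tt + tt ^ 2) ^ 2 * (xx - tt ^ 2) ^ 2 * ((1 - tt) * (1 + tt) * (1 + tt + tt ^ 2) * (xx - tt ^ 2)) * ((1 - tt ^ 3 * xx) ^ 2 * (1 - tt ^ 2 * xx))) =
    ((xx - tt ^ 2) * (xi * q1)) ^ 3 * ((1 - tt * (tt * xx)) * q2) * ((1 - tt * (tt * (tt * xx))) * q3) ^ 2 * ((1 - tt) ^ 3 * (1 + tt) ^ 2 * (1 + tt + tt ^ 2) ^ 3) := by ring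
  rw [this, h1', h2, h3]; ring

lemma Jx_f : (1 - xx) * rX * rC * ev2 tt xx pC = Jx := by
  rw [rX, rC, Jx, oX, rN]
  have h1 := xx_xi
  generalize iv (1 - tt * xx) = q1
  generalize iv (1 - tt * xi) = q3
  generalize iv (1 - tt * (tt * xx)) = q5
  generalize iv (1 - tt * (tt * xi)) = q6
  generalize iv (1 - tt * (tt * (tt * xx))) = q7
  generalize ev2 tt xx pC = C
  linear_combination (-(C * (1 - xx) * xi ^ 3 * q1 * q3 ^ 2 * q5 ^ 3 * q6 ^ 3 * q7 ^ 2)) * h1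

lemma Ge_F (w : Ex →+ ℤ) (hx : Ge w 0 xx) (hxi : Ge w 0 xi) : Ge w 0 ((1 - xx) * rX * rC) := by
  rw [rX, rC]
  repeat' first | with_reducible exact Ge_one _ | with_reducible exact Ge_tt _ | with_reducible exact hx | with_reducible exact hxi | with_reducible exact Ge_ev1 _ _ | with_reducible refine Ge_ev2 ?_ _ | with_reducible refine Ge_ev3 ?_ ?_ _ | with_reducible refine Ge_i1 ?_ | with_reducible apply Ge.mul0 | with_reducible apply Ge.pow | with_reducible apply Ge.sub | with_reducible apply Ge.add

lemma y_step : tfp PowerSeries.X * CT Gg = CT Jx := by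
  have hY := yalg tt xx yy yi (iv (1 - tt * yi)) (iv (1 - tt * xy)) oY yy_yi
    (by linear_combination mul_iv (cc1 yi) + iv (1 - tt * yi) * yy_yi)
    (by have := mul_iv (cc1 xy)
        generalize iv (1 - tt * xy) = q at *
        rw [xy_e] at this
        linear_combination this + q * yy_yi) oY_h
  have key : io (tfp PowerSeries.X) * Gg = (1 - xx) * rX * rC * (pc1 tt xx * pc2 tt xx * pc3 tt xx * (pNn tt xx yy * yi ^ 2 * iv (1 - tt * yi) ^ 2 * iv (1 - tt * xy) * oY)) := by
    have : io (tfp PowerSeries.X) = tfp tt := by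
      simp only [tfp, map_mul io, map_pow io, map_sub io, map_add io, map_one, io_X]; rfl
    rw [this, ← rC_h, Gg_f]; ring
  have n1 : Ge (wv 2) 0 xx := (Ge_zz0 (by decide)).mul0 (Ge_zi0 (by decide))
  have n2 : Ge (wv 2) 0 xi := (Ge_zz0 (by decide)).mul0 (Ge_zi0 (by decide))
  have n3 : Ge (wv 2) 0 yi := ((Ge_zz1 2).mono (by norm_num)).mul0 (Ge_zi0 (by decide))
  have n4 : Ge (wv 2) 0 xy := by rw [xy_e]; exact n1.mul0 n3
  have m1 : Ge (-wv 2) 0 xx := (Ge_zz0n (by decide)).mul0 (Ge_zi0n (by decide))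
  have m2 : Ge (-wv 2) 0 xi := (Ge_zz0n (by decide)).mul0 (Ge_zi0n (by decide))
  have m3 : Ge (-wv 2) 0 yy := (Ge_zz0n (by decide)).mul0 ((Ge_zi1n 2).mono (by norm_num))
  have m4 : Ge (-wv 2) 0 yx := by rw [yx_e]; exact m3.mul0 m2
  have f1 := Ge_F _ n1 n2
  have f2 := Ge_F _ m1 m2
  rw [← CT_io, key, hY, ← Jx_f]
  generalize (1 - xx) * rX * rC = F at *
  have e : F * (yi * (pc2 tt xx * pc3 tt xx * ev2 tt xx pA * yi * iv (1 - tt * yi) ^ 2 * iv (1 - tt * xy)) + yi * (pc3 tt xx * ev2 tt xx pB * iv (1 - tt * yi) * iv (1 - tt * xy)) +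
      (ev2 tt xx pC + yi * (ev2 tt xx pC * tt * xx * iv (1 - tt * xy))) + yy * (oY * ev3 tt xx yy pQ3)) =
      yi * (F * (pc2 tt xx * pc3 tt xx * ev2 tt xx pA * yi * iv (1 - tt * yi) ^ 2 * iv (1 - tt * xy) + pc3 tt xx * ev2 tt xx pB * iv (1 - tt * yi) * iv (1 - tt * xy) +
       ev2 tt xx pC * tt * xx * iv (1 - tt * xy))) + F * ev2 tt xx pC + yy * (F * (oY * ev3 tt xx yy pQ3)) := by ring
  rw [e, map_add, map_add, CT_yi, CT_yy, zero_add, add_zero]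
  · rw [oY]
    repeat' first | with_reducible exact Ge_one _ | with_reducible exact Ge_tt _ | with_reducible exact m1 | with_reducible exact m2 | with_reducible exact m3 | with_reducible exact m4 | with_reducible exact f2 | with_reducible exact Ge_ev1 _ _ | with_reducible refine Ge_ev2 ?_ _ | with_reducible refine Ge_ev3 ?_ ?_ _ | with_reducible refine Ge_i1 ?_ | with_reducible apply Ge.mul0 | with_reducible apply Ge.pow | with_reducible apply Ge.sub | with_reducible apply Ge.add
  · rw [pc2, pc3]
    repeat' first | with_reducible exact Ge_one _ | with_reducible exact Ge_tt _ | with_reducible exact n1 | with_reducible exact n2 | with_reducible exact n3 | with_reducible exact n4 | with_reducible exact f1 | with_reducible exact Ge_ev1 _ _ | with_reducible refine Ge_ev2 ?_ _ | with_reducible refine Ge_ev3 ?_ ?_ _ | with_reducible refine Ge_i1 ?_ | with_reducible apply Ge.mul0 | with_reducible apply Ge.pow | with_reducible apply Ge.sub | with_reducible apply Ge.add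

lemma x_step : cxp PowerSeries.X * CT Jx = PowerSeries.X * (1 - PowerSeries.X + PowerSeries.X ^ 3 + PowerSeries.X ^ 5 - PowerSeries.X ^ 7 + PowerSeries.X ^ 8) := by
  have hX := xalg tt xx xi (iv (1 - tt * xi)) (iv (1 - tt * (tt * xi))) oX xx_xi
    (by linear_combination mul_iv (cc1 xi) + iv (1 - tt * xi) * xx_xi)
    (by linear_combination mul_iv (cc1 (tt * xi)) + iv (1 - tt * (tt * xi)) * xx_xi) oX_h
  have key : io (cxp PowerSeries.X) = cxp tt := by
    simp only [cxp, map_mul io, map_pow io, map_sub io, map_add io, map_one, io_X]; rfl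
  have key2 : tt * (1 - tt + tt ^ 3 + tt ^ 5 - tt ^ 7 + tt ^ 8) = io (PowerSeries.X * (1 - PowerSeries.X + PowerSeries.X ^ 3 + PowerSeries.X ^ 5 - PowerSeries.X ^ 7 + PowerSeries.X ^ 8)) := by
    simp only [map_mul io, map_pow io, map_sub io, map_add io, map_one, io_X]; rfl
  have n2 : Ge (wv 1) 0 xi := ((Ge_zz1 1).mono (by norm_num)).mul0 (Ge_zi0 (by decide))
  have m1 : Ge (-wv 1) 0 xx := (Ge_zz0n (by decide)).mul0 ((Ge_zi1n 1).mono (by norm_num))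
  rw [← CT_io, key, cxp, Jx, hX, rA5_e, key2, map_add, map_add, map_add, map_add, map_add, map_add, CT_xi, CT_xi, CT_xi, CT_xi, CT_xi, CT_xx, CT_io']
  · ring
  · rw [oX]
    repeat' first | with_reducible exact Ge_one _ | with_reducible exact Ge_tt _ | with_reducible exact m1 | with_reducible exact Ge_ev1 _ _ | with_reducible refine Ge_ev2 ?_ _ | with_reducible refine Ge_ev3 ?_ ?_ _ | with_reducible refine Ge_i1 ?_ | with_reducible apply Ge.mul0 | with_reducible apply Ge.pow | with_reducible apply Ge.sub | with_reducible apply Ge.add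
  · rw [← key2]
    repeat' first | with_reducible exact Ge_one _ | with_reducible exact Ge_tt _ | with_reducible exact n2 | with_reducible exact Ge_ev1 _ _ | with_reducible refine Ge_ev2 ?_ _ | with_reducible refine Ge_ev3 ?_ ?_ _ | with_reducible refine Ge_i1 ?_ | with_reducible apply Ge.mul0 | with_reducible apply Ge.pow | with_reducible apply Ge.sub | with_reducible apply Ge.add
  · repeat' first | with_reducible exact Ge_one _ | with_reducible exact Ge_tt _ | with_reducible exact n2 | with_reducible exact Ge_ev1 _ _ | with_reducible refine Ge_ev2 ?_ _ | with_reducible refine Ge_ev3 ?_ ?_ _ | with_reducible refine Ge_i1 ?_ | with_reducible apply Ge.mul0 | with_reducible apply Ge.pow | with_reducible apply Ge.sub | with_reducible apply Ge.add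
  · repeat' first | with_reducible exact Ge_one _ | with_reducible exact Ge_tt _ | with_reducible exact n2 | with_reducible exact Ge_ev1 _ _ | with_reducible refine Ge_ev2 ?_ _ | with_reducible refine Ge_ev3 ?_ ?_ _ | with_reducible refine Ge_i1 ?_ | with_reducible apply Ge.mul0 | with_reducible apply Ge.pow | with_reducible apply Ge.sub | with_reducible apply Ge.add
  · repeat' first | with_reducible exact Ge_one _ | with_reducible exact Ge_tt _ | with_reducible exact n2 | with_reducible exact Ge_ev1 _ _ | with_reducible refine Ge_ev2 ?_ _ | with_reducible refine Ge_ev3 ?_ ?_ _ | with_reducible refine Ge_i1 ?_ | with_reducible apply Ge.mul0 | with_reducible apply Ge.pow | with_reducible apply Ge.sub | with_reducible apply Ge.add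
  · repeat' first | with_reducible exact Ge_one _ | with_reducible exact Ge_tt _ | with_reducible exact n2 | with_reducible exact Ge_ev1 _ _ | with_reducible refine Ge_ev2 ?_ _ | with_reducible refine Ge_ev3 ?_ ?_ _ | with_reducible refine Ge_i1 ?_ | with_reducible apply Ge.mul0 | with_reducible apply Ge.pow | with_reducible apply Ge.sub | with_reducible apply Ge.add

theorem final_PS (K : Type*) [Field K] [CharZero K] :
    (1 - PowerSeries.X) ^ 5 * (1 - PowerSeries.X ^ 2) ^ 4 * (1 - PowerSeries.X ^ 3) ^ 5 * (1 - PowerSeries.X ^ 4) ^ 3 * mixedPS1 K 4 =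
      1 - PowerSeries.X + PowerSeries.X ^ 3 + PowerSeries.X ^ 5 - PowerSeries.X ^ 7 + PowerSeries.X ^ 8 := by
  have h := PS_eq4 K
  have h2 := y_step
  have h3 := x_step
  rw [← h2, ← h] at h3
  apply mul_left_cancel₀ (PowerSeries.X_ne_zero (R := ℚ))
  rw [← h3, cxp, tfp]
  ring

/-- The simply graded Poincaré series of the mixed trace algebra of two generic `4 × 4`
matrices is `P(T_{4,2}; t) = (1 − t + t³ + t⁵ − t⁷ + t⁸) / ((1−t)⁵(1−t²)⁴(1−t³)⁵(1−t⁴)³)`. -/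
theorem poincare_T42_single (K : Type*) [Field K] [CharZero K] :
    mixedPS1 K 4 *
        ((1 - pu) ^ 5 * (1 - pu ^ 2) ^ 4 * (1 - pu ^ 3) ^ 5 * (1 - pu ^ 4) ^ 3) =
      1 - pu + pu ^ 3 + pu ^ 5 - pu ^ 7 + pu ^ 8 := by
  rw [mul_comm]
  exact final_PS K
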